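/- arXiv:2407.08771 — 4 statements merged into one kernel-verified Lean document; each statement's English description precedes it below -/
import Mathlib

section
/- Assume that every linear 3-graph F' with π_co(F') = 0 is layered. Then every 3-graph F with π_co(F) = 0 is layered. -/
open Finset

structure ThreeGraph (V : Type*) where
  edges : Finset (Finset V)
  card_eq : ∀ e ∈ edges, e.card = 3

variable {α β : Type*}

/-- `H` contains a copy of `F`. -/
def HasCopy [DecidableEq β] (H : ThreeGraph β) (F : ThreeGraph α) : Prop :=
  ∃ φ : α → β, Function.Injective φ ∧ ∀ e ∈ F.edges, e.image φ ∈ H.edges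

/-- The codegree of a pair of vertices. -/
def codeg [DecidableEq β] [Fintype β] (H : ThreeGraph β) (u v : β) : ℕ :=
  (Finset.univ.filter (fun w => ({u, v, w} : Finset β) ∈ H.edges)).card

/-- The codegree Turán density of a 3-graph `F`. -/
noncomputable def piCo (F : ThreeGraph α) : ℝ :=
  sSup {x : ℝ | 0 ≤ x ∧ x ≤ 1 ∧ ∀ n₀ : ℕ, ∃ n : ℕ, n₀ ≤ n ∧ ∃ H : ThreeGraph (Fin n),
    ¬ HasCopy H F ∧ ∀ u v : Fin n, u ≠ v → x * n ≤ (codeg H u v : ℝ)}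

/-- An `n`-vertex 3-graph is uniformly `(d, η)`-dense. -/
def UniformlyDense {n : ℕ} (H : ThreeGraph (Fin n)) (d η : ℝ) : Prop :=
  ∀ U : Finset (Fin n),
    d * (U.card.choose 3 : ℝ) - η * (n : ℝ) ^ 3 ≤ ((H.edges.filter (fun e => e ⊆ U)).card : ℝ)

/-- The uniform Turán density of a 3-graph `F`. -/
noncomputable def piUnif (F : ThreeGraph α) : ℝ :=
  sSup {d : ℝ | 0 ≤ d ∧ d ≤ 1 ∧ ∀ η : ℝ, 0 < η → ∀ n₀ : ℕ, ∃ n : ℕ, n₀ ≤ n ∧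
    ∃ H : ThreeGraph (Fin n), ¬ HasCopy H F ∧ UniformlyDense H d η}

/-- `f` is a layered function of the 3-graph with edge set `E`. -/
def IsLayeredFunction [DecidableEq α] (E : Finset (Finset α)) (f : α → ℕ) : Prop :=
  (∀ e ∈ E, ∃ w ∈ e, ∀ u ∈ e, u ≠ w → f u < f w) ∧
  (∀ e₁ ∈ E, ∀ e₂ ∈ E, e₁.sup f = e₂.sup f → Multiset.map f e₁.val = Multiset.map f e₂.val) ∧
  (∀ e₁ ∈ E, ∀ e₂ ∈ E, ∀ u v w u' v' w' : α,
    u ≠ v → u ≠ w → v ≠ w → u' ≠ v' → u' ≠ w' → v' ≠ w' →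
    e₁ = {u, v, w} → e₂ = {u', v', w'} →
    f u = f u' → f v = f v' → f w = f w')

/-- A 3-graph is layered if it admits a layered function. -/
def IsLayered [DecidableEq α] (F : ThreeGraph α) : Prop :=
  ∃ f : α → ℕ, IsLayeredFunction F.edges f

/-- A 3-graph is linear if any two distinct edges share at most one vertex. -/
def IsLinear [DecidableEq α] (F : ThreeGraph α) : Prop :=
  ∀ e₁ ∈ F.edges, ∀ e₂ ∈ F.edges, e₁ ≠ e₂ → (e₁ ∩ e₂).card ≤ 1

/-- A positive proportion of all points of a large `k`-dimensional grid contains a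
`k`-dimensional box of side `t`. -/
theorem exists_box (k t : ℕ) : ∀ c : ℝ, 0 < c → ∃ n₀ : ℕ, ∀ n : ℕ, n₀ ≤ n →
    ∀ S : Finset (Fin k → Fin n), c * (n : ℝ) ^ k ≤ (#S : ℝ) →
      ∃ B : Fin k → Finset (Fin n), (∀ i, #(B i) = t) ∧
        ∀ χ : Fin k → Fin n, (∀ i, χ i ∈ B i) → χ ∈ S := by
  induction k with
  | zero =>
    intro c hc
    refine ⟨0, fun n _ S hS => ⟨fun i => i.elim0, fun i => i.elim0, fun χ _ => ?_⟩⟩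
    have hpos : 0 < #S := by
      have : (0 : ℝ) < #S := lt_of_lt_of_le (by simpa using hc) hS
      exact_mod_cast this
    obtain ⟨y, hy⟩ := Finset.card_pos.mp hpos
    rwa [Subsingleton.elim χ y]
  | succ k ih =>
    intro c hc
    obtain ⟨T, hT⟩ := exists_nat_ge (4 * ((t : ℝ) + 1) / c)
    have hTc : 4 * ((t : ℝ) + 1) ≤ T * c := by rwa [div_le_iff₀ hc] at hT
    have hTpos : (0 : ℝ) < T := by
      have : (0 : ℝ) < 4 * ((t : ℝ) + 1) / c := by positivity
      linarith
    obtain ⟨n₁, hn₁⟩ := ih (c / 4 / 2 ^ T) (by positivity)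
    obtain ⟨n₂, hn₂⟩ := exists_nat_ge (2 * (T : ℝ) / c)
    refine ⟨max (max n₁ n₂) 1, fun n hn S hS => ?_⟩
    have hnn₁ : n₁ ≤ n := le_trans (le_trans (le_max_left _ _) (le_max_left _ _)) hn
    have hnn₂ : n₂ ≤ n := le_trans (le_trans (le_max_right _ _) (le_max_left _ _)) hn
    have hnpos : (0 : ℝ) < n := by exact_mod_cast (le_trans (le_max_right _ _) hn)
    have hpk : (0 : ℝ) < (n : ℝ) ^ k := by positivity
    let fib : Fin n → Finset (Fin k → Fin n) :=
      fun x => univ.filter fun y => (Fin.cons x y : Fin (k + 1) → Fin n) ∈ S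
    have hfib_le : ∀ x, (#(fib x) : ℝ) ≤ (n : ℝ) ^ k := by
      intro x
      have := Finset.card_le_univ (fib x)
      simp only [Fintype.card_fun, Fintype.card_fin] at this
      exact_mod_cast this
    have hsum : (#S : ℝ) ≤ ∑ x, (#(fib x) : ℝ) := by
      have hsub : S ⊆ (univ : Finset (Fin n)).biUnion
          fun x => (fib x).image fun y => (Fin.cons x y : Fin (k + 1) → Fin n) := by
        intro z hz
        simp only [mem_biUnion, mem_univ, true_and, mem_image]
        exact ⟨z 0, Fin.tail z, by simpa [fib] using hz, Fin.cons_self_tail z⟩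
      have := (card_le_card hsub).trans (card_biUnion_le.trans
        (sum_le_sum fun x _ => card_image_le))
      exact_mod_cast this
    let X : Finset (Fin n) := univ.filter fun x => c / 2 * (n : ℝ) ^ k ≤ #(fib x)
    have hX : (T : ℝ) ≤ #X := by
      have h1 : ∑ x, (#(fib x) : ℝ) ≤
          ∑ x, ((if x ∈ X then (n : ℝ) ^ k else 0) + c / 2 * (n : ℝ) ^ k) := by
        refine sum_le_sum fun x _ => ?_
        split_ifs with hx
        · have : 0 ≤ c / 2 * (n : ℝ) ^ k := by positivity
          linarith [hfib_le x]
        · simp only [X, mem_filter, mem_univ, true_and, not_le] at hx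
          linarith
      rw [sum_add_distrib, ← sum_filter, sum_const, sum_const] at h1
      simp only [filter_mem_eq_inter, univ_inter, nsmul_eq_mul, card_univ, Fintype.card_fin] at h1
      have h3 : (c / 2 * n) * (n : ℝ) ^ k ≤ #X * (n : ℝ) ^ k := by
        have : (c / 2 * n) * (n : ℝ) ^ k
          = c * (n : ℝ) ^ (k + 1) - n * (c / 2 * (n : ℝ) ^ k) := by ring
        linarith
      have h4 := le_of_mul_le_mul_right h3 hpk
      have h5 : 2 * (T : ℝ) / c ≤ n := hn₂.trans (by exact_mod_cast hnn₂)
      rw [div_le_iff₀ hc] at h5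
      linarith
    obtain ⟨X', hX'X, hX'card⟩ := Finset.exists_subset_card_eq (s := X) (n := T)
      (by exact_mod_cast hX)
    let nb : (Fin k → Fin n) → Finset (Fin n) :=
      fun y => X'.filter fun x => (Fin.cons x y : Fin (k + 1) → Fin n) ∈ S
    let Y : Finset (Fin k → Fin n) := univ.filter fun y => t ≤ #(nb y)
    have hcount : ∑ x ∈ X', (#(fib x) : ℝ) = ∑ y, (#(nb y) : ℝ) := by
      have : ∑ x ∈ X', #(fib x) = ∑ y, #(nb y) := by
        simp only [fib, nb, card_filter]
        rw [sum_comm]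
      exact_mod_cast this
    have hY : c / 4 * (n : ℝ) ^ k ≤ #Y := by
      have h1 : (T : ℝ) * (c / 2 * (n : ℝ) ^ k) ≤ ∑ x ∈ X', (#(fib x) : ℝ) := by
        have := Finset.card_nsmul_le_sum X' (fun x => (#(fib x) : ℝ)) (c / 2 * (n : ℝ) ^ k)
          (fun x hx => by simpa [X] using hX'X hx)
        simpa [hX'card] using this
      have h2 : ∑ y, (#(nb y) : ℝ) ≤ ∑ y, ((if y ∈ Y then (T : ℝ) else 0) + (t : ℝ)) := by
        refine sum_le_sum fun y _ => ?_
        have h3 : (#(nb y) : ℝ) ≤ T := by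
          rw [← hX'card]; exact_mod_cast card_le_card (filter_subset _ _)
        split_ifs with hy
        · have : (0 : ℝ) ≤ t := by positivity
          linarith
        · simp only [Y, mem_filter, mem_univ, true_and, not_le] at hy
          have : (#(nb y) : ℝ) < t := by exact_mod_cast hy
          linarith
      rw [sum_add_distrib, ← sum_filter, sum_const, sum_const] at h2
      simp only [filter_mem_eq_inter, univ_inter, nsmul_eq_mul, card_univ, Fintype.card_fin,
        Fintype.card_fun, Nat.cast_pow] at h2
      have h3 : c / 4 * (n : ℝ) ^ k * T ≤ #Y * T := by
        have h4 : (t : ℝ) * (n : ℝ) ^ k ≤ T * c / 4 * (n : ℝ) ^ k :=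
          mul_le_mul_of_nonneg_right (by linarith) hpk.le
        nlinarith
      exact le_of_mul_le_mul_right h3 hTpos
    obtain ⟨Q, hQ, hQcard⟩ : ∃ Q ∈ powersetCard t X', c / 4 / 2 ^ T * (n : ℝ) ^ k ≤
        #(univ.filter fun y : Fin k → Fin n =>
          ∀ x ∈ Q, (Fin.cons x y : Fin (k + 1) → Fin n) ∈ S) := by
      by_contra! hcon
      have hsub : Y ⊆ (powersetCard t X').biUnion fun Q =>
          univ.filter fun y : Fin k → Fin n =>
            ∀ x ∈ Q, (Fin.cons x y : Fin (k + 1) → Fin n) ∈ S := by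
        intro y hy
        simp only [Y, mem_filter, mem_univ, true_and] at hy
        obtain ⟨Q, hQ, hc⟩ := Finset.exists_subset_card_eq hy
        simp only [mem_biUnion, mem_powersetCard, mem_filter, mem_univ, true_and]
        exact ⟨Q, ⟨hQ.trans (filter_subset _ _), hc⟩, fun x hx => (mem_filter.mp (hQ hx)).2⟩
      have h1 : #Y ≤ _ := (card_le_card hsub).trans card_biUnion_le
      have hne : (powersetCard t X').Nonempty := by
        rw [powersetCard_nonempty, hX'card]
        have h6 : 0 < #Y := by
          have : (0 : ℝ) < #Y := lt_of_lt_of_le (by positivity) hY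
          exact_mod_cast this
        obtain ⟨y, hy⟩ := card_pos.mp h6
        simp only [Y, mem_filter, mem_univ, true_and] at hy
        exact hy.trans ((card_le_card (filter_subset _ _)).trans hX'card.le)
      have h2 := sum_lt_sum_of_nonempty hne hcon
      rw [sum_const, card_powersetCard, hX'card, nsmul_eq_mul] at h2
      have h3 : ((T.choose t : ℕ) : ℝ) ≤ 2 ^ T := by
        exact_mod_cast Nat.choose_le_two_pow T t
      have h4 : ((T.choose t : ℕ) : ℝ) * (c / 4 / 2 ^ T * (n : ℝ) ^ k) ≤
          2 ^ T * (c / 4 / 2 ^ T * (n : ℝ) ^ k) := mul_le_mul_of_nonneg_right h3 (by positivity)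
      have h5 : (2 : ℝ) ^ T * (c / 4 / 2 ^ T * (n : ℝ) ^ k) = c / 4 * (n : ℝ) ^ k := by
        field_simp
      have h6 : (#Y : ℝ) ≤ ∑ Q ∈ powersetCard t X', (#(univ.filter fun y : Fin k → Fin n =>
            ∀ x ∈ Q, (Fin.cons x y : Fin (k + 1) → Fin n) ∈ S) : ℝ) := by exact_mod_cast h1
      linarith
    obtain ⟨B, hBcard, hB⟩ := hn₁ n hnn₁ _ hQcard
    refine ⟨Fin.cons Q B, fun i => ?_, fun χ hχ => ?_⟩
    · refine Fin.cases ?_ (fun j => ?_) i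
      · simpa using (mem_powersetCard.mp hQ).2
      · simpa using hBcard j
    · have h0 := hB (Fin.tail χ) fun i => by simpa [Fin.tail] using hχ i.succ
      rw [mem_filter] at h0
      simpa using h0.2 (χ 0) (by simpa using hχ 0)

/-- `exists_box` for grids indexed by an arbitrary finite type. -/
theorem exists_box_of_fintype (ι : Type*) [Fintype ι] [DecidableEq ι] (t : ℕ) (c : ℝ)
    (hc : 0 < c) : ∃ n₀ : ℕ, ∀ n : ℕ, n₀ ≤ n →
    ∀ S : Finset (ι → Fin n), c * (n : ℝ) ^ Fintype.card ι ≤ (#S : ℝ) →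
      ∃ B : ι → Finset (Fin n), (∀ i, #(B i) = t) ∧
        ∀ χ : ι → Fin n, (∀ i, χ i ∈ B i) → χ ∈ S := by
  obtain ⟨n₀, h⟩ := exists_box (Fintype.card ι) t c hc
  refine ⟨n₀, fun n hn S hS => ?_⟩
  let e := Fintype.equivFin ι
  obtain ⟨B, hB, hS'⟩ := h n hn (S.map (e.arrowCongr (Equiv.refl _)).toEmbedding)
    (by simpa using hS)
  refine ⟨fun i => B (e i), fun i => hB _, fun χ hχ => ?_⟩
  have := hS' (χ ∘ e.symm) fun i => by simpa using hχ (e.symm i)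
  obtain ⟨χ', hχ', heq⟩ := mem_map.mp this
  have : χ' = χ := by
    funext i
    simpa using congrFun heq (e i)
  rwa [← this]

/-- Exponential-moment bound: few maps `ψ` with `ψ i = a` and `ψ j = b` hit a given large set `D`
rarely. -/
theorem card_sparse_le {n N : ℕ} (y : ℝ) (D : Finset (Fin n))
    (hD : 2 * y * n ≤ #D) (i j : Fin N) (hij : i ≠ j) (a b : Fin n) :
    (#(univ.filter fun ψ : Fin N → Fin n => ψ i = a ∧ ψ j = b ∧
      (#(univ.filter fun k => ψ k ∈ D) : ℝ) < y * N) : ℝ) ≤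
      (2 : ℝ) ^ (y * N) * ((1 - y) * n) ^ (N - 2) := by
  set w : Fin n → ℝ := fun z => if z ∈ D then 1 / 2 else 1 with hw
  have hw0 : ∀ z, 0 ≤ w z := fun z => by simp only [hw]; split_ifs <;> norm_num
  have hw1 : ∀ z, w z ≤ 1 := fun z => by simp only [hw]; split_ifs <;> norm_num
  let box : Fin N → Finset (Fin n) := fun k => if k = i then {a} else if k = j then {b} else univ
  have hprod : ∀ ψ : Fin N → Fin n,
      ∏ k, w (ψ k) = (1 / 2 : ℝ) ^ #(univ.filter fun k => ψ k ∈ D) := by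
    intro ψ
    simp only [hw]
    rw [← prod_filter, prod_const]
  set bad := univ.filter fun ψ : Fin N → Fin n => ψ i = a ∧ ψ j = b ∧
      (#(univ.filter fun k => ψ k ∈ D) : ℝ) < y * N with hbad
  have hlow : (#bad : ℝ) * (2 : ℝ) ^ (-(y * N)) ≤ ∑ ψ ∈ bad, ∏ k, w (ψ k) := by
    rw [← nsmul_eq_mul]
    refine card_nsmul_le_sum _ _ _ fun ψ hψ => ?_
    rw [hprod, one_div, inv_pow, ← Real.rpow_natCast, ← Real.rpow_neg (by norm_num)]
    refine Real.rpow_le_rpow_of_exponent_le (by norm_num) ?_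
    linarith [(mem_filter.mp hψ).2.2.2]
  have hsub : bad ⊆ Fintype.piFinset box := by
    intro ψ hψ
    obtain ⟨-, h1, h2, -⟩ := mem_filter.mp hψ
    rw [Fintype.mem_piFinset]
    intro k
    simp only [box]
    split_ifs with h3 h4
    · simp [h3, h1]
    · simp [h4, h2]
    · simp
  have hup : ∑ ψ ∈ Fintype.piFinset box, ∏ k, w (ψ k) ≤ ((1 - y) * n) ^ (N - 2) := by
    rw [← prod_univ_sum]
    have h1 : ∏ k, ∑ z ∈ box k, w z ≤ ∏ k, if k ∈ ({i, j} : Finset (Fin N)) then (1 : ℝ)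
        else (1 - y) * n := by
      refine prod_le_prod (fun k _ => sum_nonneg fun z _ => hw0 z) fun k _ => ?_
      simp only [box, mem_insert, mem_singleton]
      by_cases h3 : k = i
      · simp [h3, hw1]
      by_cases h4 : k = j
      · simp only [h4, if_true, or_true, hij.symm, if_false, sum_singleton]
        exact hw1 b
      simp only [h3, h4, if_false, or_self]
      have h5 : ∀ z, w z = 1 - (if z ∈ D then (1 / 2 : ℝ) else 0) := fun z => by
        simp only [hw]; split_ifs <;> norm_num
      simp only [h5, sum_sub_distrib, ← sum_filter, sum_const, card_univ, Fintype.card_fin,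
        filter_mem_eq_inter, univ_inter, nsmul_eq_mul]
      linarith
    refine h1.trans (le_of_eq ?_)
    rw [prod_ite, prod_const_one, one_mul, prod_const, filter_not, filter_mem_eq_inter,
      univ_inter, card_univ_sdiff, card_pair hij, Fintype.card_fin]
  have hfin : (#bad : ℝ) * (2 : ℝ) ^ (-(y * N)) ≤ ((1 - y) * n) ^ (N - 2) :=
    hlow.trans ((sum_le_sum_of_subset_of_nonneg hsub
      fun ψ _ _ => prod_nonneg fun k _ => hw0 _).trans hup)
  rw [Real.rpow_neg (by norm_num), ← div_eq_mul_inv, div_le_iff₀ (by positivity)] at hfin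
  linarith

theorem card_eq_at_le {n N : ℕ} (i j : Fin N) (hij : i ≠ j) :
    #(univ.filter fun ψ : Fin N → Fin n => ψ i = ψ j) ≤ n ^ (N - 1) := by
  have hinj : Set.InjOn (fun (ψ : Fin N → Fin n) (k : {k : Fin N // k ≠ j}) => ψ k)
      (univ.filter fun ψ : Fin N → Fin n => ψ i = ψ j : Finset _) := by
    intro ψ hψ ψ' hψ' heq
    simp only [coe_filter, mem_univ, true_and, Set.mem_ofPred_eq] at hψ hψ'
    have hk : ∀ k, k ≠ j → ψ k = ψ' k := fun k hk => congrFun heq ⟨k, hk⟩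
    funext k
    by_cases h : k = j
    · rw [h, ← hψ, ← hψ', hk i hij]
    · exact hk k h
  have := card_le_card_of_injOn _ (fun ψ _ => mem_univ _) hinj
  simpa [Fintype.card_subtype_compl] using this

/-- The random map `ψ : Fin N → Fin n` pulls `H` back to a 3-graph of linear minimum codegree. -/
def IsGoodSample {n N : ℕ} (H : ThreeGraph (Fin n)) (y : ℝ) (ψ : Fin N → Fin n) : Prop :=
  Function.Injective ψ ∧ ∀ i j : Fin N, i ≠ j →
    y * N ≤ (#(univ.filter fun k => ({ψ i, ψ j, ψ k} : Finset (Fin n)) ∈ H.edges) : ℝ)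

open Classical in
theorem card_not_isGoodSample_le {n N : ℕ} (H : ThreeGraph (Fin n)) (y : ℝ) (hy : y ≤ 1)
    (hH : ∀ u v : Fin n, u ≠ v → 2 * y * n ≤ (codeg H u v : ℝ)) :
    (#(univ.filter fun ψ : Fin N → Fin n => ¬ IsGoodSample H y ψ) : ℝ) ≤
      (N : ℝ) ^ 2 * ((n : ℝ) ^ (N - 1) +
        (n : ℝ) ^ 2 * ((2 : ℝ) ^ (y * N) * ((1 - y) * n) ^ (N - 2))) := by
  let D : Fin n × Fin n → Finset (Fin n) := fun p =>
    univ.filter fun w => ({p.1, p.2, w} : Finset (Fin n)) ∈ H.edges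
  let sparse : Fin N × Fin N → Fin n × Fin n → Finset (Fin N → Fin n) := fun q p =>
    univ.filter fun ψ => ψ q.1 = p.1 ∧ ψ q.2 = p.2 ∧
      (#(univ.filter fun k => ψ k ∈ D p) : ℝ) < y * N
  let coll : Fin N × Fin N → Finset (Fin N → Fin n) := fun q =>
    univ.filter fun ψ => ψ q.1 = ψ q.2
  have hsub : (univ.filter fun ψ : Fin N → Fin n => ¬ IsGoodSample H y ψ) ⊆
      (univ : Finset (Fin N)).offDiag.biUnion fun q =>
        coll q ∪ (univ : Finset (Fin n)).offDiag.biUnion (sparse q) := by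
    intro ψ hψ
    have hψ' := (mem_filter.mp hψ).2
    simp only [mem_biUnion, mem_union, mem_offDiag, mem_univ, true_and]
    by_cases hinj : Function.Injective ψ
    · simp only [IsGoodSample, hinj, true_and] at hψ'
      push Not at hψ'
      obtain ⟨i, j, hij, hlt⟩ := hψ'
      refine ⟨(i, j), hij, Or.inr ⟨(ψ i, ψ j), fun h => hij (hinj h), ?_⟩⟩
      simpa [sparse, D] using hlt
    · simp only [Function.Injective] at hinj
      push Not at hinj
      obtain ⟨i, j, heq, hij⟩ := hinj
      exact ⟨(i, j), hij, Or.inl (by simpa [coll] using heq)⟩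
  have hoff : ∀ k : ℕ, (#(univ : Finset (Fin k)).offDiag : ℝ) ≤ (k : ℝ) ^ 2 := by
    intro k
    have : #(univ : Finset (Fin k)).offDiag ≤ k ^ 2 := by
      rw [offDiag_card, card_univ, Fintype.card_fin, sq]
      exact Nat.sub_le _ _
    exact_mod_cast this
  have h1y : 0 ≤ 1 - y := by linarith
  have hsp : ∀ q ∈ (univ : Finset (Fin N)).offDiag,
      (#(coll q ∪ (univ : Finset (Fin n)).offDiag.biUnion (sparse q)) : ℝ) ≤
        (n : ℝ) ^ (N - 1) + (n : ℝ) ^ 2 * ((2 : ℝ) ^ (y * N) * ((1 - y) * n) ^ (N - 2)) := by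
    intro q hq
    have hq' : q.1 ≠ q.2 := (mem_offDiag.mp hq).2.2
    have h1 : (#(coll q) : ℝ) ≤ (n : ℝ) ^ (N - 1) := by exact_mod_cast card_eq_at_le q.1 q.2 hq'
    have h2 : (#((univ : Finset (Fin n)).offDiag.biUnion (sparse q)) : ℝ) ≤
        (n : ℝ) ^ 2 * ((2 : ℝ) ^ (y * N) * ((1 - y) * n) ^ (N - 2)) := by
      have h3 : (#((univ : Finset (Fin n)).offDiag.biUnion (sparse q)) : ℝ) ≤
          ∑ p ∈ (univ : Finset (Fin n)).offDiag, (#(sparse q p) : ℝ) := by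
        exact_mod_cast card_biUnion_le
      refine h3.trans ((sum_le_card_nsmul _ _ _ fun p hp =>
        card_sparse_le y (D p) (hH p.1 p.2 (mem_offDiag.mp hp).2.2) q.1 q.2 hq' p.1 p.2).trans ?_)
      rw [nsmul_eq_mul]
      exact mul_le_mul_of_nonneg_right (hoff n) (by positivity)
    have h4 : (#(coll q ∪ (univ : Finset (Fin n)).offDiag.biUnion (sparse q)) : ℝ) ≤
        #(coll q) + #((univ : Finset (Fin n)).offDiag.biUnion (sparse q)) := by
      exact_mod_cast card_union_le _ _
    linarith
  have h5 : (#(univ.filter fun ψ : Fin N → Fin n => ¬ IsGoodSample H y ψ) : ℝ) ≤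
      ∑ q ∈ (univ : Finset (Fin N)).offDiag,
        (#(coll q ∪ (univ : Finset (Fin n)).offDiag.biUnion (sparse q)) : ℝ) := by
    exact_mod_cast (card_le_card hsub).trans card_biUnion_le
  refine h5.trans ((sum_le_card_nsmul _ _ _ hsp).trans ?_)
  rw [nsmul_eq_mul]
  exact mul_le_mul_of_nonneg_right (hoff N) (by positivity)

open Classical in
/-- For suitable arbitrarily large `N`, at least half of the maps `Fin N → Fin n` are good
samples, provided `n` is large. -/
theorem exists_half_isGoodSample (y : ℝ) (hy₀ : 0 < y) (hy₁ : y ≤ 1 / 2) (n₀ : ℕ) :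
    ∃ N : ℕ, n₀ ≤ N ∧ 2 ≤ N ∧ ∀ n : ℕ, 4 * N ^ 2 ≤ n → ∀ H : ThreeGraph (Fin n),
      (∀ u v : Fin n, u ≠ v → 2 * y * n ≤ (codeg H u v : ℝ)) →
      (n : ℝ) ^ N ≤ 2 * #(univ.filter fun ψ : Fin N → Fin n => IsGoodSample H y ψ) := by
  set q : ℝ := (2 : ℝ) ^ y * (1 - y) with hq
  have hq0 : 0 ≤ q := mul_nonneg (by positivity) (by linarith)
  have hq1 : q < 1 := by
    have h1 : (1 + 1 : ℝ) ^ y ≤ 1 + y * 1 :=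
      rpow_one_add_le_one_add_mul_self (by norm_num) hy₀.le (by linarith)
    have h2 : (2 : ℝ) ^ y ≤ 1 + y := by norm_num at h1 ⊢; exact h1
    have h3 : q ≤ (1 + y) * (1 - y) := mul_le_mul_of_nonneg_right h2 (by linarith)
    nlinarith
  have htend := tendsto_pow_const_mul_const_pow_of_abs_lt_one 2 (r := q)
    (by rwa [abs_of_nonneg hq0])
  obtain ⟨N, hN, hNle⟩ := ((htend.eventually (gt_mem_nhds (by norm_num : (0 : ℝ) < 1 / 16))).and
    (Filter.eventually_ge_atTop (max n₀ 2))).exists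
  have hN2 : 2 ≤ N := le_trans (le_max_right _ _) hNle
  refine ⟨N, le_trans (le_max_left _ _) hNle, hN2, fun n hn H hH => ?_⟩
  have hbad := card_not_isGoodSample_le (N := N) H y (by linarith) hH
  have hsplit := card_filter_add_card_filter_not (s := (univ : Finset (Fin N → Fin n)))
    (fun ψ => IsGoodSample H y ψ)
  rw [card_univ, Fintype.card_fun, Fintype.card_fin, Fintype.card_fin] at hsplit
  have hsplit' : (#(univ.filter fun ψ : Fin N → Fin n => IsGoodSample H y ψ) : ℝ) +
      #(univ.filter fun ψ : Fin N → Fin n => ¬ IsGoodSample H y ψ) = (n : ℝ) ^ N := by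
    exact_mod_cast hsplit
  obtain ⟨K, rfl⟩ : ∃ K, N = K + 2 := ⟨N - 2, by omega⟩
  have hnR : 4 * ((K + 2 : ℕ) : ℝ) ^ 2 ≤ n := by exact_mod_cast hn
  have h1 : ((K + 2 : ℕ) : ℝ) ^ 2 * (n : ℝ) ^ (K + 2 - 1) ≤ (n : ℝ) ^ (K + 2) / 4 := by
    have : (n : ℝ) ^ (K + 2) = n * (n : ℝ) ^ (K + 2 - 1) := by
      rw [← pow_succ']; congr 1
    rw [this]
    have h0 : (0 : ℝ) ≤ (n : ℝ) ^ (K + 2 - 1) := by positivity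
    nlinarith
  have h2 : ((K + 2 : ℕ) : ℝ) ^ 2 * ((n : ℝ) ^ 2 * ((2 : ℝ) ^ (y * (K + 2 : ℕ)) *
      ((1 - y) * n) ^ (K + 2 - 2))) ≤ (n : ℝ) ^ (K + 2) / 4 := by
    have h3 : (2 : ℝ) ^ (y * (K + 2 : ℕ)) = ((2 : ℝ) ^ y) ^ (K + 2) := by
      rw [Real.rpow_mul (by norm_num), Real.rpow_natCast]
    have h4 : (1 - y) ^ K ≤ 4 * (1 - y) ^ (K + 2) := by
      have h5 : (0 : ℝ) ≤ (1 - y) ^ K := pow_nonneg (by linarith) _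
      have h6 : 1 ≤ 4 * (1 - y) ^ 2 := by nlinarith
      rw [pow_add]
      nlinarith
    have h7 : 0 ≤ ((K + 2 : ℕ) : ℝ) ^ 2 * (n : ℝ) ^ (K + 2) * ((2 : ℝ) ^ y) ^ (K + 2) := by
      positivity
    calc _ = ((K + 2 : ℕ) : ℝ) ^ 2 * (n : ℝ) ^ (K + 2) * ((2 : ℝ) ^ y) ^ (K + 2) *
          (1 - y) ^ K := by
          rw [h3, Nat.add_sub_cancel, mul_pow]; ring
      _ ≤ ((K + 2 : ℕ) : ℝ) ^ 2 * (n : ℝ) ^ (K + 2) * ((2 : ℝ) ^ y) ^ (K + 2) *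
          (4 * (1 - y) ^ (K + 2)) := mul_le_mul_of_nonneg_left h4 h7
      _ = 4 * (n : ℝ) ^ (K + 2) * (((K + 2 : ℕ) : ℝ) ^ 2 * q ^ (K + 2)) := by
          rw [hq, mul_pow]; ring
      _ ≤ 4 * (n : ℝ) ^ (K + 2) * (1 / 16) := mul_le_mul_of_nonneg_left hN.le (by positivity)
      _ = _ := by ring
  rw [mul_add] at hbad
  linarith

/-- Maps whose restriction along an injection `φ` lies in `S`. -/
theorem card_comp_mem_le {ι : Type*} [Fintype ι] [DecidableEq ι] {n N : ℕ} (φ : ι → Fin N)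
    (hφ : Function.Injective φ) (S : Finset (ι → Fin n)) :
    #(univ.filter fun ψ : Fin N → Fin n => ψ ∘ φ ∈ S) ≤ #S * n ^ (N - Fintype.card ι) := by
  classical
  have hinj : Set.InjOn (fun ψ : Fin N → Fin n =>
      (ψ ∘ φ, fun k : {k : Fin N // k ∉ Set.range φ} => ψ k))
      (univ.filter fun ψ : Fin N → Fin n => ψ ∘ φ ∈ S : Finset _) := by
    intro ψ _ ψ' _ heq
    simp only [Prod.mk.injEq] at heq
    funext k
    by_cases hk : k ∈ Set.range φ
    · obtain ⟨i, rfl⟩ := hk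
      exact congrFun heq.1 i
    · exact congrFun heq.2 ⟨k, hk⟩
  have hcard : Fintype.card {k : Fin N // k ∉ Set.range φ} = N - Fintype.card ι := by
    rw [Fintype.card_subtype_compl, Fintype.card_fin]
    congr 1
    exact Set.card_range_of_injective hφ
  have := card_le_card_of_injOn (t := S ×ˢ (univ : Finset ({k : Fin N // k ∉ Set.range φ} → Fin n)))
    _ (fun ψ hψ => by simpa using hψ) hinj
  rwa [card_product, card_univ, Fintype.card_fun, hcard, Fintype.card_fin] at this

/-- The 3-graph on `Fin N` obtained by pulling back `H` along `ψ`. -/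
def pullback {n N : ℕ} (H : ThreeGraph (Fin n)) (ψ : Fin N → Fin n) : ThreeGraph (Fin N) where
  edges := (powersetCard 3 univ).filter fun e => e.image ψ ∈ H.edges
  card_eq _ he := (mem_powersetCard.mp (mem_filter.mp he).1).2

theorem le_codeg_pullback {n N : ℕ} (H : ThreeGraph (Fin n)) (y : ℝ) (ψ : Fin N → Fin n)
    (hψ : IsGoodSample H y ψ) (i j : Fin N) (hij : i ≠ j) :
    y * N ≤ (codeg (pullback H ψ) i j : ℝ) := by
  refine (hψ.2 i j hij).trans ?_
  have hsub : (univ.filter fun k => ({ψ i, ψ j, ψ k} : Finset (Fin n)) ∈ H.edges) ⊆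
      univ.filter fun k => ({i, j, k} : Finset (Fin N)) ∈ (pullback H ψ).edges := by
    intro k hk
    have hk' := (mem_filter.mp hk).2
    have himg : ({i, j, k} : Finset (Fin N)).image ψ = {ψ i, ψ j, ψ k} := by
      simp [image_insert]
    have hcard : #({i, j, k} : Finset (Fin N)) = 3 := by
      rw [← card_image_of_injective _ hψ.1, himg]
      exact H.card_eq _ hk'
    simp only [pullback, mem_filter, mem_univ, true_and, mem_powersetCard, subset_univ, hcard,
      himg, hk', and_self]
  exact_mod_cast card_le_card hsub

/-- If all dense 3-graphs on `Fin N` contain `F`, then a positive proportion of all maps into a large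
dense 3-graph are injective homomorphisms from `F`. -/
theorem card_embeddings_ge {γ : Type*} [Fintype γ] [DecidableEq γ] (F : ThreeGraph γ) (y : ℝ)
    {n N : ℕ} (hn : 0 < n) (hN : 0 < N) (H : ThreeGraph (Fin n))
    (hF : ∀ G : ThreeGraph (Fin N), (∀ u v, u ≠ v → y * N ≤ (codeg G u v : ℝ)) → HasCopy G F)
    [DecidablePred fun ψ : Fin N → Fin n => IsGoodSample H y ψ]
    [DecidablePred fun χ : γ → Fin n =>
      Function.Injective χ ∧ ∀ e ∈ F.edges, e.image χ ∈ H.edges]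
    (hgood : (n : ℝ) ^ N ≤ 2 * #(univ.filter fun ψ : Fin N → Fin n => IsGoodSample H y ψ)) :
    1 / (2 * (N : ℝ) ^ Fintype.card γ) * (n : ℝ) ^ Fintype.card γ ≤
      #(univ.filter fun χ : γ → Fin n =>
        Function.Injective χ ∧ ∀ e ∈ F.edges, e.image χ ∈ H.edges) := by
  classical
  set S := univ.filter fun χ : γ → Fin n =>
        Function.Injective χ ∧ ∀ e ∈ F.edges, e.image χ ∈ H.edges with hS
  set good := univ.filter fun ψ : Fin N → Fin n => IsGoodSample H y ψ with hg
  have hcopy : ∀ ψ ∈ good, ∃ φ : γ → Fin N, Function.Injective φ ∧ ψ ∘ φ ∈ S := by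
    intro ψ hψ
    have hψ' : IsGoodSample H y ψ := (mem_filter.mp hψ).2
    obtain ⟨φ, hφ, he⟩ := hF (pullback H ψ) (le_codeg_pullback H y ψ hψ')
    refine ⟨φ, hφ, mem_filter.mpr ⟨mem_univ _, hψ'.1.comp hφ, fun e heF => ?_⟩⟩
    rw [← image_image]
    exact (mem_filter.mp (he e heF)).2
  have hcardle : Fintype.card γ ≤ N := by
    have hpos : 0 < #good := by
      have h1 : (0 : ℝ) < (n : ℝ) ^ N := by positivity
      have h2 : (0 : ℝ) < #good := by linarith
      exact_mod_cast h2
    obtain ⟨ψ, hψ⟩ := card_pos.mp hpos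
    obtain ⟨φ, hφ, -⟩ := hcopy ψ hψ
    simpa using Fintype.card_le_of_injective φ hφ
  have hsub : good ⊆ ((univ : Finset (γ → Fin N)).filter fun φ => Function.Injective φ).biUnion
      fun φ => univ.filter fun ψ => ψ ∘ φ ∈ S := by
    intro ψ hψ
    obtain ⟨φ, hφ, h⟩ := hcopy ψ hψ
    exact mem_biUnion.mpr ⟨φ, mem_filter.mpr ⟨mem_univ _, hφ⟩, mem_filter.mpr ⟨mem_univ _, h⟩⟩
  have hle : #good ≤ N ^ Fintype.card γ * (#S * n ^ (N - Fintype.card γ)) := by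
    refine (card_le_card hsub).trans (card_biUnion_le.trans ?_)
    refine (sum_le_card_nsmul _ _ _ fun φ hφ =>
      card_comp_mem_le φ (mem_filter.mp hφ).2 S).trans ?_
    rw [smul_eq_mul]
    refine Nat.mul_le_mul_right _ ((card_le_univ _).trans ?_)
    rw [Fintype.card_fun, Fintype.card_fin]
  have hle' : (#good : ℝ) ≤ (N : ℝ) ^ Fintype.card γ *
      (#S * (n : ℝ) ^ (N - Fintype.card γ)) := by exact_mod_cast hle
  have hsplit : (n : ℝ) ^ N = (n : ℝ) ^ Fintype.card γ * (n : ℝ) ^ (N - Fintype.card γ) := by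
    rw [← pow_add, Nat.add_sub_cancel' hcardle]
  have hfin : (n : ℝ) ^ Fintype.card γ * (n : ℝ) ^ (N - Fintype.card γ) ≤
      (2 * (N : ℝ) ^ Fintype.card γ * #S) * (n : ℝ) ^ (N - Fintype.card γ) := by
    rw [← hsplit]; linarith
  have hfin' := le_of_mul_le_mul_right hfin (by positivity)
  rw [one_div, inv_mul_le_iff₀ (by positivity)]
  exact hfin'

/-- A box of embeddings of `F` into `H` yields a copy of every subgraph of the blow-up of `F`. -/
theorem hasCopy_of_box {γ : Type*} [Fintype γ] [DecidableEq γ] (F : ThreeGraph γ) {n t : ℕ}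
    (ht : 0 < t) (H : ThreeGraph (Fin n)) (F' : ThreeGraph (γ × Fin t))
    (hF' : ∀ e ∈ F'.edges, e.image Prod.fst ∈ F.edges) (B : γ → Finset (Fin n))
    (hB : ∀ i, #(B i) = t)
    (hχ : ∀ χ : γ → Fin n, (∀ i, χ i ∈ B i) →
      Function.Injective χ ∧ ∀ e ∈ F.edges, e.image χ ∈ H.edges) : HasCopy H F' := by
  let φ : γ × Fin t → Fin n := fun p => ((B p.1).equivFinOfCardEq (hB p.1)).symm p.2
  have hφmem : ∀ p, φ p ∈ B p.1 := fun p => Subtype.prop _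
  refine ⟨φ, ?_, fun e he => ?_⟩
  · rintro ⟨u, a⟩ ⟨v, b⟩ heq
    by_cases huv : u = v
    · subst huv
      have : a = b := by simpa [φ, Subtype.ext_iff] using heq
      rw [this]
    · exfalso
      let χ : γ → Fin n := fun w => if w = u then φ (u, a) else if w = v then φ (v, b) else
        φ (w, ⟨0, ht⟩)
      have hmem : ∀ w, χ w ∈ B w := by
        intro w
        simp only [χ]
        split_ifs with h1 h2
        · rw [h1]; exact hφmem (u, a)
        · rw [h2]; exact hφmem (v, b)
        · exact hφmem (w, _)
      have hval : χ u = χ v := by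
        simp only [χ, if_true, if_neg (Ne.symm huv)]
        exact heq
      exact huv ((hχ χ hmem).1 hval)
  · have hinj : Set.InjOn Prod.fst (e : Set (γ × Fin t)) := by
      rw [← card_image_iff, F.card_eq _ (hF' e he), F'.card_eq e he]
    let χ : γ → Fin n := fun w =>
      if h : ∃ a, (w, a) ∈ e then φ (w, h.choose) else φ (w, ⟨0, ht⟩)
    have hmem : ∀ w, χ w ∈ B w := by
      intro w
      simp only [χ]
      split_ifs
      · exact hφmem (w, _)
      · exact hφmem (w, _)
    have hval : ∀ p ∈ e, χ p.1 = φ p := by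
      intro p hp
      have hex : ∃ a, (p.1, a) ∈ e := ⟨p.2, hp⟩
      have h1 : χ p.1 = φ (p.1, hex.choose) := dif_pos hex
      exact h1.trans (congrArg φ (hinj (mem_coe.mpr hex.choose_spec) hp rfl))
    have himg : e.image φ = (e.image Prod.fst).image χ := by
      rw [image_image]
      exact image_congr fun p hp => (hval p hp).symm
    rw [himg]
    exact (hχ χ hmem).2 _ (hF' e he)

/-- Passing to a subgraph of a blow-up preserves vanishing codegree Turán density. -/
theorem piCo_eq_zero_of_blowup {γ : Type*} [Fintype γ] [DecidableEq γ] (F : ThreeGraph γ)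
    (hF : piCo F = 0) {t : ℕ} (ht : 0 < t) (F' : ThreeGraph (γ × Fin t))
    (hF' : ∀ e ∈ F'.edges, e.image Prod.fst ∈ F.edges) : piCo F' = 0 := by
  classical
  refine le_antisymm (Real.sSup_nonpos ?_) (Real.sSup_nonneg fun x hx => hx.1)
  rintro x ⟨hx0, hx1, hx⟩
  by_contra hxpos
  push Not at hxpos
  suffices hmem : x / 2 ≤ piCo F by linarith
  refine le_csSup ⟨1, fun z hz => hz.2.1⟩ ⟨by linarith, by linarith, ?_⟩
  by_contra hcon
  push Not at hcon
  obtain ⟨n₀, hn₀⟩ := hcon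
  obtain ⟨N, hNn₀, hN2, hN⟩ := exists_half_isGoodSample (x / 2) (by linarith) (by linarith) n₀
  have hNpos : (0 : ℝ) < N := by exact_mod_cast (by omega : 0 < N)
  obtain ⟨n₁, hbox⟩ := exists_box_of_fintype γ t (1 / (2 * (N : ℝ) ^ Fintype.card γ))
    (by positivity)
  obtain ⟨n, hn, H, hfree, hcodeg⟩ := hx (max n₁ (4 * N ^ 2))
  have hn2 : 4 * N ^ 2 ≤ n := le_trans (le_max_right _ _) hn
  have hnpos : 0 < n := lt_of_lt_of_le (by positivity) hn2
  have hgood := hN n hn2 H fun u v huv => by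
    have := hcodeg u v huv
    linarith
  have hcard := card_embeddings_ge F (x / 2) hnpos (by omega : 0 < N) H (fun G hG => by
    by_contra hG'
    obtain ⟨u, v, huv, hlt⟩ := hn₀ N hNn₀ G hG'
    exact absurd (hG u v huv) (not_le.mpr hlt)) hgood
  obtain ⟨B, hB, hχ⟩ := hbox n (le_trans (le_max_left _ _) hn) _ hcard
  exact hfree (hasCopy_of_box F ht H F' hF' B hB fun χ h => (mem_filter.mp (hχ χ h)).2)

/-- The 3-sets of `Ω` meeting some member of a family `L` of 3-sets in at least two points
are few. -/
theorem card_conflict_le {V : Type*} [Fintype V] [DecidableEq V] (Ω L : Finset (Finset V))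
    (hΩ : ∀ e ∈ Ω, #e = 3) (hL : ∀ e ∈ L, #e = 3) :
    #(Ω.filter fun e => ∃ l ∈ L, 2 ≤ #(e ∩ l)) ≤ #L * 3 * Fintype.card V := by
  have hsub : (Ω.filter fun e => ∃ l ∈ L, 2 ≤ #(e ∩ l)) ⊆
      ((L.biUnion fun l => powersetCard 2 l) ×ˢ (univ : Finset V)).image
        fun p => insert p.2 p.1 := by
    intro e he
    obtain ⟨heΩ, l, hl, h2⟩ := mem_filter.mp he
    obtain ⟨p, hp, hpc⟩ := exists_subset_card_eq h2
    have hpe : p ⊆ e := hp.trans inter_subset_left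
    have h1 : #(e \ p) = 1 := by rw [card_sdiff_of_subset hpe, hpc, hΩ e heΩ]
    obtain ⟨x, hx⟩ := card_eq_one.mp h1
    refine mem_image.mpr ⟨(p, x), ?_, ?_⟩
    · simp only [mem_product, mem_biUnion, mem_powersetCard, mem_univ, and_true]
      exact ⟨l, hl, hp.trans inter_subset_right, hpc⟩
    · change insert x p = e
      rw [insert_eq, ← hx, sdiff_union_of_subset hpe]
  refine (card_le_card hsub).trans (card_image_le.trans ?_)
  rw [card_product, card_univ]
  refine Nat.mul_le_mul_right _ (card_biUnion_le.trans ?_)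
  rw [← smul_eq_mul]
  refine sum_le_card_nsmul _ _ _ fun l hl => ?_
  rw [card_powersetCard, hL l hl]
  decide

/-- Greedy choice of a linear family of 3-sets: if each set `A c` with `c ∈ 𝒞` misses at least `M`
members of `Ω`, then some linear subfamily `L` of `Ω` is contained in only few of the `A c`. -/
theorem exists_linear_family {V C : Type*} [Fintype V] [DecidableEq V]
    (Ω : Finset (Finset V)) (hΩ : ∀ e ∈ Ω, #e = 3) (𝒞 : Finset C) (A : C → Finset (Finset V))
    (M : ℕ) (hM₀ : 0 < M) (hM : ∀ c ∈ 𝒞, M ≤ #(Ω \ A c)) (δ : ℝ) (hδ₀ : 0 < δ) (hδ₁ : δ ≤ 1)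
    (hδ : δ * (2 * (Fintype.card V : ℝ) ^ 3) ≤ M) (k : ℕ)
    (hk : k * 6 * Fintype.card V ≤ M) :
    ∃ L ⊆ Ω, #L ≤ k ∧ (∀ e₁ ∈ L, ∀ e₂ ∈ L, e₁ ≠ e₂ → #(e₁ ∩ e₂) ≤ 1) ∧
      (#(𝒞.filter fun c => L ⊆ A c) : ℝ) ≤ (1 - δ) ^ k * #𝒞 := by
  classical
  induction k with
  | zero => exact ⟨∅, by simp⟩
  | succ k ih =>
    obtain ⟨L, hLΩ, hLk, hlin, hcount⟩ := ih (le_trans (by gcongr; omega) hk)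
    set R := 𝒞.filter fun c => L ⊆ A c with hR
    have hstep : ∃ L' ⊆ Ω, #L' ≤ k + 1 ∧
        (∀ e₁ ∈ L', ∀ e₂ ∈ L', e₁ ≠ e₂ → #(e₁ ∩ e₂) ≤ 1) ∧
        (#(𝒞.filter fun c => L' ⊆ A c) : ℝ) ≤ (1 - δ) * #R := by
      rcases R.eq_empty_or_nonempty with hRe | hRne
      · refine ⟨L, hLΩ, by omega, hlin, ?_⟩
        rw [← hR, hRe]; simp
      set Q := Ω.filter fun e => ∃ l ∈ L, 2 ≤ #(e ∩ l) with hQ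
      have hQcard : 2 * #Q ≤ M := by
        have h1 := card_conflict_le Ω L hΩ fun e he => hΩ e (hLΩ he)
        have h2 : #L * 3 * Fintype.card V ≤ (k + 1) * 3 * Fintype.card V := by gcongr; omega
        rw [← hQ] at h1
        have h3 : (k + 1) * 6 * Fintype.card V = 2 * ((k + 1) * 3 * Fintype.card V) := by ring
        omega
      have havail : ∀ c ∈ R, M ≤ 2 * #((Ω \ Q).filter fun e => e ∉ A c) := by
        intro c hc
        have h1 := hM c (mem_filter.mp hc).1
        have h2 : Ω \ A c ⊆ ((Ω \ Q).filter fun e => e ∉ A c) ∪ Q := by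
          intro e he
          simp only [mem_sdiff, mem_union, mem_filter] at he ⊢
          tauto
        have h3 := (card_le_card h2).trans (card_union_le _ _)
        omega
      have hΩcard : #Ω ≤ Fintype.card V ^ 3 := by
        have h1 : Ω ⊆ powersetCard 3 univ := fun e he =>
          mem_powersetCard.mpr ⟨subset_univ _, hΩ e he⟩
        have h2 := card_le_card h1
        rw [card_powersetCard, card_univ] at h2
        exact h2.trans (Nat.choose_le_pow _ _)
      have hdouble : ∑ e ∈ Ω \ Q, #(R.filter fun c => e ∉ A c) =
          ∑ c ∈ R, #((Ω \ Q).filter fun e => e ∉ A c) := by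
        simp only [card_filter]
        rw [sum_comm]
      have hlow : #R * M ≤ 2 * ∑ e ∈ Ω \ Q, #(R.filter fun c => e ∉ A c) := by
        rw [hdouble, mul_sum, ← smul_eq_mul]
        exact card_nsmul_le_sum _ _ _ havail
      have hne : (Ω \ Q).Nonempty := by
        obtain ⟨c, hc⟩ := hRne
        have h1 : 0 < #((Ω \ Q).filter fun e => e ∉ A c) := by
          have := havail c hc
          omega
        exact (card_pos.mp h1).mono (filter_subset _ _)
      obtain ⟨e, he, heR⟩ : ∃ e ∈ Ω \ Q, δ * #R ≤ #(R.filter fun c => e ∉ A c) := by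
        by_contra! hcon
        have h1 := sum_lt_sum_of_nonempty hne hcon
        rw [sum_const, nsmul_eq_mul] at h1
        have h2 : (#(Ω \ Q) : ℝ) ≤ (Fintype.card V : ℝ) ^ 3 := by
          exact_mod_cast (card_le_card sdiff_subset).trans hΩcard
        have h3 : (#(Ω \ Q) : ℝ) * (δ * #R) ≤ (Fintype.card V : ℝ) ^ 3 * (δ * #R) :=
          mul_le_mul_of_nonneg_right h2 (by positivity)
        have h4 : (#R * M : ℝ) ≤ 2 * ∑ e ∈ Ω \ Q, (#(R.filter fun c => e ∉ A c) : ℝ) := by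
          exact_mod_cast hlow
        have h5 : (#R : ℝ) * (δ * (2 * (Fintype.card V : ℝ) ^ 3)) ≤ #R * M :=
          mul_le_mul_of_nonneg_left hδ (by positivity)
        linarith
      obtain ⟨heΩ, heQ⟩ := mem_sdiff.mp he
      have heL : ∀ l ∈ L, #(e ∩ l) ≤ 1 := by
        intro l hl
        by_contra hcon
        exact heQ (mem_filter.mpr ⟨heΩ, l, hl, by omega⟩)
      refine ⟨insert e L, insert_subset heΩ hLΩ, (card_insert_le _ _).trans (by omega), ?_, ?_⟩
      · intro e₁ h₁ e₂ h₂ hne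
        rcases mem_insert.mp h₁ with h₁' | h₁' <;>
          rcases mem_insert.mp h₂ with h₂' | h₂'
        · exact absurd (h₁'.trans h₂'.symm) hne
        · rw [h₁']; exact heL _ h₂'
        · rw [h₂', inter_comm]; exact heL _ h₁'
        · exact hlin _ h₁' _ h₂' hne
      · have h1 : (𝒞.filter fun c => insert e L ⊆ A c) = R.filter fun c => e ∈ A c := by
          ext c
          simp only [hR, mem_filter, insert_subset_iff]
          tauto
        have h2 := card_filter_add_card_filter_not (s := R) (fun c => e ∈ A c)
        have h3 : (#(R.filter fun c => e ∈ A c) : ℝ) + #(R.filter fun c => e ∉ A c) = #R := by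
          exact_mod_cast h2
        rw [h1]
        linarith
    obtain ⟨L', h1, h2, h3, h4⟩ := hstep
    refine ⟨L', h1, h2, h3, h4.trans ?_⟩
    calc (1 - δ) * (#R : ℝ) ≤ (1 - δ) * ((1 - δ) ^ k * #𝒞) :=
          mul_le_mul_of_nonneg_left hcount (by linarith)
      _ = _ := by ring

/-- The multisets of `f`-values of the members of `E`. -/
def valuePatterns {V : Type*} (E : Finset (Finset V)) (f : V → ℕ) : Set (Multiset ℕ) :=
  {M | ∃ e ∈ E, e.val.map f = M}

/-- The conditions on a set of value patterns that make the underlying function layered. -/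
structure PatternsLayered (P : Set (Multiset ℕ)) : Prop where
  strict_max : ∀ a b c : ℕ, ({a, b, c} : Multiset ℕ) ∈ P →
    (b < a ∧ c < a) ∨ (a < b ∧ c < b) ∨ (a < c ∧ b < c)
  eq_of_sup_eq : ∀ M ∈ P, ∀ M' ∈ P, M.sup = M'.sup → M = M'
  third_unique : ∀ a b c c' : ℕ, ({a, b, c} : Multiset ℕ) ∈ P → ({a, b, c'} : Multiset ℕ) ∈ P →
    c = c'

theorem val_triple {V : Type*} [DecidableEq V] {u v w : V} (huv : u ≠ v) (huw : u ≠ w)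
    (hvw : v ≠ w) : ({u, v, w} : Finset V).val = {u, v, w} := by
  rw [insert_val_of_notMem (by simp [huv, huw]), insert_val_of_notMem (by simp [hvw])]
  rfl

theorem exists_triple_of_map_eq {V : Type*} [DecidableEq V] {e : Finset V} {f : V → ℕ}
    {a b c : ℕ} (h : e.val.map f = {a, b, c}) :
    ∃ u v w, u ≠ v ∧ u ≠ w ∧ v ≠ w ∧ e = {u, v, w} ∧ f u = a ∧ f v = b ∧ f w = c := by
  obtain ⟨u, hu, hfu, h⟩ := (Multiset.map_eq_cons _ _ _ _).mpr h
  obtain ⟨v, hv, hfv, h⟩ := (Multiset.map_eq_cons _ _ _ _).mpr h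
  obtain ⟨w, hw, hfw⟩ := Multiset.map_eq_singleton.mp h
  rw [← erase_val] at hv hw
  rw [← erase_val] at hw
  have hw' : (e.erase u).erase v = {w} := val_injective hw
  have hv' : v ∈ e.erase u := hv
  have hu' : u ∈ e := hu
  have hwm : w ∈ (e.erase u).erase v := by rw [hw']; exact mem_singleton_self w
  rw [mem_erase, mem_erase] at hwm
  rw [mem_erase] at hv'
  refine ⟨u, v, w, Ne.symm hv'.1, Ne.symm hwm.2.1, Ne.symm hwm.1, ?_, hfu, hfv, hfw⟩
  rw [← hw', insert_erase (mem_erase.mpr hv'), insert_erase hu']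

theorem IsLayeredFunction.patternsLayered {V : Type*} [DecidableEq V] {E : Finset (Finset V)}
    {f : V → ℕ} (hf : IsLayeredFunction E f) : PatternsLayered (valuePatterns E f) where
  strict_max a b c := by
    rintro ⟨e, he, hM⟩
    obtain ⟨u, v, w, huv, huw, hvw, rfl, rfl, rfl, rfl⟩ := exists_triple_of_map_eq hM
    obtain ⟨z, hz, hmax⟩ := hf.1 _ he
    simp only [mem_insert, mem_singleton] at hz hmax
    rcases hz with rfl | rfl | rfl
    · exact Or.inl ⟨hmax v (by simp) huv.symm, hmax w (by simp) huw.symm⟩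
    · exact Or.inr (Or.inl ⟨hmax u (by simp) huv, hmax w (by simp) hvw.symm⟩)
    · exact Or.inr (Or.inr ⟨hmax u (by simp) huw, hmax v (by simp) hvw⟩)
  eq_of_sup_eq := by
    rintro _ ⟨e, he, rfl⟩ _ ⟨e', he', rfl⟩ h
    exact hf.2.1 e he e' he' h
  third_unique a b c c' := by
    rintro ⟨e, he, hM⟩ ⟨e', he', hM'⟩
    obtain ⟨u, v, w, h1, h2, h3, heq, hu, hv, rfl⟩ := exists_triple_of_map_eq hM
    obtain ⟨u', v', w', h1', h2', h3', heq', hu', hv', rfl⟩ := exists_triple_of_map_eq hM'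
    exact hf.2.2 e he e' he' u v w u' v' w' h1 h2 h3 h1' h2' h3' heq heq'
      (hu.trans hu'.symm) (hv.trans hv'.symm)

theorem PatternsLayered.isLayeredFunction {V : Type*} [DecidableEq V] (F : ThreeGraph V)
    {f : V → ℕ} {P : Set (Multiset ℕ)} (hP : PatternsLayered P)
    (hmem : ∀ e ∈ F.edges, e.val.map f ∈ P) : IsLayeredFunction F.edges f := by
  refine ⟨fun e he => ?_,
    fun e₁ h₁ e₂ h₂ hsup => hP.eq_of_sup_eq _ (hmem e₁ h₁) _ (hmem e₂ h₂) hsup,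
    fun e₁ h₁ e₂ h₂ u v w u' v' w' huv huw hvw huv' huw' hvw' heq heq' hu hv => ?_⟩
  · obtain ⟨u, v, w, huv, huw, hvw, rfl⟩ := card_eq_three.mp (F.card_eq e he)
    have h := hmem _ he
    rw [val_triple huv huw hvw] at h
    rcases hP.strict_max (f u) (f v) (f w) (by simpa using h) with h | h | h
    · exact ⟨u, by simp, by simp [h.1, h.2]⟩
    · exact ⟨v, by simp, by simp [h.1, h.2]⟩
    · exact ⟨w, by simp, by simp [h.1, h.2]⟩
  · have h1 := hmem _ h₁
    have h2 := hmem _ h₂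
    rw [heq, val_triple huv huw hvw] at h1
    rw [heq', val_triple huv' huw' hvw'] at h2
    refine hP.third_unique (f u) (f v) _ _ (by simpa using h1) ?_
    rw [hu, hv]
    simpa using h2

/-- The edge set of the `t`-blow-up of `F`. -/
def blowupEdges {γ : Type*} [Fintype γ] [DecidableEq γ] (F : ThreeGraph γ) (t : ℕ) :
    Finset (Finset (γ × Fin t)) :=
  univ.filter fun e => #e = 3 ∧ e.image Prod.fst ∈ F.edges

theorem card_le_card_missed {γ : Type*} [Fintype γ] [DecidableEq γ] (F : ThreeGraph γ) {t : ℕ}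
    (f : γ × Fin t → ℕ) (P : Set (Multiset ℕ)) [DecidablePred (· ∈ P)] {u v w : γ} (huv : u ≠ v)
    (huw : u ≠ w) (hvw : v ≠ w) (he : ({u, v, w} : Finset γ) ∈ F.edges)
    (Z : Finset ((Fin t × Fin t) × Fin t))
    (hZ : ∀ z ∈ Z, ({f (u, z.2), f (v, z.1.1), f (w, z.1.2)} : Multiset ℕ) ∉ P) :
    #Z ≤ #((blowupEdges F t).filter fun e => e.val.map f ∉ P) := by
  refine card_le_card_of_injOn
    (fun z => ({(u, z.2), (v, z.1.1), (w, z.1.2)} : Finset (γ × Fin t))) ?_ ?_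
  · intro z hz
    have h1 : ((u, z.2) : γ × Fin t) ≠ (v, z.1.1) := fun h => huv (congrArg Prod.fst h)
    have h2 : ((u, z.2) : γ × Fin t) ≠ (w, z.1.2) := fun h => huw (congrArg Prod.fst h)
    have h3 : ((v, z.1.1) : γ × Fin t) ≠ (w, z.1.2) := fun h => hvw (congrArg Prod.fst h)
    simp only [blowupEdges, coe_filter, mem_filter, mem_univ, true_and, Set.mem_ofPred_eq]
    refine ⟨⟨card_eq_three.mpr ⟨_, _, _, h1, h2, h3, rfl⟩, ?_⟩, ?_⟩
    · simpa [image_insert] using he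
    · rw [val_triple h1 h2 h3]
      simpa using hZ z hz
  · rintro ⟨⟨y, z⟩, x⟩ _ ⟨⟨y', z'⟩, x'⟩ _ heq
    simp only at heq
    have hx : (u, x) ∈ ({(u, x'), (v, y'), (w, z')} : Finset (γ × Fin t)) := by
      rw [← heq]; simp
    have hy : (v, y) ∈ ({(u, x'), (v, y'), (w, z')} : Finset (γ × Fin t)) := by
      rw [← heq]; simp
    have hz : (w, z) ∈ ({(u, x'), (v, y'), (w, z')} : Finset (γ × Fin t)) := by
      rw [← heq]; simp
    simp [huv, huw, hvw, huv.symm, huw.symm, hvw.symm] at hx hy hz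
    rw [hx, hy, hz]

/-- If `F` is not layered, then any layered set of patterns is missed by many edges of the blow-up
of `F`. -/
theorem card_missed_ge {γ : Type*} [Fintype γ] [DecidableEq γ] (F : ThreeGraph γ)
    (hF : ¬ IsLayered F) (s : ℕ) (f : γ × Fin (2 * s) → ℕ) (P : Set (Multiset ℕ))
    [DecidablePred (· ∈ P)] (hP : PatternsLayered P) :
    s ^ 3 ≤ #((blowupEdges F (2 * s)).filter fun e => e.val.map f ∉ P) := by
  classical
  let cls : γ → ℕ → Finset (Fin (2 * s)) := fun u a => univ.filter fun x => f (u, x) = a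
  by_cases hmaj : ∀ e ∈ F.edges, ∀ u ∈ e, ∃ a, s ≤ #(cls u a)
  · let c : γ → ℕ := fun u => if h : ∃ a, s ≤ #(cls u a) then h.choose else 0
    have hc : ∀ e ∈ F.edges, ∀ u ∈ e, s ≤ #(cls u (c u)) := by
      intro e he u hu
      have h := hmaj e he u hu
      have : c u = h.choose := dif_pos h
      rw [this]
      exact h.choose_spec
    obtain ⟨e, he, hePat⟩ : ∃ e ∈ F.edges, e.val.map c ∉ P := by
      by_contra! hcon
      exact hF ⟨c, hP.isLayeredFunction F hcon⟩
    obtain ⟨u, v, w, huv, huw, hvw, rfl⟩ := card_eq_three.mp (F.card_eq e he)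
    rw [val_triple huv huw hvw] at hePat
    refine le_trans ?_ (card_le_card_missed F f P huv huw hvw he
      ((cls v (c v) ×ˢ cls w (c w)) ×ˢ cls u (c u)) ?_)
    · rw [card_product, card_product]
      calc s ^ 3 = s * s * s := by ring
        _ ≤ _ := Nat.mul_le_mul (Nat.mul_le_mul (hc _ he v (by simp)) (hc _ he w (by simp)))
            (hc _ he u (by simp))
    · intro z hz
      simp only [mem_product, cls, mem_filter, mem_univ, true_and] at hz
      rw [hz.1.1, hz.1.2, hz.2]
      simpa using hePat
  · push Not at hmaj
    obtain ⟨e, he, u, hu, hsmall⟩ := hmaj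
    have h2 : #(e.erase u) = 2 := by rw [card_erase_of_mem hu, F.card_eq e he]
    obtain ⟨v, w, hvw, hvweq⟩ := card_eq_two.mp h2
    have huv : u ≠ v := by
      have : v ∈ e.erase u := by simp [hvweq]
      exact (mem_erase.mp this).1.symm
    have huw : u ≠ w := by
      have : w ∈ e.erase u := by simp [hvweq]
      exact (mem_erase.mp this).1.symm
    have heq : e = {u, v, w} := by rw [← hvweq, insert_erase hu]
    rw [heq] at he
    refine le_trans ?_ (card_le_card_missed F f P huv huw hvw he
      (univ.filter fun z => ({f (u, z.2), f (v, z.1.1), f (w, z.1.2)} : Multiset ℕ) ∉ P)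
      fun z hz => (mem_filter.mp hz).2)
    rw [card_filter, Fintype.sum_prod_type]
    have hfib : ∀ p ∈ (univ : Finset (Fin (2 * s) × Fin (2 * s))), s ≤ ∑ x : Fin (2 * s),
        if ({f (u, x), f (v, p.1), f (w, p.2)} : Multiset ℕ) ∉ P then 1 else 0 := by
      intro p _
      rw [← card_filter]
      have hsplit := card_filter_add_card_filter_not (s := (univ : Finset (Fin (2 * s))))
        (fun x => ({f (u, x), f (v, p.1), f (w, p.2)} : Multiset ℕ) ∈ P)
      rw [card_univ, Fintype.card_fin] at hsplit
      have hle : #(univ.filter fun x : Fin (2 * s) =>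
          ({f (u, x), f (v, p.1), f (w, p.2)} : Multiset ℕ) ∈ P) ≤ s := by
        rcases (univ.filter fun x : Fin (2 * s) =>
          ({f (u, x), f (v, p.1), f (w, p.2)} : Multiset ℕ) ∈ P).eq_empty_or_nonempty
          with h0 | ⟨x₀, hx₀⟩
        · rw [h0]; simp
        · refine (card_le_card fun x hx => ?_).trans (hsmall (f (u, x₀))).le
          have hrot : ∀ a b c : ℕ, ({a, b, c} : Multiset ℕ) = {b, c, a} := by
            intro a b c
            change a ::ₘ b ::ₘ {c} = b ::ₘ c ::ₘ {a}
            rw [Multiset.cons_swap]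
            congr 1
            exact Multiset.pair_comm a c
          have hx₁ := (mem_filter.mp hx₀).2
          have hx₂ := (mem_filter.mp hx).2
          rw [hrot] at hx₁ hx₂
          exact mem_filter.mpr ⟨mem_univ _, hP.third_unique _ _ _ _ hx₂ hx₁⟩
      omega
    refine le_trans ?_ (card_nsmul_le_sum _ _ _ hfib)
    rw [card_univ, Fintype.card_prod, Fintype.card_fin, smul_eq_mul]
    nlinarith [Nat.zero_le (s ^ 3)]

/-- A finite encoding of a function with unbounded values, up to renaming of the values, and of a
set of at most one value pattern per value. -/
abbrev PatternCode (V : Type*) := (V → V) × (V → Option (V × V × V))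

/-- The 3-sets whose pattern is encoded by `c`. -/
def PatternCode.allowed {V : Type*} [Fintype V] [DecidableEq V] (c : PatternCode V) :
    Finset (Finset V) :=
  univ.filter fun e => ∃ k, ∃ p : V × V × V,
    c.2 k = some p ∧ e.val.map c.1 = {p.1, p.2.1, p.2.2}

theorem exists_patternCode {V : Type*} [Fintype V] [DecidableEq V] [Nonempty V] (F : ThreeGraph V)
    {f : V → ℕ} (hf : IsLayeredFunction F.edges f) :
    ∃ c : PatternCode V, ∀ e, e ∈ c.allowed ↔ e.val.map f ∈ valuePatterns F.edges f := by
  classical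
  let ρ : ℕ → V := Function.invFun f
  have hρ : ∀ v, f (ρ (f v)) = f v := fun v => Function.invFun_eq ⟨v, rfl⟩
  have hmap : ∀ M : Multiset V, (M.map (ρ ∘ f)).map f = M.map f := by
    intro M
    rw [Multiset.map_map]
    exact Multiset.map_congr rfl fun v _ => hρ v
  have htrip : ∀ k : V, (∃ e ∈ F.edges, e.sup f = f k) →
      ∃ p : V × V × V, ∃ e ∈ F.edges, e.sup f = f k ∧
        e.val.map (ρ ∘ f) = {p.1, p.2.1, p.2.2} := by
    rintro k ⟨e, he, hk⟩
    obtain ⟨u, v, w, huv, huw, hvw, rfl⟩ := card_eq_three.mp (F.card_eq e he)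
    refine ⟨(ρ (f u), ρ (f v), ρ (f w)), _, he, hk, ?_⟩
    rw [val_triple huv huw hvw]
    simp
  let g : V → Option (V × V × V) := fun k =>
    if h : ∃ e ∈ F.edges, e.sup f = f k then some (htrip k h).choose else none
  refine ⟨(ρ ∘ f, g), fun e => ?_⟩
  simp only [PatternCode.allowed, mem_filter, mem_univ, true_and]
  constructor
  · rintro ⟨k, p, hgk, hpat⟩
    by_cases h : ∃ e ∈ F.edges, e.sup f = f k
    · have hgk' : g k = some (htrip k h).choose := dif_pos h
      rw [hgk', Option.some_inj] at hgk
      obtain ⟨e', he', -, hpat'⟩ := (htrip k h).choose_spec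
      rw [hgk, ← hpat] at hpat'
      refine ⟨e', he', ?_⟩
      rw [← hmap e'.val, hpat', hmap]
    · have hgk' : g k = none := dif_neg h
      rw [hgk'] at hgk
      exact absurd hgk (by simp)
  · rintro ⟨e', he', hpat⟩
    obtain ⟨k, hk, hmax⟩ := hf.1 e' he'
    have hsup : e'.sup f = f k := by
      refine le_antisymm (Finset.sup_le fun u hu => ?_) (Finset.le_sup hk)
      by_cases huk : u = k
      · rw [huk]
      · exact (hmax u hu huk).le
    have h : ∃ e ∈ F.edges, e.sup f = f k := ⟨e', he', hsup⟩
    obtain ⟨e'', he'', hsup'', hpat''⟩ := (htrip k h).choose_spec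
    refine ⟨k, (htrip k h).choose, dif_pos h, ?_⟩
    rw [← hpat'']
    have h1 : e.val.map f = e''.val.map f :=
      hpat.symm.trans (hf.2.1 e' he' e'' he'' (hsup.trans hsup''.symm))
    rw [← Multiset.map_map, ← Multiset.map_map, h1]

theorem card_patternCode (V : Type*) [Fintype V] [DecidableEq V] :
    Fintype.card (PatternCode V) =
      Fintype.card V ^ Fintype.card V * (Fintype.card V ^ 3 + 1) ^ Fintype.card V := by
  simp only [PatternCode, Fintype.card_prod, Fintype.card_fun, Fintype.card_option]
  congr 3
  ring

/-- The greedy choice beats the number of pattern codes once the blow-up is large. -/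
theorem exists_blowup_size (n : ℕ) (hn : 0 < n) : ∃ r : ℕ, 0 < r ∧
    (1 - 1 / (16 * (n : ℝ) ^ 3)) ^ (12 * n * r ^ 2) *
      (((24 * n ^ 2 * r : ℕ) : ℝ) ^ (24 * n ^ 2 * r) *
        (((24 * n ^ 2 * r : ℕ) : ℝ) ^ 3 + 1) ^ (24 * n ^ 2 * r)) < 1 := by
  have hn1 : (1 : ℝ) ≤ n := by exact_mod_cast hn
  have hn3 : (1 : ℝ) ≤ (n : ℝ) ^ 3 := one_le_pow₀ hn1
  set d : ℝ := 1 - 1 / (16 * (n : ℝ) ^ 3) with hd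
  have hd0 : 0 ≤ d := by
    have : 1 / (16 * (n : ℝ) ^ 3) ≤ 1 := by
      rw [div_le_one (by positivity)]; linarith
    linarith
  have hd1 : d < 1 := by
    have : 0 < 1 / (16 * (n : ℝ) ^ 3) := by positivity
    linarith
  set q : ℝ := d ^ (12 * n) with hq
  have hq0 : 0 ≤ q := pow_nonneg hd0 _
  have hq1 : q < 1 := pow_lt_one₀ hd0 hd1 (by omega)
  set C : ℝ := (2 * (24 * (n : ℝ) ^ 2) ^ 4) ^ (24 * n ^ 2) with hC
  have hCpos : 0 < C := by positivity
  have htend := tendsto_pow_const_mul_const_pow_of_abs_lt_one (96 * n ^ 2) (r := q)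
    (by rwa [abs_of_nonneg hq0])
  obtain ⟨r, hr, hr1⟩ := ((htend.eventually (gt_mem_nhds (by positivity : (0 : ℝ) < 1 / C))).and
    (Filter.eventually_ge_atTop 1)).exists
  refine ⟨r, hr1, ?_⟩
  set m : ℝ := ((24 * n ^ 2 * r : ℕ) : ℝ) with hm
  have hmval : m = 24 * (n : ℝ) ^ 2 * r := by rw [hm]; push_cast; ring
  have hm1 : 1 ≤ m := by
    have : 1 ≤ 24 * n ^ 2 * r := Nat.mul_pos (by positivity) hr1
    rw [hm]; exact_mod_cast this
  have hbase : m * (m ^ 3 + 1) ≤ 2 * m ^ 4 := by nlinarith [one_le_pow₀ hm1 (n := 3)]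
  have hinner : q ^ r * (2 * m ^ 4) ^ (24 * n ^ 2) < 1 := by
    have h1 : (2 * m ^ 4) ^ (24 * n ^ 2) = C * (r : ℝ) ^ (96 * n ^ 2) := by
      rw [hC, hmval, show 96 * n ^ 2 = 4 * (24 * n ^ 2) by ring, pow_mul (r : ℝ), ← mul_pow]
      congr 1
      ring
    rw [h1]
    rw [lt_div_iff₀ hCpos] at hr
    linarith
  calc d ^ (12 * n * r ^ 2) * (m ^ (24 * n ^ 2 * r) * (m ^ 3 + 1) ^ (24 * n ^ 2 * r))
      = (q ^ r * (m * (m ^ 3 + 1)) ^ (24 * n ^ 2)) ^ r := by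
        rw [hq, ← mul_pow, mul_pow _ _ r, ← pow_mul, ← pow_mul, ← pow_mul]
        congr 2
        ring
    _ ≤ (q ^ r * (2 * m ^ 4) ^ (24 * n ^ 2)) ^ r := by
        gcongr
    _ < 1 := pow_lt_one₀ (by positivity) hinner (by omega)

/-- A non-layered 3-graph has a non-layered linear subgraph in one of its blow-ups. -/
theorem exists_linear_not_isLayered {γ : Type*} [Fintype γ] [DecidableEq γ] (F : ThreeGraph γ)
    (hF : ¬ IsLayered F) : ∃ t : ℕ, 0 < t ∧ ∃ F' : ThreeGraph (γ × Fin t),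
      (∀ e ∈ F'.edges, e.image Prod.fst ∈ F.edges) ∧ IsLinear F' ∧ ¬ IsLayered F' := by
  classical
  have hne : Nonempty γ := by
    by_contra hemp
    rw [not_nonempty_iff] at hemp
    have hno : ∀ e ∈ F.edges, False := by
      intro e he
      have := F.card_eq e he
      rw [eq_empty_of_isEmpty e] at this
      simp at this
    exact hF ⟨fun _ => 0, fun e he => (hno e he).elim, fun e he => (hno e he).elim,
      fun e he => (hno e he).elim⟩
  set n := Fintype.card γ with hn
  have hnpos : 0 < n := Fintype.card_pos
  have hnR : (1 : ℝ) ≤ n := by exact_mod_cast hnpos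
  obtain ⟨r, hr, hsize⟩ := exists_blowup_size n hnpos
  set s := 12 * n * r with hs
  have hspos : 0 < s := by positivity
  have : NeZero (2 * s) := ⟨by omega⟩
  have hcardV : Fintype.card (γ × Fin (2 * s)) = 24 * n ^ 2 * r := by
    rw [Fintype.card_prod, Fintype.card_fin, ← hn, hs]; ring
  let 𝒞 : Finset (PatternCode (γ × Fin (2 * s))) :=
    univ.filter fun c => s ^ 3 ≤ #(blowupEdges F (2 * s) \ c.allowed)
  have hn3 : (1 : ℝ) ≤ (n : ℝ) ^ 3 := one_le_pow₀ hnR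
  obtain ⟨L, hLΩ, -, hlin, hcount⟩ := exists_linear_family (blowupEdges F (2 * s))
    (fun e he => (mem_filter.mp he).2.1) 𝒞 PatternCode.allowed (s ^ 3) (by positivity)
    (fun c hc => (mem_filter.mp hc).2) (1 / (16 * (n : ℝ) ^ 3)) (by positivity)
    (by rw [div_le_one (by positivity)]; linarith)
    (by
      rw [hcardV, hs]
      push_cast
      apply le_of_eq
      field_simp
      ring)
    (12 * n * r ^ 2) (by rw [hcardV, hs]; apply le_of_eq; ring)
  have hnone : 𝒞.filter (fun c => L ⊆ c.allowed) = ∅ := by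
    rw [← card_eq_zero]
    have h𝒞 : (#𝒞 : ℝ) ≤ ((24 * n ^ 2 * r : ℕ) : ℝ) ^ (24 * n ^ 2 * r) *
        (((24 * n ^ 2 * r : ℕ) : ℝ) ^ 3 + 1) ^ (24 * n ^ 2 * r) := by
      have := card_le_univ 𝒞
      rw [card_patternCode, hcardV] at this
      exact_mod_cast this
    have hnonneg : 0 ≤ (1 - 1 / (16 * (n : ℝ) ^ 3)) ^ (12 * n * r ^ 2) := by
      refine pow_nonneg ?_ _
      have : 1 / (16 * (n : ℝ) ^ 3) ≤ 1 := by
        rw [div_le_one (by positivity)]; linarith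
      linarith
    have hlt := (hcount.trans (mul_le_mul_of_nonneg_left h𝒞 hnonneg)).trans_lt hsize
    have hlt' : #(𝒞.filter fun c => L ⊆ c.allowed) < 1 := by exact_mod_cast hlt
    omega
  let F' : ThreeGraph (γ × Fin (2 * s)) := ⟨L, fun e he => (mem_filter.mp (hLΩ he)).2.1⟩
  refine ⟨2 * s, by omega, F', fun e he => (mem_filter.mp (hLΩ he)).2.2, hlin, ?_⟩
  rintro ⟨f, hf⟩
  obtain ⟨c, hc⟩ := exists_patternCode F' hf
  have hmiss := card_missed_ge F hF s f _ hf.patternsLayered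
  have hset : (blowupEdges F (2 * s)).filter
      (fun e => e.val.map f ∉ valuePatterns F'.edges f) = blowupEdges F (2 * s) \ c.allowed := by
    ext e
    rw [mem_filter, mem_sdiff, hc]
  rw [hset] at hmiss
  have hcmem : c ∈ 𝒞.filter fun c => L ⊆ c.allowed :=
    mem_filter.mpr ⟨mem_filter.mpr ⟨mem_univ _, hmiss⟩, fun e he => (hc e).mpr ⟨e, he, rfl⟩⟩
  rw [hnone] at hcmem
  exact absurd hcmem (notMem_empty _)

/-- If every linear 3-graph with vanishing codegree Turán density is layered, then every
3-graph with vanishing codegree Turán density is layered. -/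
theorem stmt2
    (h : ∀ (γ : Type) [Fintype γ] [DecidableEq γ] (F' : ThreeGraph γ),
      IsLinear F' → piCo F' = 0 → IsLayered F') :
    ∀ (γ : Type) [Fintype γ] [DecidableEq γ] (F : ThreeGraph γ),
      piCo F = 0 → IsLayered F := by
  intro γ _ _ F hF
  by_contra hlay
  obtain ⟨t, ht, F', hsub, hlin, hlay'⟩ := exists_linear_not_isLayered F hlay
  exact hlay' (h _ F' hlin (piCo_eq_zero_of_blowup F hF ht F' hsub))
end

section
/- Let F be a (2,1)-type 3-graph with parts A (first layer) and B (second layer). Then π_co(F) = 0 if and only if there is a labeling σ of A such that for every vertex v ∈ B the link graph L_F(v) (whose edges all lie inside A) contains no monotone P3 under σ. -/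
open Finset

variable {α β : Type*}

/-- A labeling of a finite set `A`: a bijection from `A` onto `{1, …, |A|}`. -/
def IsLabeling [DecidableEq α] (A : Finset α) (σ : α → ℕ) : Prop :=
  Set.BijOn σ ↑A ↑(Finset.Icc 1 A.card)

section IteratedLimits

open Filter

/-- If `R t t'` for almost all `t` and almost all `t'`, there are arbitrarily long sequences along
which `R` holds between earlier and later terms. -/
lemma exists_fin_seq_of_eventually {T : Type*} (𝒱 : Filter T) [𝒱.NeBot] {R : T → T → Prop}
    (hR : ∀ᶠ t in 𝒱, ∀ᶠ t' in 𝒱, R t t') (N : ℕ) :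
    ∀ P : T → Prop, (∀ᶠ t in 𝒱, P t) →
      ∃ t : Fin N → T, (∀ i, P (t i)) ∧ ∀ i j, i < j → R (t i) (t j) := by
  induction N with
  | zero => exact fun P _ => ⟨Fin.elim0, fun i => i.elim0, fun i => i.elim0⟩
  | succ N ih =>
    intro P hP
    obtain ⟨t₀, hP₀, hR₀⟩ := (hP.and hR).exists
    obtain ⟨t, ht, htR⟩ := ih (fun t' => P t' ∧ R t₀ t') (hP.and hR₀)
    refine ⟨Fin.cons t₀ t, fun i => ?_, fun i j => ?_⟩
    · refine Fin.cases hP₀ (fun i => ?_) i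
      simpa using (ht i).1
    · refine Fin.cases ?_ (fun i => ?_) i <;> refine Fin.cases ?_ (fun j => ?_) j
      · simp
      · simpa using (ht j).2
      · simp
      · simpa using htR i j

/-- An ultrafilter picks one out of finitely many alternatives. -/
lemma Ultrafilter.exists_eventually_of_eventually_exists {T ι : Type*} [Finite ι]
    (𝒱 : Ultrafilter T) {P : ι → T → Prop} (h : ∀ᶠ t in 𝒱, ∃ i, P i t) :
    ∃ i, ∀ᶠ t in 𝒱, P i t := by
  by_contra! hne
  have : ∀ᶠ t in 𝒱, ∀ i, ¬ P i t :=
    eventually_all.2 fun i => hne i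
  obtain ⟨t, ⟨i, hi⟩, ht⟩ := (h.and this).exists
  exact ht i hi

variable {S : Type*} [SemilatticeInf S] [OrderTop S]

/-- Points of `ℕ` are chosen one after the other, almost everywhere with respect to `𝒰`, following
the word `w`. A letter `true` adds the point `a` to the set `L` of lower points, a letter `false`
intersects the current event with `E l a` for all lower points `l` chosen so far. The final event
has to be `Big` with parameter `c`. -/
def GoodWord (𝒰 : Ultrafilter ℕ) (E : ℕ → ℕ → S) (Big : ℝ → S → Prop) (c : ℝ) :
    List Bool → Finset ℕ → S → Prop
  | [], _, X => Big c X
  | true :: w, L, X => ∀ᶠ a in 𝒰, GoodWord 𝒰 E Big c w (insert a L) X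
  | false :: w, L, X => ∀ᶠ a in 𝒰, GoodWord 𝒰 E Big c w L (X ⊓ L.inf fun l => E l a)

variable {𝒰 : Ultrafilter ℕ} {E : ℕ → ℕ → S} {Big : ℝ → S → Prop}

lemma GoodWord.mono (hmono : ∀ c X Y, X ≤ Y → Big c X → Big c Y) {c : ℝ} {w : List Bool} :
    ∀ {L L' : Finset ℕ} {X X' : S}, L' ⊆ L → X ≤ X' → GoodWord 𝒰 E Big c w L X →
      GoodWord 𝒰 E Big c w L' X' := by
  induction w with
  | nil => exact fun _ hX h => hmono _ _ _ hX h
  | cons x w ih =>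
    intro L L' X X' hL hX h
    cases x
    · exact Eventually.mono h fun a ha => ih hL (inf_le_inf hX (Finset.inf_mono hL)) ha
    · exact Eventually.mono h fun a ha => ih (Finset.insert_subset_insert a hL) hX ha

/-- Transformations of a word may be performed behind common initial letters. -/
lemma GoodWord.append_of_imp {c c' : ℝ} {w w' : List Bool}
    (h : ∀ L X, GoodWord 𝒰 E Big c w L X → GoodWord 𝒰 E Big c' w' L X) (p : List Bool) :
    ∀ L X, GoodWord 𝒰 E Big c (p ++ w) L X → GoodWord 𝒰 E Big c' (p ++ w') L X := by
  induction p with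
  | nil => exact h
  | cons x p ih =>
    intro L X hg
    cases x
    · exact Eventually.mono hg fun a ha => ih _ _ ha
    · exact Eventually.mono hg fun a ha => ih _ _ ha

/-- Pigeonhole for events: among `N` events that are big with parameter `p`, two have an
intersection that is big with parameter `η`. -/
def PairPigeonhole (Big : ℝ → S → Prop) (p η : ℝ) (N : ℕ) : Prop :=
  ∀ X : Fin N → S, (∀ i, Big p (X i)) → ∃ i j, i < j ∧ Big η (X i ⊓ X j)

lemma GoodWord.exists_pair {p η : ℝ} {N : ℕ} (hN : PairPigeonhole Big p η N) (w : List Bool) :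
    ∀ (L : Fin N → Finset ℕ) (X : Fin N → S), (∀ i, GoodWord 𝒰 E Big p w (L i) (X i)) →
      ∃ i j, i < j ∧ GoodWord 𝒰 E Big η w (L i ∪ L j) (X i ⊓ X j) := by
  induction w with
  | nil => exact fun _ X h => hN X h
  | cons x w ih =>
    intro L X h
    have key : ∃ q : {q : Fin N × Fin N // q.1 < q.2},
        GoodWord 𝒰 E Big η (x :: w) (L q.1.1 ∪ L q.1.2) (X q.1.1 ⊓ X q.1.2) := by
      cases x
      · refine 𝒰.exists_eventually_of_eventually_exists ?_
        have h' : ∀ᶠ a in 𝒰, ∀ i,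
            GoodWord 𝒰 E Big p w (L i) (X i ⊓ (L i).inf fun l => E l a) :=
          eventually_all.2 h
        refine h'.mono fun a ha => ?_
        obtain ⟨i, j, hij, hg⟩ := ih _ _ ha
        refine ⟨⟨(i, j), hij⟩, ?_⟩
        rwa [Finset.inf_union, inf_inf_inf_comm]
      · refine 𝒰.exists_eventually_of_eventually_exists ?_
        have h' : ∀ᶠ a in 𝒰, ∀ i, GoodWord 𝒰 E Big p w (insert a (L i)) (X i) :=
          eventually_all.2 h
        refine h'.mono fun a ha => ?_
        obtain ⟨i, j, hij, hg⟩ := ih _ _ ha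
        refine ⟨⟨(i, j), hij⟩, ?_⟩
        rwa [Finset.insert_union_distrib]
    obtain ⟨⟨⟨i, j⟩, hij⟩, hg⟩ := key
    exact ⟨i, j, hij, hg⟩

/-- If almost all states of a family are good, then so is the join of almost all pairs. -/
lemma GoodWord.eventually_pair {p η : ℝ} {N : ℕ} (hN : PairPigeonhole Big p η N) (w : List Bool)
    {T : Type*} (𝒱 : Ultrafilter T) (L : T → Finset ℕ) (X : T → S)
    (h : ∀ᶠ t in 𝒱, GoodWord 𝒰 E Big p w (L t) (X t)) :
    ∀ᶠ t in 𝒱, ∀ᶠ t' in 𝒱, GoodWord 𝒰 E Big η w (L t ∪ L t') (X t ⊓ X t') := by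
  by_contra hne
  have hne' : ∀ᶠ t in 𝒱, ∀ᶠ t' in 𝒱, ¬ GoodWord 𝒰 E Big η w (L t ∪ L t') (X t ⊓ X t') := by
    simpa only [Ultrafilter.eventually_not] using Ultrafilter.eventually_not.2 hne
  obtain ⟨t, ht, htR⟩ := exists_fin_seq_of_eventually (𝒱 : Filter T) hne' N _ h
  obtain ⟨i, j, hij, hg⟩ := GoodWord.exists_pair hN w _ _ ht
  exact htR i j hij hg

lemma GoodWord.big (hmono : ∀ c X Y, X ≤ Y → Big c X → Big c Y) {c : ℝ} (w : List Bool) :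
    ∀ (L : Finset ℕ) (X : S), GoodWord 𝒰 E Big c w L X → Big c X := by
  induction w with
  | nil => exact fun _ _ h => h
  | cons x w ih =>
    intro L X h
    cases x
    · obtain ⟨a, ha⟩ := Eventually.exists h
      exact hmono _ _ _ inf_le_left (ih _ _ ha)
    · obtain ⟨a, ha⟩ := Eventually.exists h
      exact ih _ _ ha

lemma GoodWord.double_true (hmono : ∀ c X Y, X ≤ Y → Big c X → Big c Y) {p η : ℝ} {N : ℕ}
    (hN : PairPigeonhole Big p η N) (w : List Bool)
    (L : Finset ℕ) (X : S) (h : GoodWord 𝒰 E Big p (true :: w) L X) :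
    GoodWord 𝒰 E Big η (true :: true :: w) L X := by
  refine (GoodWord.eventually_pair hN w 𝒰 (fun a => insert a L) (fun _ => X) h).mono
    fun a ha => Eventually.mono ha fun b hb => GoodWord.mono hmono ?_ inf_le_left hb
  intro z
  simp only [Finset.mem_insert, Finset.mem_union]
  tauto

lemma GoodWord.double_false (hmono : ∀ c X Y, X ≤ Y → Big c X → Big c Y) {p η : ℝ} {N : ℕ}
    (hN : PairPigeonhole Big p η N) (w : List Bool)
    (L : Finset ℕ) (X : S) (h : GoodWord 𝒰 E Big p (false :: w) L X) :
    GoodWord 𝒰 E Big η (false :: false :: w) L X := by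
  refine (GoodWord.eventually_pair hN w 𝒰 (fun _ => L)
    (fun a => X ⊓ L.inf fun l => E l a) h).mono
    fun a ha => Eventually.mono ha fun b hb => GoodWord.mono hmono Finset.subset_union_left ?_ hb
  exact le_inf inf_le_left (inf_le_right.trans inf_le_right)

lemma GoodWord.swap (hmono : ∀ c X Y, X ≤ Y → Big c X → Big c Y) {p η : ℝ} {N : ℕ}
    (hN : PairPigeonhole Big p η N) (w : List Bool)
    (L : Finset ℕ) (X : S) (h : GoodWord 𝒰 E Big p (true :: false :: w) L X) :
    GoodWord 𝒰 E Big η (false :: true :: w) L X := by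
  have h' := GoodWord.eventually_pair hN w (𝒰.bind fun x => 𝒰.map (Prod.mk x))
    (fun t : ℕ × ℕ => insert t.1 L)
    (fun t => X ⊓ (insert t.1 L).inf fun l => E l t.2) h
  replace h' : ∀ᶠ x in 𝒰, ∀ᶠ y in 𝒰, ∀ᶠ x' in 𝒰, ∀ᶠ y' in 𝒰, GoodWord 𝒰 E Big η w
      (insert x L ∪ insert x' L) ((X ⊓ (insert x L).inf fun l => E l y) ⊓
        (X ⊓ (insert x' L).inf fun l => E l y')) := h'
  obtain ⟨x, hx⟩ := h'.exists
  refine Eventually.mono hx fun y hy => Eventually.mono hy fun x' hx' => ?_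
  obtain ⟨y', hy'⟩ := hx'.exists
  refine GoodWord.mono hmono Finset.subset_union_right ?_ hy'
  exact inf_le_left.trans (inf_le_inf_left _ (Finset.inf_mono (Finset.subset_insert _ _)))

/-- Every word is good, provided the word consisting of one lower and one upper point is. -/
theorem exists_goodWord (hmono : ∀ c X Y, X ≤ Y → Big c X → Big c Y)
    (hpig : ∀ p : ℝ, 0 < p → ∃ η : ℝ, 0 < η ∧ ∃ N, PairPigeonhole Big p η N)
    {c : ℝ} (hc : 0 < c) (hbase : GoodWord 𝒰 E Big c [true, false] ∅ ⊤)
    (w : List Bool) : ∃ c > 0, GoodWord 𝒰 E Big c (w ++ [true, false]) ∅ ⊤ := by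
  have step : ∀ u v : List Bool, (∀ p η : ℝ, ∀ N, PairPigeonhole Big p η N → ∀ L X,
      GoodWord 𝒰 E Big p u L X → GoodWord 𝒰 E Big η v L X) → ∀ pre : List Bool,
      (∃ c > 0, GoodWord 𝒰 E Big c (pre ++ u) ∅ ⊤) →
        ∃ c > 0, GoodWord 𝒰 E Big c (pre ++ v) ∅ ⊤ := by
    rintro u v huv pre ⟨c, hc, hg⟩
    obtain ⟨η, hη, N, hN⟩ := hpig c hc
    exact ⟨η, hη, GoodWord.append_of_imp (huv c η N hN) pre _ _ hg⟩
  have hswap : ∀ pre s : List Bool, (∃ c > 0, GoodWord 𝒰 E Big c (pre ++ true :: false :: s) ∅ ⊤) →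
      ∃ c > 0, GoodWord 𝒰 E Big c (pre ++ false :: true :: s) ∅ ⊤ := fun pre s =>
    step _ _ (fun p η N hN L X => GoodWord.swap hmono hN s L X) pre
  have hmove : ∀ a : ℕ, ∀ pre s : List Bool,
      (∃ c > 0, GoodWord 𝒰 E Big c (pre ++ (List.replicate a true ++ false :: s)) ∅ ⊤) →
      ∃ c > 0, GoodWord 𝒰 E Big c (pre ++ false :: (List.replicate a true ++ s)) ∅ ⊤ := by
    intro a
    induction a with
    | zero => exact fun pre s h => h
    | succ a ih =>
      intro pre s h
      have := ih (pre ++ [true]) s (by simpa [List.replicate_succ] using h)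
      simpa [List.replicate_succ] using
        hswap pre (List.replicate a true ++ s) (by simpa using this)
  have hsorted : ∀ a b : ℕ, ∃ c > 0, GoodWord 𝒰 E Big c
      (List.replicate (a + 1) true ++ List.replicate (b + 1) false) ∅ ⊤ := by
    intro a
    induction a with
    | zero =>
      intro b
      induction b with
      | zero => exact ⟨c, hc, hbase⟩
      | succ b ih =>
        simpa [List.replicate_succ] using step _ _ (fun p η N hN L X =>
          GoodWord.double_false hmono hN (List.replicate b false) L X) [true]
          (by simpa [List.replicate_succ] using ih)
    | succ a ih =>
      intro b
      simpa [List.replicate_succ] using step _ _ (fun p η N hN L X =>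
        GoodWord.double_true hmono hN
          (List.replicate a true ++ List.replicate (b + 1) false) L X) []
        (by simpa [List.replicate_succ] using ih b)
  have hall : ∀ w : List Bool, ∀ a b : ℕ, ∃ c > 0, GoodWord 𝒰 E Big c
      (w ++ (List.replicate (a + 1) true ++ List.replicate (b + 1) false)) ∅ ⊤ := by
    intro w
    induction w using List.reverseRecOn with
    | nil => exact hsorted
    | append_singleton w x ih =>
      intro a b
      cases x
      · simpa using hmove (a + 1) w (List.replicate (b + 1) false)
          (by simpa [List.replicate_succ] using ih a (b + 1))
      · simpa [List.replicate_succ] using ih (a + 1) b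
  exact hall w 0 0

/-- Finitely many good words read along the same list `as` are realised by common points. -/
lemma GoodWord.exists_points (h𝒰 : (𝒰 : Filter ℕ) ≤ cofinite)
    {α β : Type*} [DecidableEq α] [Finite β] (p : β → α → Bool) (c : β → ℝ) (s : List Bool)
    (as : List α) (hnd : as.Nodup) : ∀ (L : β → Finset ℕ) (X : β → S) (D : Finset ℕ),
    (∀ v, GoodWord 𝒰 E Big (c v) (as.map (p v) ++ s) (L v) (X v)) →
    ∃ (φ : α → ℕ) (Y : β → S) (L' : β → Finset ℕ),
      (∀ a ∈ as, φ a ∉ D) ∧ (∀ a ∈ as, ∀ b ∈ as, φ a = φ b → a = b) ∧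
      (∀ v, GoodWord 𝒰 E Big (c v) s (L' v) (Y v)) ∧ (∀ v, Y v ≤ X v) ∧
      (∀ v, ∀ l ∈ L v, ∀ b ∈ as, p v b = false → Y v ≤ E l (φ b)) ∧
      as.Pairwise fun a b => ∀ v, p v a = true → p v b = false → Y v ≤ E (φ a) (φ b) := by
  induction as with
  | nil => exact fun L X D h => ⟨fun _ => 0, X, L, by simp, by simp, h, fun _ => le_rfl, by simp,
      List.Pairwise.nil⟩
  | cons a as ih =>
    intro L X D h
    obtain ⟨ha, hnd⟩ := List.nodup_cons.1 hnd
    have h' : ∀ᶠ x in (𝒰 : Filter ℕ), ∀ v, GoodWord 𝒰 E Big (c v) (as.map (p v) ++ s)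
        (if p v a then insert x (L v) else L v)
        (if p v a then X v else X v ⊓ (L v).inf fun l => E l x) := by
      refine eventually_all.2 fun v => ?_
      have := h v
      rw [List.map_cons, List.cons_append] at this
      cases hp : p v a <;> rw [hp] at this <;> exact Eventually.mono this fun x hx => by simpa
    have hD : ∀ᶠ x in (𝒰 : Filter ℕ), x ∉ D := h𝒰 D.finite_toSet.compl_mem_cofinite
    obtain ⟨x, hx, hxD⟩ := (h'.and hD).exists
    obtain ⟨φ, Y, L', hφD, hφinj, hgood, hYX, hYL, hpair⟩ := ih hnd _ _ (insert x D) hx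
    have hne : ∀ b ∈ as, b ≠ a := fun b hb hba => ha (hba ▸ hb)
    have hφ : ∀ b ∈ as, Function.update φ a x b = φ b := fun b hb =>
      Function.update_of_ne (hne b hb) _ _
    have hxφ : ∀ b ∈ as, φ b ≠ x := fun b hb hbx =>
      hφD b hb (hbx ▸ Finset.mem_insert_self _ _)
    refine ⟨Function.update φ a x, Y, L', ?_, ?_, hgood, fun v => ?_, ?_, ?_⟩
    · intro b hb
      rcases List.mem_cons.1 hb with rfl | hb
      · simpa using hxD
      · rw [hφ _ hb]
        exact fun hbD => hφD b hb (Finset.mem_insert_of_mem hbD)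
    · intro b hb b' hb' hbb
      rcases List.mem_cons.1 hb with hba | hba <;> rcases List.mem_cons.1 hb' with hba' | hba'
      · rw [hba, hba']
      · rw [hφ _ hba', hba, Function.update_self] at hbb
        exact absurd hbb.symm (hxφ _ hba')
      · rw [hφ _ hba, hba', Function.update_self] at hbb
        exact absurd hbb (hxφ _ hba)
      · rw [hφ _ hba, hφ _ hba'] at hbb
        exact hφinj _ hba _ hba' hbb
    · refine (hYX v).trans ?_
      split_ifs
      exacts [le_rfl, inf_le_left]
    · intro v l hl b hb hpb
      rcases List.mem_cons.1 hb with rfl | hb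
      · rw [Function.update_self]
        refine (hYX v).trans ?_
        rw [if_neg (by simp [hpb])]
        exact inf_le_right.trans (Finset.inf_le (f := fun l => E l x) hl)
      · rw [hφ _ hb]
        refine hYL v l ?_ b hb hpb
        split_ifs
        exacts [Finset.mem_insert_of_mem hl, hl]
    · refine List.pairwise_cons.2 ⟨fun b hb v hpa hpb => ?_, ?_⟩
      · rw [Function.update_self, hφ b hb]
        exact hYL v x (by rw [if_pos hpa]; exact Finset.mem_insert_self _ _) b hb hpb
      · refine hpair.imp_of_mem fun {b b'} hb hb' hbb => ?_
        rwa [hφ b hb, hφ b' hb']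

end IteratedLimits

section Embedding

open Filter

lemma sum_card_le_card_biUnion_add {ι γ : Type*} [DecidableEq ι] [DecidableEq γ] (X : ι → Finset γ)
    {t : ℝ} (ht : 0 ≤ t) (h : ∀ i j, i ≠ j → (#(X i ∩ X j) : ℝ) ≤ t) (s : Finset ι) :
    (∑ i ∈ s, (#(X i) : ℝ)) ≤ #(s.biUnion X) + (#s : ℝ) ^ 2 * t := by
  induction s using Finset.induction_on with
  | empty => simp
  | insert a s ha ih =>
    have h₁ : (#(X a ∩ s.biUnion X) : ℝ) ≤ #s * t := by
      rw [Finset.inter_biUnion]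
      refine (Nat.cast_le.2 Finset.card_biUnion_le).trans ?_
      push_cast
      refine (Finset.sum_le_card_nsmul s _ t fun i hi => h a i ?_).trans (by simp)
      rintro rfl
      exact ha hi
    have h₂ : (#(X a ∪ s.biUnion X) : ℝ) + #(X a ∩ s.biUnion X) = #(X a) + #(s.biUnion X) := by
      exact_mod_cast Finset.card_union_add_card_inter _ _
    rw [Finset.sum_insert ha, Finset.biUnion_insert, Finset.card_insert_of_notMem ha]
    push_cast
    have : 0 ≤ (#s : ℝ) * t := by positivity
    nlinarith

/-- The event (along the sequence of 3-graphs `H`) that a vertex forms an edge with `a` and `b`. -/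
def linkEvent {n : ℕ → ℕ} (H : ∀ k, ThreeGraph (Fin (n k))) (a b : ℕ) (k : ℕ) :
    Finset (Fin (n k)) :=
  {v | ∃ (ha : a < n k) (hb : b < n k),
    ({⟨a, ha⟩, ⟨b, hb⟩, v} : Finset (Fin (n k))) ∈ (H k).edges}

/-- The event `X` has density at least `c` along the hyperfilter. -/
def DenseEvent {n : ℕ → ℕ} (c : ℝ) (X : ∀ k, Finset (Fin (n k))) : Prop :=
  ∀ᶠ k in hyperfilter ℕ, c * n k ≤ #(X k)

lemma DenseEvent.mono {n : ℕ → ℕ} (c : ℝ) (X Y : ∀ k, Finset (Fin (n k))) (hXY : X ≤ Y)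
    (hX : DenseEvent c X) : DenseEvent c Y :=
  Eventually.mono hX fun k hk => hk.trans (Nat.cast_le.2 (Finset.card_le_card (hXY k)))

lemma eventually_hyperfilter_of_ge {P : ℕ → Prop} (m : ℕ) (h : ∀ k, m ≤ k → P k) :
    ∀ᶠ k in hyperfilter ℕ, P k :=
  Nat.hyperfilter_le_atTop (eventually_atTop.2 ⟨m, h⟩)

lemma DenseEvent.pairPigeonhole {n : ℕ → ℕ} (hn : ∀ k, k ≤ n k) (p : ℝ) (hp : 0 < p) :
    ∃ η : ℝ, 0 < η ∧ ∃ N, PairPigeonhole (DenseEvent (n := n)) p η N := by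
  obtain ⟨N, hN⟩ := exists_nat_gt (2 / p)
  have hN0 : (0 : ℝ) < N := lt_trans (by positivity) hN
  refine ⟨1 / (N : ℝ) ^ 2, by positivity, N, fun X hX => ?_⟩
  have hX' : ∀ᶠ k in hyperfilter ℕ, ∀ i, p * n k ≤ #(X i k) := eventually_all.2 hX
  have key : ∀ᶠ k in hyperfilter ℕ, ∃ q : {q : Fin N × Fin N // q.1 < q.2},
      1 / (N : ℝ) ^ 2 * n k ≤ #((X q.1.1 ⊓ X q.1.2) k) := by
    filter_upwards [hX', eventually_hyperfilter_of_ge 1 fun k hk => hk] with k hk hk1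
    by_contra! hne
    have hnk : (0 : ℝ) < n k := by exact_mod_cast lt_of_lt_of_le hk1 (hn k)
    have hsmall : ∀ i j, i ≠ j → (#(X i k ∩ X j k) : ℝ) ≤ 1 / (N : ℝ) ^ 2 * n k := by
      intro i j hij
      rcases lt_or_gt_of_ne hij with h | h
      · exact (hne ⟨(i, j), h⟩).le
      · rw [Finset.inter_comm]
        exact (hne ⟨(j, i), h⟩).le
    have h₁ := sum_card_le_card_biUnion_add (fun i => X i k) (by positivity) hsmall Finset.univ
    have h₂ : (N : ℝ) * (p * n k) ≤ ∑ i : Fin N, (#(X i k) : ℝ) := by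
      simpa using Finset.card_nsmul_le_sum Finset.univ _ _ fun i _ => hk i
    have h₃ : (#(Finset.univ.biUnion fun i => X i k) : ℝ) ≤ n k := by
      exact_mod_cast (Finset.card_le_univ _).trans_eq (Fintype.card_fin _)
    have h₄ : (#(Finset.univ : Finset (Fin N)) : ℝ) ^ 2 * (1 / (N : ℝ) ^ 2 * n k) = n k := by
      rw [Finset.card_univ, Fintype.card_fin]
      field_simp
    have h₅ : 2 < N * p := by rwa [div_lt_iff₀ hp] at hN
    nlinarith
  obtain ⟨⟨⟨i, j⟩, hij⟩, h⟩ := (hyperfilter ℕ).exists_eventually_of_eventually_exists key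
  exact ⟨i, j, hij, h⟩

lemma goodWord_true_false {n : ℕ → ℕ} (hn : ∀ k, k ≤ n k) (H : ∀ k, ThreeGraph (Fin (n k)))
    {x : ℝ} (hH : ∀ k, ∀ u v : Fin (n k), u ≠ v → x * n k ≤ (codeg (H k) u v : ℝ)) :
    GoodWord (hyperfilter ℕ) (linkEvent H) DenseEvent x [true, false] ∅ ⊤ := by
  refine Eventually.of_forall fun a => ?_
  refine eventually_hyperfilter_of_ge (a + 1) fun b hb => ?_
  refine eventually_hyperfilter_of_ge (b + 1) fun k hk => ?_
  have hbk : b < n k := lt_of_lt_of_le hk (hn k)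
  have hak : a < n k := lt_trans hb hbk
  refine (hH k ⟨a, hak⟩ ⟨b, hbk⟩ (by simp; lia)).trans ?_
  rw [codeg]
  refine Nat.cast_le.2 (Finset.card_le_card fun v hv => ?_)
  simpa [linkEvent, hak, hbk] using hv

/-- Finite sets with at least `|ι|` elements have distinct representatives. -/
lemma exists_injective_mem_of_card_le {ι γ : Type*} [Fintype ι] [DecidableEq γ]
    (t : ι → Finset γ) (ht : ∀ i, Fintype.card ι ≤ #(t i)) :
    ∃ g : ι → γ, Function.Injective g ∧ ∀ i, g i ∈ t i := by
  refine (Finset.all_card_le_biUnion_card_iff_exists_injective t).1 fun s => ?_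
  rcases s.eq_empty_or_nonempty with rfl | ⟨i, hi⟩
  · simp
  · exact (Finset.card_le_univ s).trans
      ((ht i).trans (Finset.card_le_card (Finset.subset_biUnion_of_mem t hi)))

lemma IsLabeling.exists_list {α : Type*} [DecidableEq α] {A : Finset α} {σ : α → ℕ}
    (hσ : IsLabeling A σ) : ∃ as : List α, as.Pairwise (fun a b => σ a < σ b) ∧
      ∀ a, a ∈ as ↔ a ∈ A := by
  classical
  rcases A.eq_empty_or_nonempty with rfl | ⟨a₀, ha₀⟩
  · exact ⟨[], List.Pairwise.nil, by simp⟩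
  have : Nonempty α := ⟨a₀⟩
  have hinv : ∀ i ∈ Finset.Icc 1 #A, Function.invFunOn σ A i ∈ A ∧
      σ (Function.invFunOn σ A i) = i := fun i hi =>
    ⟨Function.invFunOn_mem (hσ.surjOn (by simpa using hi)),
      Function.invFunOn_eq (hσ.surjOn (by simpa using hi))⟩
  refine ⟨(List.range' 1 #A).map (Function.invFunOn σ A), ?_, fun a => ?_⟩
  · rw [List.pairwise_map]
    refine List.Pairwise.imp_of_mem (fun {i j} hi hj hij => ?_) List.pairwise_lt_range'
    rw [(hinv i (by simp [List.mem_range'_1] at hi ⊢; lia)).2,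
      (hinv j (by simp [List.mem_range'_1] at hj ⊢; lia)).2]
    exact hij
  · rw [List.mem_map]
    constructor
    · rintro ⟨i, hi, rfl⟩
      exact (hinv i (by simp [List.mem_range'_1] at hi ⊢; lia)).1
    · intro ha
      have hmem := hσ.mapsTo ha
      refine ⟨σ a, by simp [List.mem_range'_1] at hmem ⊢; lia, ?_⟩
      exact hσ.injOn.leftInvOn_invFunOn ha

/-- An edge of a `(2,1)`-type 3-graph, with its two vertices in the first layer ordered. -/
lemma exists_eq_of_type {α : Type*} [DecidableEq α] {A B e : Finset α} {σ : α → ℕ}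
    (hσ : Set.InjOn σ A) (hcover : e ⊆ A ∪ B) (he : #(e ∩ A) = 2 ∧ #(e ∩ B) = 1) :
    ∃ v ∈ B, ∃ a ∈ A, ∃ b ∈ A, σ a < σ b ∧ e = {v, a, b} := by
  obtain ⟨x, y, hxy, hA⟩ := Finset.card_eq_two.1 he.1
  obtain ⟨v, hB⟩ := Finset.card_eq_one.1 he.2
  have hx : x ∈ e ∩ A := by simp [hA]
  have hy : y ∈ e ∩ A := by simp [hA]
  have hv : v ∈ e ∩ B := by simp [hB]
  rw [Finset.mem_inter] at hx hy hv
  have he' : e = {v, x, y} := by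
    rw [← Finset.inter_eq_left.2 hcover, Finset.inter_union_distrib_left, hA, hB,
      Finset.union_comm]
    rfl
  rcases lt_or_gt_of_ne fun h => hxy (hσ hx.2 hy.2 h) with h | h
  · exact ⟨v, hv.2, x, hx.2, y, hy.2, h, he'⟩
  · exact ⟨v, hv.2, y, hy.2, x, hx.2, h, by rw [he', Finset.pair_comm]⟩

/-- In a sequence of 3-graphs of positive minimum codegree density, a `(2,1)`-type 3-graph with a
labeling whose links have no monotone `P₃` eventually appears. -/
theorem exists_hasCopy_of_labeling {α : Type*} [Fintype α] [DecidableEq α] (F : ThreeGraph α)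
    (A B : Finset α) (hdisj : Disjoint A B) (hcover : A ∪ B = Finset.univ)
    (htype : ∀ e ∈ F.edges, #(e ∩ A) = 2 ∧ #(e ∩ B) = 1) (σ : α → ℕ) (hσ : IsLabeling A σ)
    (hmon : ∀ v ∈ B, ¬ ∃ a ∈ A, ∃ b ∈ A, ∃ c ∈ A, σ a < σ b ∧ σ b < σ c ∧
      ({v, a, b} : Finset α) ∈ F.edges ∧ ({v, b, c} : Finset α) ∈ F.edges)
    {n : ℕ → ℕ} (hn : ∀ k, k ≤ n k) (H : ∀ k, ThreeGraph (Fin (n k))) {x : ℝ} (hx : 0 < x)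
    (hH : ∀ k, ∀ u v : Fin (n k), u ≠ v → x * n k ≤ (codeg (H k) u v : ℝ)) :
    ∃ k, HasCopy (H k) F := by
  classical
  obtain ⟨as, hsorted, hmem⟩ := hσ.exists_list
  let low : α → α → Bool := fun v a => decide (∃ b ∈ A, σ a < σ b ∧ {v, a, b} ∈ F.edges)
  have hgood : ∀ v, ∃ c > 0, GoodWord (hyperfilter ℕ) (linkEvent H) DenseEvent c
      (as.map (low v) ++ [true, false]) ∅ ⊤ := fun v =>
    exists_goodWord DenseEvent.mono (DenseEvent.pairPigeonhole hn) hx (goodWord_true_false hn H hH) _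
  choose c hc hgood using hgood
  have hnd : as.Nodup := hsorted.imp fun {a b} h hab => by simp [hab] at h
  obtain ⟨φ, Y, L', -, hφ, hY, -, -, hpair⟩ :=
    GoodWord.exists_points hyperfilter_le_cofinite low c _ as hnd _ _ ∅ hgood
  have hordered : ∀ a ∈ as, ∀ b ∈ as,
      (σ a < σ b → ∀ v, low v a = true → low v b = false → Y v ≤ linkEvent H (φ a) (φ b)) ∧
      (σ b < σ a → ∀ v, low v b = true → low v a = false → Y v ≤ linkEvent H (φ b) (φ a)) :=
    fun a ha b hb => @List.Pairwise.forall_of_forall _ (fun a b =>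
      (σ a < σ b → ∀ v, low v a = true → low v b = false → Y v ≤ linkEvent H (φ a) (φ b)) ∧
      (σ b < σ a → ∀ v, low v b = true → low v a = false → Y v ≤ linkEvent H (φ b) (φ a)))
      as ⟨fun _ _ h => h.symm⟩
      (fun a _ => ⟨fun h => absurd h (lt_irrefl _), fun h => absurd h (lt_irrefl _)⟩)
      ((hsorted.and hpair).imp fun h => ⟨fun _ => h.2, fun h' => absurd h' h.1.not_gt⟩)
      a ha b hb
  have hdense : ∀ᶠ k in hyperfilter ℕ, ∀ v, c v * n k ≤ #(Y v k) :=
    eventually_all.2 fun v => GoodWord.big DenseEvent.mono _ _ _ (hY v)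
  have hlarge : ∀ᶠ k in hyperfilter ℕ, ∀ v, 2 * (Fintype.card α : ℝ) ≤ c v * n k := by
    refine eventually_all.2 fun v => ?_
    obtain ⟨m, hm⟩ := exists_nat_ge (2 * (Fintype.card α : ℝ) / c v)
    refine eventually_hyperfilter_of_ge m fun k hk => ?_
    rw [div_le_iff₀ (hc v)] at hm
    have : (m : ℝ) ≤ n k := by exact_mod_cast hk.trans (hn k)
    nlinarith [hc v]
  have hlt : ∀ᶠ k in hyperfilter ℕ, ∀ a, φ a < n k := eventually_all.2 fun a =>
    eventually_hyperfilter_of_ge (φ a + 1) fun k hk => lt_of_lt_of_le hk (hn k)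
  obtain ⟨k, hk₁, hk₂, hk₃⟩ := (hdense.and (hlarge.and hlt)).exists
  let ψ : α → Fin (n k) := fun a => ⟨φ a, hk₃ a⟩
  obtain ⟨g, hginj, hg⟩ := exists_injective_mem_of_card_le
    (fun v => Y v k \ Finset.univ.image ψ) (fun v => by
      have h₁ : 2 * Fintype.card α ≤ #(Y v k) := by exact_mod_cast (hk₂ v).trans (hk₁ v)
      have h₂ : #(Finset.univ.image ψ) ≤ Fintype.card α := Finset.card_image_le
      have h₃ := Finset.le_card_sdiff (Finset.univ.image ψ) (Y v k)
      lia)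
  simp only [Finset.mem_sdiff, Finset.mem_image, Finset.mem_univ, true_and, not_exists] at hg
  refine ⟨k, fun a => if a ∈ A then ψ a else g a, fun a b hab => ?_, fun e he => ?_⟩
  · dsimp only at hab
    split_ifs at hab with ha hb hb
    · exact hφ a ((hmem a).2 ha) b ((hmem b).2 hb) (congrArg Fin.val hab)
    · exact absurd hab ((hg b).2 a)
    · exact absurd hab.symm ((hg a).2 b)
    · exact hginj hab
  · obtain ⟨v, hv, a, ha, b, hb, hab, rfl⟩ :=
      exists_eq_of_type hσ.injOn (hcover ▸ Finset.subset_univ e) (htype e he)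
    have hlowa : low v a = true := decide_eq_true ⟨b, hb, hab, he⟩
    have hlowb : low v b = false := by
      refine decide_eq_false ?_
      rintro ⟨d, hd, hbd, hedge⟩
      exact hmon v hv ⟨a, ha, b, hb, d, hd, hab, hbd, he, hedge⟩
    have hYab : Y v ≤ linkEvent H (φ a) (φ b) :=
      (hordered a ((hmem a).2 ha) b ((hmem b).2 hb)).1 hab v hlowa hlowb
    have hvA : v ∉ A := fun h => Finset.disjoint_left.1 hdisj h hv
    have hgv := hYab k (hg v).1
    simp only [linkEvent, Finset.mem_filter, Finset.mem_univ, true_and] at hgv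
    obtain ⟨_, _, hgv⟩ := hgv
    convert hgv using 1
    simp only [Finset.image_insert, Finset.image_singleton, ha, hb, hvA, if_true, if_false]
    rw [Finset.insert_comm, Finset.pair_comm]

end Embedding

section CyclicConstruction

variable {W : Type*} [LinearOrder W] {r : ℕ}

/-- The signed displacement from the arc of `a` to the arc of `b`; inside one arc the order of the
vertices decides between `1` and `-1`. -/
def arcShift (s : W → ZMod r) (a b : W) : ZMod r :=
  if s a = s b then if a < b then 1 else -1 else s b - s a

lemma arcShift_ne_zero [Fact r.Prime] (s : W → ZMod r) (a b : W) : arcShift s a b ≠ 0 := by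
  unfold arcShift
  split_ifs with h₁ h₂
  · exact one_ne_zero
  · exact neg_ne_zero.2 one_ne_zero
  · exact sub_ne_zero.2 (Ne.symm h₁)

/-- The vertices `a, b` lie on the circle just below the one of `v`, and the labels `f v a`, `f v b`
point from each of `a, b` towards the other one. -/
def PointsAt (circ : W → ZMod 3) (s : W → ZMod r) (f : W → W → ZMod r) (v a b : W) : Prop :=
  a ≠ b ∧ circ v = circ a + 1 ∧ circ b = circ a ∧ f v a = arcShift s a b ∧ f v b = arcShift s b a

lemma PointsAt.symm {circ : W → ZMod 3} {s : W → ZMod r} {f : W → W → ZMod r} {v a b : W}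
    (h : PointsAt circ s f v a b) : PointsAt circ s f v b a :=
  ⟨h.1.symm, h.2.2.1 ▸ h.2.1, h.2.2.1.symm, h.2.2.2.2, h.2.2.2.1⟩

lemma PointsAt.ne_left {circ : W → ZMod 3} {s : W → ZMod r} {f : W → W → ZMod r} {v a b : W}
    (h : PointsAt circ s f v a b) : v ≠ a := by
  rintro rfl
  have := h.2.1
  simp at this

open Classical in
/-- The 3-graph whose edges are the triples `{v, a, b}` with `PointsAt circ s f v a b`. -/
noncomputable def pointingGraph [Fintype W] (circ : W → ZMod 3) (s : W → ZMod r) (f : W → W → ZMod r) :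
    ThreeGraph W where
  edges := {e | ∃ v a b, e = {v, a, b} ∧ PointsAt circ s f v a b}
  card_eq e he := by
    obtain ⟨v, a, b, rfl, h⟩ := (Finset.mem_filter.1 he).2
    exact Finset.card_eq_three.2 ⟨v, a, b, h.ne_left, h.symm.ne_left, h.1, rfl⟩

lemma mem_edges_pointingGraph [Fintype W] {circ : W → ZMod 3} {s : W → ZMod r} {f : W → W → ZMod r}
    {x y z : W} : {x, y, z} ∈ (pointingGraph circ s f).edges ↔
      PointsAt circ s f x y z ∨ PointsAt circ s f y x z ∨ PointsAt circ s f z x y := by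
  simp only [pointingGraph, Finset.mem_filter, Finset.mem_univ, true_and]
  constructor
  · rintro ⟨v, a, b, h, hp⟩
    have hva := hp.ne_left
    have hvb := hp.symm.ne_left
    have hab := hp.1
    have hv : v = x ∨ v = y ∨ v = z := by simpa [← h] using Finset.mem_insert_self v {a, b}
    have ha : a = x ∨ a = y ∨ a = z := by
      have : a ∈ ({v, a, b} : Finset W) := by simp
      simpa [← h] using this
    have hb : b = x ∨ b = y ∨ b = z := by
      have : b ∈ ({v, a, b} : Finset W) := by simp
      simpa [← h] using this
    have := hp.symm
    rcases hv with rfl | rfl | rfl <;> rcases ha with rfl | rfl | rfl <;>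
      rcases hb with rfl | rfl | rfl <;> tauto
  · rintro (h | h | h)
    · exact ⟨_, _, _, rfl, h⟩
    · exact ⟨_, _, _, Finset.insert_comm _ _ _, h⟩
    · exact ⟨z, x, y, by rw [Finset.insert_comm z, Finset.pair_comm z], h⟩

/-- Vertices are ordered by circle, then along the circle cut open at `e`, then inside an arc. -/
def cutKey {W : Type*} (circ : W → ZMod 3) (s : W → ZMod r) (e : ZMod r) (a : W) : ℕ ×ₗ ℕ ×ₗ W :=
  toLex ((circ a).val, toLex ((s a - e).val, a))

lemma cutKey_injective {W : Type*} (circ : W → ZMod 3) (s : W → ZMod r) (e : ZMod r) :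
    Function.Injective (cutKey circ s e) := fun a b h => by
  simpa [cutKey] using congrArg (fun p => (ofLex (ofLex p).2).2) h

lemma ZMod.val_lt_val_add_one [Fact r.Prime] {u : ZMod r} (hu : u + 1 ≠ 0) : u.val < (u + 1).val := by
  rcases Nat.eq_or_lt_of_le (Nat.succ_le_of_lt u.val_lt) with h | h
  · refine absurd ?_ hu
    rw [← ZMod.natCast_zmod_val u]
    exact_mod_cast (congrArg (Nat.cast : ℕ → ZMod r) h).trans (ZMod.natCast_self r)
  · rw [ZMod.val_add_of_lt (by rwa [ZMod.val_one]), ZMod.val_one]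
    exact Nat.lt_succ_self _

/-- Below a fixed vertex `x`, the label `f x y` decides on which side of `y` its partners lie. -/
lemma PointsAt.cutKey_lt_iff [Fact r.Prime] (hr : 2 < r) {circ : W → ZMod 3} {s : W → ZMod r}
    {f : W → W → ZMod r} {e : ZMod r} {x y z : W} (h : PointsAt circ s f x y z)
    (hy : s y ≠ e) (hz : s z ≠ e) :
    cutKey circ s e y < cutKey circ s e z ↔
      f x y = 1 ∨ f x y ≠ -1 ∧ (s y - e).val < (s y - e + f x y).val := by
  have : Fact (2 < r) := ⟨hr⟩
  have hne : (-1 : ZMod r) ≠ 1 := ZMod.neg_one_ne_one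
  obtain ⟨hyz, -, hcirc, hf, -⟩ := h
  simp only [cutKey, Prod.Lex.toLex_lt_toLex, hcirc, lt_irrefl, true_and, false_or]
  by_cases hs : s y = s z
  · rw [hf, arcShift, if_pos hs, hs]
    split_ifs with hlt
    · simp [hlt]
    · simp [hlt, hne]
  · have hfs : f x y = s z - s y := by rw [hf, arcShift, if_neg hs]
    have hu : s y - e + f x y = s z - e := by rw [hfs]; ring
    have hval : (s y - e).val ≠ (s z - e).val := fun h' =>
      hs (by simpa using ZMod.val_injective r h')
    rw [hu]
    simp only [hval, false_and, or_false]
    constructor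
    · intro hlt
      by_cases h1 : f x y = -1
      · have h2 : s z - e + 1 = s y - e := by rw [← hu, h1]; ring
        have := ZMod.val_lt_val_add_one (u := s z - e) (by rw [h2]; exact sub_ne_zero.2 hy)
        rw [h2] at this
        lia
      · exact Or.inr ⟨h1, hlt⟩
    · rintro (h1 | h1)
      · have h2 : s y - e + 1 = s z - e := by rw [← hu, h1]
        have := ZMod.val_lt_val_add_one (u := s y - e) (by rw [h2]; exact sub_ne_zero.2 hz)
        rwa [h2] at this
      · exact h1.2

/-- In a `pointingGraph`, the third vertices of all edges through `x, y` lie on one side of `y`. -/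
lemma cutKey_lt_iff_of_mem_edges [Fintype W] [Fact r.Prime] (hr : 2 < r) {circ : W → ZMod 3}
    {s : W → ZMod r} {f : W → W → ZMod r} {e : ZMod r} {x y z z' : W}
    (h : {x, y, z} ∈ (pointingGraph circ s f).edges)
    (h' : {x, y, z'} ∈ (pointingGraph circ s f).edges)
    (hy : s y ≠ e) (hz : s z ≠ e) (hz' : s z' ≠ e) :
    cutKey circ s e y < cutKey circ s e z ↔ cutKey circ s e y < cutKey circ s e z' := by
  have hcyc : ∀ c d : ZMod 3, c = d + 1 → d ≠ c ∧ d ≠ c + 1 := by decide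
  have hcirc : ∀ c d d' : ZMod 3, c ≠ d → d = d' →
      ((c.val < d.val ↔ c.val < d'.val) ∧ c.val ≠ d.val ∧ c.val ≠ d'.val) := by decide
  have hside : circ y ≠ circ z → circ z = circ z' →
      (cutKey circ s e y < cutKey circ s e z ↔ cutKey circ s e y < cutKey circ s e z') := by
    intro h₁ h₂
    obtain ⟨h₃, h₄, h₅⟩ := hcirc _ _ _ h₁ h₂
    simp only [cutKey, Prod.Lex.toLex_lt_toLex, h₃, h₄, h₅, false_and]
  rw [mem_edges_pointingGraph] at h h'
  rcases h with h | h | h <;> rcases h' with h' | h' | h'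
  · rw [h.cutKey_lt_iff hr hy hz, h'.cutKey_lt_iff hr hy hz']
  · exact absurd h'.2.1 (hcyc _ _ h.2.1).2
  · exact absurd h'.2.2.1 (hcyc _ _ h.2.1).1
  · exact absurd h.2.1 (hcyc _ _ h'.2.1).2
  · refine hside ?_ (h.2.2.1.trans h'.2.2.1.symm)
    rw [h.2.2.1]
    exact (hcyc _ _ h.2.1).1.symm
  · exact absurd h'.2.2.1.symm (hcyc _ _ h.2.1).1
  · exact absurd h.2.2.1 (hcyc _ _ h'.2.1).1
  · exact absurd h.2.2.1.symm (hcyc _ _ h'.2.1).1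
  · refine hside ?_ (h.2.1.trans h'.2.1.symm)
    rw [h.2.2.1]
    exact (hcyc _ _ h.2.1).1

/-- Ranking a finite set by an injective key is a labeling. -/
lemma exists_isLabeling_of_injective {α L : Type*} [DecidableEq α] [LinearOrder L] (A : Finset α)
    {key : α → L} (hkey : Function.Injective key) :
    ∃ σ : α → ℕ, IsLabeling A σ ∧ ∀ a ∈ A, ∀ b ∈ A, σ a < σ b → key a < key b := by
  let σ : α → ℕ := fun a => #{b ∈ A | key b ≤ key a}
  have hle : ∀ a b, key a ≤ key b → σ a ≤ σ b := fun a b h =>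
    Finset.card_le_card fun c hc => by
      simp only [Finset.mem_filter] at hc ⊢
      exact ⟨hc.1, hc.2.trans h⟩
  have hlt : ∀ a, ∀ b ∈ A, key a < key b → σ a < σ b := fun a b hb h => by
    refine Finset.card_lt_card ⟨fun c hc => ?_, fun hsub => ?_⟩
    · simp only [Finset.mem_filter] at hc ⊢
      exact ⟨hc.1, hc.2.trans h.le⟩
    · have := hsub (Finset.mem_filter.2 ⟨hb, le_rfl⟩)
      exact absurd (Finset.mem_filter.1 this).2 h.not_ge
  have hinj : Set.InjOn σ A := fun a ha b hb hab => by
    rcases lt_trichotomy (key a) (key b) with h | h | h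
    · exact absurd hab (hlt a b hb h).ne
    · exact hkey h
    · exact absurd hab (hlt b a ha h).ne'
  have hmaps : Set.MapsTo σ A (Finset.Icc 1 #A) := fun a ha => by
    have h₁ : 0 < σ a := Finset.card_pos.2 ⟨a, Finset.mem_filter.2 ⟨ha, le_rfl⟩⟩
    have h₂ : σ a ≤ #A := Finset.card_filter_le _ _
    simp only [Finset.coe_Icc, Set.mem_Icc]
    lia
  refine ⟨σ, ⟨hmaps, hinj, Finset.surjOn_of_injOn_of_card_le σ hmaps hinj (by simp)⟩,
    fun a _ b _ h => ?_⟩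
  by_contra! hba
  exact absurd (hle b a hba) h.not_ge

/-- A 3-graph contained in a `pointingGraph` with more arcs than vertices has a labeling whose links
have no monotone `P₃`. -/
lemma exists_labeling_of_hasCopy_pointingGraph [Fintype W] [Fact r.Prime] (hr : 2 < r)
    {α : Type*} [Fintype α] [DecidableEq α] (hα : Fintype.card α < r) (F : ThreeGraph α) (A : Finset α)
    {circ : W → ZMod 3} {s : W → ZMod r} {f : W → W → ZMod r}
    (h : HasCopy (pointingGraph circ s f) F) :
    ∃ σ : α → ℕ, IsLabeling A σ ∧ ∀ v,
      ¬ ∃ a ∈ A, ∃ b ∈ A, ∃ c ∈ A, σ a < σ b ∧ σ b < σ c ∧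
        ({v, a, b} : Finset α) ∈ F.edges ∧ ({v, b, c} : Finset α) ∈ F.edges := by
  obtain ⟨φ, hφ, hedge⟩ := h
  obtain ⟨e, he⟩ : ∃ e, ∀ a, s (φ a) ≠ e := by
    by_contra! hsurj
    have := Fintype.card_le_of_surjective (fun a => s (φ a)) hsurj
    rw [ZMod.card] at this
    lia
  obtain ⟨σ, hσ, hlt⟩ := exists_isLabeling_of_injective A ((cutKey_injective circ s e).comp hφ)
  refine ⟨σ, hσ, ?_⟩
  rintro v ⟨a, ha, b, hb, c, hc, hab, hbc, h₁, h₂⟩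
  have h₁' := hedge _ h₁
  have h₂' := hedge _ h₂
  rw [Finset.pair_comm] at h₁'
  simp only [Finset.image_insert, Finset.image_singleton] at h₁' h₂'
  exact (hlt a ha b hb hab).not_gt
    ((cutKey_lt_iff_of_mem_edges hr h₁' h₂' (he b) (he a) (he c)).2 (hlt b hb c hc hbc))

end CyclicConstruction

section Label

variable {r D : ℕ}

/-- The first two of the coordinates exchange their roles with the next two, unless `c = 0`. -/
def coordPerm (c : ZMod r) : Equiv.Perm (Fin (D + 5)) :=
  if c = 0 then 1 else Equiv.swap 0 2 * Equiv.swap 1 3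

/-- An affine function of `a` for fixed `v`, and of `v` for fixed `a` and fixed `v 1`. -/
def affineLabel (v a : Fin (D + 5) → ZMod r) : ZMod r :=
  v 0 + a (coordPerm (v 1) 0) + ∑ j ∈ ({0, 1} : Finset (Fin (D + 5)))ᶜ, v j * a (coordPerm (v 1) j)

/-- The values of `affineLabel`, made nonzero. -/
def unitLabel (v a : Fin (D + 5) → ZMod r) : ZMod r :=
  if affineLabel v a = 0 then 1 else affineLabel v a

lemma unitLabel_ne_zero [Fact r.Prime] (v a : Fin (D + 5) → ZMod r) : unitLabel v a ≠ 0 := by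
  unfold unitLabel
  split_ifs with h
  · exact one_ne_zero
  · exact h

lemma unitLabel_eq {v a : Fin (D + 5) → ZMod r} {c : ZMod r} (hc : c ≠ 0)
    (h : affineLabel v a = c) : unitLabel v a = c := by
  rw [unitLabel, h, if_neg hc]

/-- If every vector can be moved into `S` by changing only the coordinates in `T`, then `S` has
density at least `|K| ^ (-|T|)`. -/
lemma card_le_card_mul_pow_of_modify {ι K : Type*} [Fintype ι] [DecidableEq ι] [Fintype K]
    (S : Finset (ι → K)) (T : Finset ι) (h : ∀ w : ι → K, ∃ w' ∈ S, ∀ i ∉ T, w' i = w i) :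
    Fintype.card (ι → K) ≤ #S * Fintype.card K ^ #T := by
  choose ψ hψ hψT using h
  have hinj : Function.Injective fun w : ι → K =>
      ((⟨ψ w, hψ w⟩, fun i => w i) : S × (T → K)) := by
    intro w w' hw
    simp only [Prod.mk.injEq, Subtype.mk.injEq] at hw
    funext i
    by_cases hi : i ∈ T
    · exact congrFun hw.2 ⟨i, hi⟩
    · rw [← hψT w i hi, ← hψT w' i hi, hw.1]
  simpa using Fintype.card_le_of_injective _ hinj

lemma two_three_four_mod_add_five (D : ℕ) :
    2 % (D + 5) = 2 ∧ 3 % (D + 5) = 3 ∧ 4 % (D + 5) = 4 :=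
  ⟨Nat.mod_eq_of_lt (by lia), Nat.mod_eq_of_lt (by lia), Nat.mod_eq_of_lt (by lia)⟩

lemma coordPerm_one_two [Fact r.Prime] : coordPerm (1 : ZMod r) (2 : Fin (D + 5)) = 0 := by
  simp [coordPerm, Equiv.swap_apply_def, Fin.ext_iff, two_three_four_mod_add_five]

lemma coordPerm_one_three [Fact r.Prime] : coordPerm (1 : ZMod r) (3 : Fin (D + 5)) = 1 := by
  simp [coordPerm, Equiv.swap_apply_def, Fin.ext_iff, two_three_four_mod_add_five]

lemma coordPerm_zero_ne_four (c : ZMod r) : coordPerm c (0 : Fin (D + 5)) ≠ 4 := by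
  unfold coordPerm
  split_ifs <;> simp [Equiv.swap_apply_def, Fin.ext_iff, two_three_four_mod_add_five]

lemma exists_coordPerm_apply_ne [Fact r.Prime] {a b : Fin (D + 5) → ZMod r} (hab : a ≠ b) :
    ∃ (c : ZMod r) (j : Fin (D + 5)), j ∉ ({0, 1} : Finset (Fin (D + 5))) ∧
      a (coordPerm c j) ≠ b (coordPerm c j) := by
  obtain ⟨i, hi⟩ := Function.ne_iff.1 hab
  by_cases h0 : i = 0
  · exact ⟨1, 2, by simp [Fin.ext_iff, two_three_four_mod_add_five],
      by rwa [coordPerm_one_two, ← h0]⟩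
  by_cases h1 : i = 1
  · exact ⟨1, 3, by simp [Fin.ext_iff, two_three_four_mod_add_five],
      by rwa [coordPerm_one_three, ← h1]⟩
  exact ⟨0, i, by simp [h0, h1], by simpa [coordPerm] using hi⟩

lemma card_le_card_affineLabel_eq_left [Fact r.Prime] {a b : Fin (D + 5) → ZMod r} (hab : a ≠ b)
    (x y : ZMod r) : r ^ (D + 5) ≤
      #{v : Fin (D + 5) → ZMod r | affineLabel v a = x ∧ affineLabel v b = y} * r ^ 3 := by
  obtain ⟨c, j, hj, hne⟩ := exists_coordPerm_apply_ne hab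
  have h := card_le_card_mul_pow_of_modify
    {v : Fin (D + 5) → ZMod r | affineLabel v a = x ∧ affineLabel v b = y} {0, 1, j} fun w => ?_
  · have hT : #({0, 1, j} : Finset (Fin (D + 5))) ≤ 3 := Finset.card_le_three
    simp only [Fintype.card_fun, ZMod.card, Fintype.card_fin] at h
    exact h.trans (Nat.mul_le_mul_left _ (Nat.pow_le_pow_right (Fact.out : r.Prime).pos hT))
  simp only [Finset.mem_insert, Finset.mem_singleton, not_or] at hj
  have hsub : a (coordPerm c j) - b (coordPerm c j) ≠ 0 := sub_ne_zero.2 hne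
  let rest : (Fin (D + 5) → ZMod r) → ZMod r := fun a =>
    a (coordPerm c 0) + ∑ i ∈ ({0, 1} : Finset (Fin (D + 5)))ᶜ.erase j, w i * a (coordPerm c i)
  let t : ZMod r := (x - y - (rest a - rest b)) / (a (coordPerm c j) - b (coordPerm c j))
  let v : Fin (D + 5) → ZMod r := fun i =>
    if i = 0 then x - rest a - t * a (coordPerm c j) else if i = 1 then c else if i = j then t
      else w i
  have hv : ∀ a, affineLabel v a = v 0 + rest a + t * a (coordPerm c j) := by
    intro a
    have hv1 : v 1 = c := by simp [v]
    have hvj : v j = t := by simp [v, hj.1, hj.2]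
    rw [affineLabel, hv1, ← Finset.add_sum_erase _ _ (a := j) (by simp [hj]), hvj,
      Finset.sum_congr rfl (g := fun i => w i * a (coordPerm c i))]
    · ring
    · intro i hi
      simp only [Finset.mem_erase, Finset.mem_compl, Finset.mem_insert, Finset.mem_singleton,
        not_or] at hi
      simp [v, hi.1, hi.2.1, hi.2.2]
  have hv0 : v 0 = x - rest a - t * a (coordPerm c j) := by simp [v]
  have ht : t * (a (coordPerm c j) - b (coordPerm c j)) = x - y - (rest a - rest b) :=
    div_mul_cancel₀ _ hsub
  refine ⟨v, ?_, fun i hi => ?_⟩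
  · simp only [Finset.mem_filter, Finset.mem_univ, true_and, hv, hv0]
    exact ⟨by ring, by linear_combination -ht⟩
  · simp only [Finset.mem_insert, Finset.mem_singleton, not_or] at hi
    simp [v, hi.1, hi.2.1, hi.2.2]

lemma card_le_card_affineLabel_eq_right [Fact r.Prime] (v : Fin (D + 5) → ZMod r)
    (x y : ZMod r) : r ^ (D + 5) ≤
      #{b : Fin (D + 5) → ZMod r | b 4 = x ∧ affineLabel v b = y} * r ^ 3 := by
  have h := card_le_card_mul_pow_of_modify
    {b : Fin (D + 5) → ZMod r | b 4 = x ∧ affineLabel v b = y} {4, coordPerm (v 1) 0} fun w => ?_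
  · have hT : #({4, coordPerm (v 1) 0} : Finset (Fin (D + 5))) ≤ 3 :=
      Finset.card_le_two.trans (by norm_num)
    simp only [Fintype.card_fun, ZMod.card, Fintype.card_fin] at h
    exact h.trans (Nat.mul_le_mul_left _ (Nat.pow_le_pow_right (Fact.out : r.Prime).pos hT))
  let b : Fin (D + 5) → ZMod r := Function.update w 4 x
  let t : ZMod r :=
    y - v 0 - ∑ j ∈ ({0, 1} : Finset (Fin (D + 5)))ᶜ, v j * b (coordPerm (v 1) j)
  refine ⟨Function.update b (coordPerm (v 1) 0) t, ?_, fun i hi => ?_⟩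
  · simp only [Finset.mem_filter, Finset.mem_univ, true_and]
    constructor
    · rw [Function.update_of_ne (coordPerm_zero_ne_four _).symm]
      simp [b]
    · rw [affineLabel, Function.update_self,
        Finset.sum_congr rfl (g := fun j => v j * b (coordPerm (v 1) j))]
      · simp only [t]
        ring
      · intro j hj
        simp only [Finset.mem_compl, Finset.mem_insert, Finset.mem_singleton, not_or] at hj
        rw [Function.update_of_ne ((coordPerm (v 1)).injective.ne hj.1)]
  · simp only [Finset.mem_insert, Finset.mem_singleton, not_or] at hi
    rw [Function.update_of_ne hi.2]
    exact Function.update_of_ne hi.1 _ _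

end Label

section LowerBound

variable {r D n : ℕ}

lemma codeg_comm {V : Type*} [DecidableEq V] [Fintype V] (H : ThreeGraph V) (u v : V) :
    codeg H u v = codeg H v u := by
  simp only [codeg, Finset.insert_comm u v]

/-- The `pointingGraph` on the vertex set `ZMod 3 × (Fin (D + 5) → ZMod r)`. -/
noncomputable def labelGraph (ε : Fin n ≃ ZMod 3 × (Fin (D + 5) → ZMod r)) : ThreeGraph (Fin n) :=
  pointingGraph (fun v => (ε v).1) (fun v => (ε v).2 4) (fun v a => unitLabel (ε v).2 (ε a).2)

lemma card_le_codeg_labelGraph_of_subset [Fact r.Prime]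
    (ε : Fin n ≃ ZMod 3 × (Fin (D + 5) → ZMod r)) (u w : Fin n) (c : ZMod 3)
    (S : Finset (Fin (D + 5) → ZMod r))
    (hS : ∀ z ∈ S, {u, w, ε.symm (c, z)} ∈ (labelGraph ε).edges) :
    #S ≤ codeg (labelGraph ε) u w := by
  refine Finset.card_le_card_of_injOn (fun z => ε.symm (c, z)) (fun z hz => ?_) fun z _ z' _ h => ?_
  · simpa using hS z hz
  · simpa using h

lemma le_codeg_labelGraph [Fact r.Prime] (ε : Fin n ≃ ZMod 3 × (Fin (D + 5) → ZMod r))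
    {u w : Fin n} (huw : u ≠ w) : r ^ (D + 5) ≤ codeg (labelGraph ε) u w * r ^ 3 := by
  have hcirc : ∀ c d : ZMod 3, c = d ∨ c = d + 1 ∨ d = c + 1 := by decide
  have hbelow : ∀ u w : Fin n, (ε u).1 = (ε w).1 + 1 →
      r ^ (D + 5) ≤ codeg (labelGraph ε) u w * r ^ 3 := by
    intro u w h
    have hd := unitLabel_ne_zero (ε u).2 (ε w).2
    refine (card_le_card_affineLabel_eq_right (ε u).2
      ((ε w).2 4 + unitLabel (ε u).2 (ε w).2) (-unitLabel (ε u).2 (ε w).2)).trans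
      (Nat.mul_le_mul_right _ (card_le_codeg_labelGraph_of_subset ε u w (ε w).1 _ fun z hz => ?_))
    obtain ⟨hz4, hz⟩ := (Finset.mem_filter.1 hz).2
    refine mem_edges_pointingGraph.2 (Or.inl ⟨?_, h, by simp, ?_, ?_⟩)
    · intro hwz
      have hwz2 : (ε w).2 = z := congrArg Prod.snd ((Equiv.eq_symm_apply ε).1 hwz)
      rw [← hwz2] at hz4
      simp [hd] at hz4
    · simp [arcShift, hz4, hd]
    · simp [arcShift, hz4, hd, unitLabel_eq (neg_ne_zero.2 hd) hz]
  rcases hcirc (ε u).1 (ε w).1 with h | h | h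
  · have hne : (ε u).2 ≠ (ε w).2 := fun h' => huw (ε.injective (Prod.ext h h'))
    refine (card_le_card_affineLabel_eq_left hne (arcShift (fun v => (ε v).2 4) u w)
      (arcShift (fun v => (ε v).2 4) w u)).trans (Nat.mul_le_mul_right _
      (card_le_codeg_labelGraph_of_subset ε u w ((ε u).1 + 1) _ fun z hz => ?_))
    obtain ⟨hzu, hzw⟩ := (Finset.mem_filter.1 hz).2
    refine mem_edges_pointingGraph.2 (Or.inr (Or.inr ⟨huw, by simp, h.symm, ?_, ?_⟩))
    · simpa using unitLabel_eq (arcShift_ne_zero _ _ _) hzu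
    · simpa using unitLabel_eq (arcShift_ne_zero _ _ _) hzw
  · exact hbelow u w h
  · rw [codeg_comm]
    exact hbelow w u h

/-- A 3-graph none of whose labelings of `A` is free of monotone `P₃`s in the links has positive
codegree Turán density. -/
theorem piCo_pos_of_forall_labeling {α : Type*} [Fintype α] [DecidableEq α] (F : ThreeGraph α)
    (A B : Finset α) (h : ¬ ∃ σ : α → ℕ, IsLabeling A σ ∧ ∀ v ∈ B,
      ¬ ∃ a ∈ A, ∃ b ∈ A, ∃ c ∈ A, σ a < σ b ∧ σ b < σ c ∧
        ({v, a, b} : Finset α) ∈ F.edges ∧ ({v, b, c} : Finset α) ∈ F.edges) :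
    0 < piCo F := by
  obtain ⟨r, hr, hprime⟩ := Nat.exists_infinite_primes (Fintype.card α + 3)
  have : Fact r.Prime := ⟨hprime⟩
  have hr0 : (1 : ℝ) ≤ r := by exact_mod_cast hprime.one_lt.le
  have hx : (0 : ℝ) < 1 / (3 * (r : ℝ) ^ 3) := by positivity
  refine hx.trans_le (le_csSup ⟨1, fun y hy => hy.2.1⟩ ⟨hx.le, ?_, fun n₀ => ?_⟩)
  · rw [div_le_one (by positivity)]
    have := one_le_pow₀ hr0 (n := 3)
    linarith
  · have hcard : Fintype.card (ZMod 3 × (Fin (n₀ + 5) → ZMod r)) = 3 * r ^ (n₀ + 5) := by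
      simp [ZMod.card]
    let ε : Fin (3 * r ^ (n₀ + 5)) ≃ ZMod 3 × (Fin (n₀ + 5) → ZMod r) :=
      (Fintype.equivFinOfCardEq hcard).symm
    refine ⟨3 * r ^ (n₀ + 5), ?_, labelGraph ε, fun hcopy => h ?_, fun u v huv => ?_⟩
    · have := Nat.lt_pow_self hprime.one_lt (n := n₀ + 5)
      lia
    · obtain ⟨σ, hσ, hmon⟩ :=
        exists_labeling_of_hasCopy_pointingGraph (by lia) (by lia) F A hcopy
      exact ⟨σ, hσ, fun v _ => hmon v⟩
    · have hco : (r : ℝ) ^ (n₀ + 5) ≤ codeg (labelGraph ε) u v * (r : ℝ) ^ 3 := by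
        exact_mod_cast le_codeg_labelGraph ε huv
      push_cast
      rw [div_mul_eq_mul_div, div_le_iff₀ (by positivity)]
      linarith

end LowerBound

/-- A labeling whose links have no monotone `P₃` forces the codegree Turán density to vanish. -/
theorem piCo_eq_zero_of_labeling {α : Type*} [Fintype α] [DecidableEq α] (F : ThreeGraph α)
    (A B : Finset α) (hdisj : Disjoint A B) (hcover : A ∪ B = Finset.univ)
    (htype : ∀ e ∈ F.edges, #(e ∩ A) = 2 ∧ #(e ∩ B) = 1) (σ : α → ℕ) (hσ : IsLabeling A σ)
    (hmon : ∀ v ∈ B, ¬ ∃ a ∈ A, ∃ b ∈ A, ∃ c ∈ A, σ a < σ b ∧ σ b < σ c ∧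
      ({v, a, b} : Finset α) ∈ F.edges ∧ ({v, b, c} : Finset α) ∈ F.edges) :
    piCo F = 0 := by
  refine le_antisymm (Real.sSup_nonpos fun x hx => ?_) (Real.sSup_nonneg fun x hx => hx.1)
  obtain ⟨-, -, hx⟩ := hx
  by_contra! hpos
  choose n hn H hfree hH using hx
  obtain ⟨k, hk⟩ :=
    exists_hasCopy_of_labeling F A B hdisj hcover htype σ hσ hmon hn H hpos hH
  exact hfree k hk

/-- For a `(2,1)`-type 3-graph `F` with first layer `A` and second layer `B`,
`π_co(F) = 0` iff there is a labeling of `A` such that no link graph of a vertex of `B`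
contains a monotone `P₃`. -/
theorem stmt3 {α : Type} [Fintype α] [DecidableEq α] (F : ThreeGraph α)
    (A B : Finset α) (hdisj : Disjoint A B) (hcover : A ∪ B = Finset.univ)
    (htype : ∀ e ∈ F.edges, (e ∩ A).card = 2 ∧ (e ∩ B).card = 1) :
    piCo F = 0 ↔
      ∃ σ : α → ℕ, IsLabeling A σ ∧ ∀ v ∈ B,
        ¬ ∃ a ∈ A, ∃ b ∈ A, ∃ c ∈ A, σ a < σ b ∧ σ b < σ c ∧
          ({v, a, b} : Finset α) ∈ F.edges ∧ ({v, b, c} : Finset α) ∈ F.edges := by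
  constructor
  · intro h
    by_contra hne
    exact (piCo_pos_of_forall_labeling F A B hne).ne' h
  · rintro ⟨σ, hσ, hmon⟩
    exact piCo_eq_zero_of_labeling F A B hdisj hcover htype σ hσ hmon
end

section
/- For every integer ℓ ≥ 5, the codegree Turán density of the tight cycle of length ℓ with one edge removed satisfies π_co(C_ℓ^{(3)−}) = 0. -/
open Finset

variable {α β : Type*}

universe u

/-- Sufficiently many subsets of positive density contain two with large intersection. -/
lemma exists_large_inter {ι V : Type*} [DecidableEq ι] [Fintype V] [DecidableEq V]
    (Y : Finset ι) (N : ι → Finset V) {a : ℝ} (hV : 0 < Fintype.card V)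
    (hY : 2 ≤ a * #Y) (hN : ∀ y ∈ Y, a * Fintype.card V ≤ #(N y)) :
    ∃ y ∈ Y, ∃ z ∈ Y, y ≠ z ∧ 1 / (2 * (#Y : ℝ) ^ 2) * Fintype.card V ≤ #(N y ∩ N z) := by
  by_contra! hcon
  have hV' : (0 : ℝ) < Fintype.card V := by exact_mod_cast hV
  have hY0 : (0 : ℝ) < #Y := by
    rcases Nat.eq_zero_or_pos #Y with h | h
    · rw [h] at hY; norm_num at hY
    · exact_mod_cast h
  have hpoint : ∀ v : V, #{y ∈ Y | v ∈ N y} ≤ 1 + #{p ∈ Y.offDiag | v ∈ N p.1 ∩ N p.2} := by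
    intro v
    have hoff : {p ∈ Y.offDiag | v ∈ N p.1 ∩ N p.2} = ({y ∈ Y | v ∈ N y} : Finset ι).offDiag := by
      ext p
      simp only [mem_filter, mem_offDiag, mem_inter]
      tauto
    rw [hoff, offDiag_card]
    rcases Nat.lt_or_ge #{y ∈ Y | v ∈ N y} 2 with h | h
    · omega
    · have := Nat.mul_le_mul_right #{y ∈ Y | v ∈ N y} h
      omega
  have hsum : ∑ y ∈ Y, #(N y) ≤ Fintype.card V + ∑ p ∈ Y.offDiag, #(N p.1 ∩ N p.2) := by
    have h₁ : ∑ y ∈ Y, #(N y) = ∑ v : V, #{y ∈ Y | v ∈ N y} := by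
      simpa [bipartiteAbove, bipartiteBelow] using
        sum_card_bipartiteAbove_eq_sum_card_bipartiteBelow (s := Y) (t := univ) fun y v => v ∈ N y
    have h₂ : ∑ p ∈ Y.offDiag, #(N p.1 ∩ N p.2)
        = ∑ v : V, #{p ∈ Y.offDiag | v ∈ N p.1 ∩ N p.2} := by
      simpa only [bipartiteAbove, bipartiteBelow, filter_mem_eq_inter, univ_inter] using
        sum_card_bipartiteAbove_eq_sum_card_bipartiteBelow (s := Y.offDiag) (t := univ)
          fun p v => v ∈ N p.1 ∩ N p.2
    rw [h₁, h₂]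
    calc _ ≤ ∑ v : V, (1 + #{p ∈ Y.offDiag | v ∈ N p.1 ∩ N p.2}) := sum_le_sum fun v _ => hpoint v
      _ = _ := by simp [sum_add_distrib]
  have hlow : (#Y : ℝ) * (a * Fintype.card V) ≤ ∑ y ∈ Y, (#(N y) : ℝ) := by
    rw [← nsmul_eq_mul]
    exact card_nsmul_le_sum _ _ _ hN
  have hup : ∑ p ∈ Y.offDiag, (#(N p.1 ∩ N p.2) : ℝ) ≤ 1 / 2 * Fintype.card V := by
    calc _ ≤ ∑ p ∈ Y.offDiag, 1 / (2 * (#Y : ℝ) ^ 2) * Fintype.card V := by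
          refine sum_le_sum fun p hp => ?_
          rw [mem_offDiag] at hp
          exact (hcon _ hp.1 _ hp.2.1 hp.2.2).le
      _ = (#Y.offDiag : ℝ) * (1 / (2 * (#Y : ℝ) ^ 2) * Fintype.card V) := by simp
      _ ≤ (#Y : ℝ) ^ 2 * (1 / (2 * (#Y : ℝ) ^ 2) * Fintype.card V) := by
          gcongr
          rw [offDiag_card, pow_two]
          exact_mod_cast Nat.sub_le _ _
      _ = _ := by field_simp
  have hsum' : ∑ y ∈ Y, (#(N y) : ℝ)
      ≤ Fintype.card V + ∑ p ∈ Y.offDiag, (#(N p.1 ∩ N p.2) : ℝ) := by exact_mod_cast hsum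
  nlinarith

/-- Ramsey theorem for graphs. -/
lemma exists_ramsey (k s : ℕ) : ∃ N : ℕ, ∀ {V : Type u} (r : V → V → Prop),
    (∀ x y, r x y → r y x) → ∀ Q : Finset V, N ≤ #Q →
      (∃ C ⊆ Q, #C = k ∧ (C : Set V).Pairwise fun x y => ¬ r x y) ∨
      (∃ C ⊆ Q, #C = s ∧ (C : Set V).Pairwise r) := by
  classical
  induction k generalizing s with
  | zero => exact ⟨0, fun r _ Q _ => Or.inl ⟨∅, by simp, by simp, by simp⟩⟩
  | succ k ihk =>
    induction s with
    | zero => exact ⟨0, fun r _ Q _ => Or.inr ⟨∅, by simp, by simp, by simp⟩⟩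
    | succ s ihs =>
      obtain ⟨N₁, h₁⟩ := ihk (s + 1)
      obtain ⟨N₂, h₂⟩ := ihs
      refine ⟨N₁ + N₂ + 1, fun {V} r hr Q hQ => ?_⟩
      obtain ⟨v, hv⟩ : Q.Nonempty := card_pos.mp (by omega)
      have hsplit : #{x ∈ Q.erase v | r v x} + #{x ∈ Q.erase v | ¬ r v x} = #Q - 1 := by
        rw [← card_erase_of_mem hv]
        exact card_filter_add_card_filter_not _
      have hsub : ∀ {p : V → Prop} [DecidablePred p] {C : Finset V}, C ⊆ (Q.erase v).filter p →
          C ⊆ Q ∧ v ∉ C ∧ ∀ x ∈ C, p x := by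
        intro p _ C hC
        refine ⟨fun x hx => mem_of_mem_erase (mem_filter.mp (hC hx)).1, fun hx => ?_,
          fun x hx => (mem_filter.mp (hC hx)).2⟩
        simpa using hC hx
      rcases Nat.lt_or_ge #{x ∈ Q.erase v | r v x} N₂ with hlt | hge
      · rcases h₁ r hr {x ∈ Q.erase v | ¬ r v x} (by omega) with ⟨C, hC, hcard, hp⟩ | ⟨C, hC, h⟩
        · obtain ⟨hCQ, hvC, hCr⟩ := hsub hC
          refine Or.inl ⟨insert v C, insert_subset hv hCQ, by rw [card_insert_of_notMem hvC, hcard],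
            ?_⟩
          rw [coe_insert, Set.pairwise_insert]
          exact ⟨hp, fun x hx _ => ⟨hCr x hx, fun h => hCr x hx (hr _ _ h)⟩⟩
        · exact Or.inr ⟨C, (hsub hC).1, h⟩
      · rcases h₂ r hr {x ∈ Q.erase v | r v x} hge with ⟨C, hC, h⟩ | ⟨C, hC, hcard, hp⟩
        · exact Or.inl ⟨C, (hsub hC).1, h⟩
        · obtain ⟨hCQ, hvC, hCr⟩ := hsub hC
          refine Or.inr ⟨insert v C, insert_subset hv hCQ, by rw [card_insert_of_notMem hvC, hcard],
            ?_⟩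
          rw [coe_insert, Set.pairwise_insert]
          exact ⟨hp, fun x hx _ => ⟨hCr x hx, hr _ _ (hCr x hx)⟩⟩

/-- Let `I x y z` be symmetric in `y` and `z`, such that for every `x` any `k` further points contain
distinct `y`, `z` with `I x y z`. Then every large finite set contains a triple for which `I` holds
with respect to two of its three apices. -/
lemma exists_two_apices (k : ℕ) : ∃ M : ℕ, ∀ {V : Type u} (I : V → V → V → Prop),
    (∀ x y z, I x y z → I x z y) →
    (∀ x, ∀ Y : Finset V, x ∉ Y → #Y = k → ∃ y ∈ Y, ∃ z ∈ Y, y ≠ z ∧ I x y z) →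
    ∀ Q : Finset V, M ≤ #Q →
      ∃ p ∈ Q, ∃ q ∈ Q, ∃ r ∈ Q, p ≠ q ∧ p ≠ r ∧ q ≠ r ∧ I p q r ∧ I q p r := by
  classical
  have key : ∀ t : ℕ, ∃ M : ℕ, ∀ {V : Type u} (I : V → V → V → Prop),
    (∀ x y z, I x y z → I x z y) →
    (∀ x, ∀ Y : Finset V, x ∉ Y → #Y = k → ∃ y ∈ Y, ∃ z ∈ Y, y ≠ z ∧ I x y z) →
    ∀ Q : Finset V, M ≤ #Q →
      (∃ p ∈ Q, ∃ q ∈ Q, ∃ r ∈ Q, p ≠ q ∧ p ≠ r ∧ q ≠ r ∧ I p q r ∧ I q p r) ∨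
      ∃ y ∈ Q, ∃ X ⊆ Q, y ∉ X ∧ #X = t ∧ (X : Set V).Pairwise fun x x' => ¬ I y x x' := by
    intro t
    induction t with
    | zero =>
      refine ⟨1, fun I _ _ Q hQ => Or.inr ?_⟩
      obtain ⟨y, hy⟩ : Q.Nonempty := card_pos.mp hQ
      exact ⟨y, hy, ∅, by simp⟩
    | succ t ih =>
      obtain ⟨M, hM⟩ := ih
      obtain ⟨N, hN⟩ := exists_ramsey k M
      refine ⟨N + 1, fun {V} I hsymm hI Q hQ => ?_⟩
      obtain ⟨x, hx⟩ : Q.Nonempty := card_pos.mp (by omega)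
      rcases hN (I x) (hsymm x) (Q.erase x) (by rw [card_erase_of_mem hx]; omega) with
        ⟨C, hC, hcard, hp⟩ | ⟨C, hC, hcard, hp⟩
      · obtain ⟨y, hy, z, hz, hyz, h⟩ := hI x C (fun h => by simpa using hC h) hcard
        exact absurd h (hp hy hz hyz)
      · have hxC : x ∉ C := fun h => by simpa using hC h
        have hCQ : C ⊆ Q := hC.trans (erase_subset _ _)
        rcases hM I hsymm hI C hcard.ge with ⟨p, hp, q, hq, r, hr, h⟩ | ⟨y, hy, X, hX, hyX, ht, hpX⟩
        · exact Or.inl ⟨p, hCQ hp, q, hCQ hq, r, hCQ hr, h⟩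
        · have hxy : x ≠ y := fun h => hxC (h ▸ hy)
          by_cases hbad : ∃ z ∈ X, I y x z
          · obtain ⟨z, hz, hIz⟩ := hbad
            have hyz : y ≠ z := fun h => hyX (h ▸ hz)
            exact Or.inl ⟨x, hx, y, hCQ hy, z, hCQ (hX hz), hxy, fun h => hxC (h ▸ hX hz), hyz,
              hp hy (hX hz) hyz, hIz⟩
          · push Not at hbad
            refine Or.inr ⟨y, hCQ hy, insert x X, insert_subset hx (hX.trans hCQ), ?_, ?_, ?_⟩
            · simp [hyX, hxy.symm]
            · rw [card_insert_of_notMem fun h => hxC (hX h), ht]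
            · rw [coe_insert, Set.pairwise_insert]
              exact ⟨hpX, fun z hz _ => ⟨hbad z hz, fun h => hbad z hz (hsymm _ _ _ h)⟩⟩
  obtain ⟨M, hM⟩ := key k
  refine ⟨M, fun I hsymm hI Q hQ => ?_⟩
  rcases hM I hsymm hI Q hQ with h | ⟨y, _, X, _, hyX, hcard, hp⟩
  · exact h
  · obtain ⟨x, hx, x', hx', hne, h⟩ := hI y X hyX hcard
    exact absurd h (hp hx hx' hne)

/-- Among many subsets of positive density, a positive proportion share `t` common elements. -/
lemma exists_common_subset {V W : Type*} [Fintype V] [DecidableEq V] {c : ℝ} (hc : 0 < c) (t : ℕ)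
    (htV : t ≤ Fintype.card V) (hV : 2 * t ≤ c * Fintype.card V) (S : Finset W) (N : W → Finset V)
    (hN : ∀ w ∈ S, c * Fintype.card V ≤ #(N w)) :
    ∃ A : Finset V, #A = t ∧ (c / 2) ^ t * #S ≤ #{w ∈ S | A ⊆ N w} := by
  induction t with
  | zero => exact ⟨∅, by simp⟩
  | succ t ih =>
    push_cast at hV
    obtain ⟨A, hA, hS⟩ := ih (by omega) (by linarith)
    set S' : Finset W := {w ∈ S | A ⊆ N w} with hS'
    have hcount : ∑ a ∈ Aᶜ, #{w ∈ S' | a ∈ N w} = ∑ w ∈ S', #(N w \ A) := by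
      have := sum_card_bipartiteAbove_eq_sum_card_bipartiteBelow (s := Aᶜ) (t := S')
        fun a w => a ∈ N w
      simp only [bipartiteAbove, bipartiteBelow] at this
      rw [this]
      refine sum_congr rfl fun w _ => congrArg _ ?_
      ext a
      simp [and_comm]
    have hlow : ∑ a ∈ Aᶜ, c / 2 * (#S' : ℝ) ≤ ∑ a ∈ Aᶜ, (#{w ∈ S' | a ∈ N w} : ℝ) := by
      calc ∑ a ∈ Aᶜ, c / 2 * (#S' : ℝ) = #Aᶜ * (c / 2 * (#S' : ℝ)) := by simp
        _ ≤ Fintype.card V * (c / 2 * (#S' : ℝ)) := by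
            gcongr
            exact card_le_univ _
        _ = ∑ w ∈ S', c / 2 * Fintype.card V := by
            rw [sum_const, nsmul_eq_mul]
            ring
        _ ≤ ∑ w ∈ S', (#(N w \ A) : ℝ) := by
            refine sum_le_sum fun w hw => ?_
            have h₁ := hN w (mem_filter.mp hw).1
            have h₂ : (#(N w) : ℝ) ≤ #(N w \ A) + t := by
              rw [← hA]
              exact_mod_cast tsub_le_iff_right.mp (le_card_sdiff A (N w))
            linarith
        _ = _ := by exact_mod_cast hcount.symm
    have hne : (Aᶜ : Finset V).Nonempty := by
      rw [← card_pos, card_compl]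
      omega
    obtain ⟨a, ha, hle⟩ := exists_le_of_sum_le hne hlow
    rw [mem_compl] at ha
    refine ⟨insert a A, by rw [card_insert_of_notMem ha, hA], ?_⟩
    have hfilter : {w ∈ S | insert a A ⊆ N w} = {w ∈ S' | a ∈ N w} := by
      ext w
      simp only [hS', mem_filter, insert_subset_iff]
      tauto
    rw [hfilter]
    calc (c / 2) ^ (t + 1) * #S = c / 2 * ((c / 2) ^ t * #S) := by ring
      _ ≤ c / 2 * #S' := by gcongr
      _ ≤ _ := hle

/-- **Erdős box theorem**: a dense `r`-ary relation contains a large complete `r`-partite one. -/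
lemma exists_box_s4 (r t : ℕ) {c : ℝ} (hc : 0 < c) : ∃ n₀ : ℕ, ∀ {V : Type u} [Fintype V]
    [DecidableEq V], n₀ ≤ Fintype.card V → ∀ S : Finset (Fin r → V),
      c * (Fintype.card V : ℝ) ^ r ≤ #S →
      ∃ A : Fin r → Finset V, (∀ i, #(A i) = t) ∧ ∀ f : Fin r → V, (∀ i, f i ∈ A i) → f ∈ S := by
  induction r generalizing c with
  | zero =>
    refine ⟨0, fun {V} _ _ _ S hS => ⟨fun _ => ∅, fun i => i.elim0, fun f _ => ?_⟩⟩
    obtain ⟨g, hg⟩ : S.Nonempty := by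
      rw [← card_pos]
      rw [pow_zero, mul_one] at hS
      exact_mod_cast hc.trans_le hS
    rwa [Subsingleton.elim f g]
  | succ r ih =>
    have hc' : 0 < (c / 2 / 2) ^ t * (c / 2) := by positivity
    obtain ⟨n₁, hn₁⟩ := ih hc'
    refine ⟨n₁ + t + ⌈2 * t / (c / 2)⌉₊ + 1, fun {V} _ _ hV S hS => ?_⟩
    have hbig : 2 * t ≤ c / 2 * Fintype.card V := by
      have h : 2 * t / (c / 2) ≤ Fintype.card V :=
        (Nat.le_ceil _).trans (Nat.cast_le.mpr (by omega))
      rw [div_le_iff₀ (by positivity)] at h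
      linarith
    let N : (Fin r → V) → Finset V := fun w => {v | Fin.cons v w ∈ S}
    let W : Finset (Fin r → V) := {w | c / 2 * Fintype.card V ≤ #(N w)}
    have hsum : #S = ∑ w : Fin r → V, #(N w) := by
      rw [← card_sigma]
      refine card_bij' (fun f _ => ⟨Fin.tail f, f 0⟩) (fun p _ => Fin.cons p.2 p.1) ?_ ?_ ?_ ?_ <;>
        simp [N]
    have hW : c / 2 * (Fintype.card V : ℝ) ^ r ≤ #W := by
      have hsum' : (#S : ℝ) ≤ #W * Fintype.card V
          + (Fintype.card V : ℝ) ^ r * (c / 2 * Fintype.card V) := by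
        rw [hsum]
        push_cast
        calc ∑ w : Fin r → V, (#(N w) : ℝ)
            ≤ ∑ w : Fin r → V, ((if w ∈ W then (Fintype.card V : ℝ) else 0)
              + c / 2 * Fintype.card V) := by
              refine sum_le_sum fun w _ => ?_
              split_ifs with h
              · have : (#(N w) : ℝ) ≤ Fintype.card V := by exact_mod_cast card_le_univ _
                linarith [show 0 ≤ c / 2 * (Fintype.card V : ℝ) by positivity]
              · have : ¬ c / 2 * Fintype.card V ≤ (#(N w) : ℝ) := by simpa [W] using h
                linarith
          _ = _ := by simp [sum_add_distrib]
      have hpos' : (0 : ℝ) < Fintype.card V := by exact_mod_cast (by omega : 0 < Fintype.card V)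
      rw [pow_succ] at hS
      refine le_of_mul_le_mul_right ?_ hpos'
      linarith
    obtain ⟨A₀, hA₀, hle⟩ := exists_common_subset (half_pos hc) t (by omega) hbig W N
      (fun w hw => (mem_filter.mp hw).2)
    obtain ⟨A, hA, hbox⟩ := hn₁ (by omega) {w ∈ W | A₀ ⊆ N w} (by
      refine le_trans ?_ hle
      rw [mul_assoc]
      gcongr)
    refine ⟨Fin.cons A₀ A, Fin.cases hA₀ hA, fun f hf => ?_⟩
    have h := (mem_filter.mp (hbox (Fin.tail f) fun i => by simpa [Fin.tail] using hf i.succ)).2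
      (by simpa using hf 0 : f 0 ∈ A₀)
    simpa [N] using h

/-- The edges of `C₅⁻`. -/
def fiveCycleEdges : Finset (Finset (Fin 5)) := {{0, 1, 2}, {1, 2, 3}, {2, 3, 4}, {3, 4, 0}}

lemma ne_of_mem_fiveCycleEdges : ∀ {a b c : Fin 5}, {a, b, c} ∈ fiveCycleEdges →
    a ≠ b ∧ a ≠ c ∧ b ≠ c := by
  decide

/-- `C_ℓ⁻` maps homomorphically to `C₅⁻` for every `ℓ ≥ 5`. -/
lemma exists_walk_fiveCycle {ℓ : ℕ} (hℓ : 5 ≤ ℓ) : ∃ g : ℕ → Fin 5, g ℓ = g 0 ∧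
    ∀ k, k + 2 ≤ ℓ → {g k, g (k + 1), g (k + 2)} ∈ fiveCycleEdges := by
  induction ℓ using Nat.strong_induction_on with
  | _ ℓ ih =>
    rcases (by omega : ℓ = 5 ∨ ℓ = 6 ∨ ℓ = 7 ∨ 8 ≤ ℓ) with rfl | rfl | rfl | h
    · refine ⟨fun k => [0, 1, 2, 3, 4, 0].getD k 0, rfl, fun k hk => ?_⟩
      have : k ≤ 3 := by omega
      interval_cases k <;> decide
    · refine ⟨fun k => [0, 1, 2, 0, 1, 2, 0].getD k 0, rfl, fun k hk => ?_⟩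
      have : k ≤ 4 := by omega
      interval_cases k <;> decide
    · refine ⟨fun k => [0, 2, 1, 3, 2, 4, 3, 0].getD k 0, rfl, fun k hk => ?_⟩
      have : k ≤ 5 := by omega
      interval_cases k <;> decide
    · obtain ⟨g, hg, hwalk⟩ := ih (ℓ - 3) (by omega) (by omega)
      have hrot : ∀ a b c : Fin 5, {a, b, c} ∈ fiveCycleEdges → {b, c, a} ∈ fiveCycleEdges := by
        decide
      have h₀ := hwalk 0 (by omega)
      refine ⟨fun k => if k < 3 then g k else g (k - 3), ?_, fun k hk => ?_⟩
      · beta_reduce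
        rw [if_neg (by omega), if_pos (by omega), hg]
      · rcases (by omega : k = 0 ∨ k = 1 ∨ k = 2 ∨ 3 ≤ k) with rfl | rfl | rfl | h3
        · exact h₀
        · exact hrot _ _ _ h₀
        · exact hrot _ _ _ (hrot _ _ _ h₀)
        · obtain ⟨j, rfl⟩ := Nat.exists_eq_add_of_le' h3
          beta_reduce
          rw [if_neg (by omega), if_neg (by omega), if_neg (by omega)]
          exact hwalk j (by omega)

/-- At least a `2⁻ᵐ` proportion of the maps from an `m`-set to a large set is injective. -/
lemma card_injective_ge {V : Type*} [Fintype V] [DecidableEq V] (m : ℕ)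
    (hV : 2 * m ≤ Fintype.card V) :
    (1 / 2) ^ m * (Fintype.card V : ℝ) ^ m ≤ #{f : Fin m → V | Function.Injective f} := by
  have hcard : #{f : Fin m → V | Function.Injective f} = (Fintype.card V).descFactorial m := by
    rw [← Fintype.card_subtype, Fintype.card_congr (Equiv.subtypeInjectiveEquivEmbedding _ _),
      Fintype.card_embedding_eq, Fintype.card_fin]
  have hle : ((Fintype.card V + 1 - m : ℕ) : ℝ) ^ m ≤ ((Fintype.card V).descFactorial m : ℝ) := by
    exact_mod_cast Nat.pow_sub_le_descFactorial _ _
  rw [hcard, ← mul_pow]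
  refine le_trans ?_ hle
  gcongr
  rw [Nat.cast_sub (by omega)]
  have : 2 * (m : ℝ) ≤ Fintype.card V := by exact_mod_cast hV
  push_cast
  linarith

/-- A large 3-graph with positive codegree density contains every blow-up of `C₅⁻`, possibly with
overlapping parts. -/
lemma exists_blowup_fiveCycle {c : ℝ} (hc : 0 < c) {t : ℕ} (ht : 0 < t) : ∃ n₀ : ℕ,
    ∀ {V : Type u} [Fintype V] [DecidableEq V] (H : ThreeGraph V), n₀ ≤ Fintype.card V →
      (∀ u v : V, u ≠ v → c * Fintype.card V ≤ codeg H u v) →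
      ∃ A : Fin 5 → Finset V, (∀ i, #(A i) = t) ∧
        ∀ x : Fin 5 → V, (∀ i, x i ∈ A i) → ∀ e ∈ fiveCycleEdges, e.image x ∈ H.edges := by
  classical
  obtain ⟨k, hk⟩ := exists_nat_ge (2 / c)
  have hk0 : (0 : ℝ) < k := lt_of_lt_of_le (by positivity) hk
  have hkc : 2 ≤ c * k := by
    rw [div_le_iff₀ hc] at hk
    linarith
  let b : ℝ := 1 / (2 * (k : ℝ) ^ 2)
  have hb : 0 < b := by positivity
  obtain ⟨M, hM⟩ := exists_two_apices.{u} k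
  let m := M + 1
  let d : ℝ := (1 / 2) ^ m / (m : ℝ) ^ 3
  have hd : 0 < d := by positivity
  obtain ⟨n₁, hn₁⟩ := exists_box_s4.{u} m t
    (c := (b / 2) ^ t * ((b / 2) ^ t * d)) (by positivity)
  refine ⟨n₁ + t + ⌈2 * t / b⌉₊ + 2 * m, fun {V} _ _ H hV hH => ?_⟩
  have hbig : 2 * t ≤ b * Fintype.card V := by
    have h : 2 * t / b ≤ Fintype.card V :=
      (Nat.le_ceil _).trans (Nat.cast_le.mpr (by omega))
    rw [div_le_iff₀ hb] at h
    linarith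
  let N : V → V → Finset V := fun u v => {w | {u, v, w} ∈ H.edges}
  let I : V → V → V → Prop := fun x y z => b * Fintype.card V ≤ #(N x y ∩ N x z)
  let P : Fin m × Fin m × Fin m → (Fin m → V) → Prop := fun s f =>
    s.1 ≠ s.2.1 ∧ s.1 ≠ s.2.2 ∧ s.2.1 ≠ s.2.2 ∧
      I (f s.1) (f s.2.1) (f s.2.2) ∧ I (f s.2.1) (f s.1) (f s.2.2)
  have hI : ∀ x, ∀ Y : Finset V, x ∉ Y → #Y = k → ∃ y ∈ Y, ∃ z ∈ Y, y ≠ z ∧ I x y z := by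
    intro x Y hx hY
    have := exists_large_inter Y (N x) (by omega) (a := c) (by rwa [hY])
      (fun y hy => hH x y fun h => hx (h ▸ hy))
    rwa [hY] at this
  have hP : ∀ f : Fin m → V, Function.Injective f → ∃ s, P s f := by
    intro f hf
    obtain ⟨p, hp, q, hq, r, hr, hpq, hpr, hqr, h⟩ := hM I
      (fun x y z h => by simpa only [I, inter_comm] using h) hI (univ.image f)
      (by rw [card_image_of_injective _ hf, card_fin]; omega)
    simp only [mem_image, mem_univ, true_and] at hp hq hr
    obtain ⟨⟨i, rfl⟩, ⟨j, rfl⟩, ⟨l, rfl⟩⟩ := And.intro hp (And.intro hq hr)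
    exact ⟨(i, j, l), ne_of_apply_ne f hpq, ne_of_apply_ne f hpr, ne_of_apply_ne f hqr, h⟩
  obtain ⟨⟨i, j, l⟩, hs⟩ : ∃ s, d * (Fintype.card V : ℝ) ^ m ≤ #{f | P s f} := by
    have hsub : ({f : Fin m → V | Function.Injective f} : Finset _)
        ⊆ univ.biUnion fun s => {f | P s f} := by
      intro f hf
      obtain ⟨s, hs⟩ := hP f (mem_filter.mp hf).2
      exact mem_biUnion.mpr ⟨s, mem_univ _, by simpa using hs⟩
    have hcard : (#{f : Fin m → V | Function.Injective f} : ℝ) ≤ ∑ s, (#{f | P s f} : ℝ) := by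
      exact_mod_cast (card_le_card hsub).trans card_biUnion_le
    have hlow := (card_injective_ge m (by omega)).trans hcard
    obtain ⟨s, -, h⟩ := exists_le_of_sum_le (s := univ) univ_nonempty
      (f := fun _ : Fin m × Fin m × Fin m => d * (Fintype.card V : ℝ) ^ m) (by
        refine le_trans (le_of_eq ?_) hlow
        have hm : (m : ℝ) ≠ 0 := by positivity
        simp only [sum_const, card_univ, Fintype.card_prod, Fintype.card_fin, nsmul_eq_mul, d]
        push_cast
        field_simp)
    exact ⟨s, h⟩
  obtain ⟨B, hB, hBS⟩ := exists_common_subset hb t (by omega) hbig {f | P (i, j, l) f}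
    (fun f => N (f i) (f j) ∩ N (f i) (f l)) (fun f hf => (mem_filter.mp hf).2.2.2.2.1)
  set S₁ : Finset (Fin m → V) :=
    {f ∈ {f | P (i, j, l) f} | B ⊆ N (f i) (f j) ∩ N (f i) (f l)}
  have hPS : ∀ f ∈ S₁, P (i, j, l) f := fun f hf => (mem_filter.mp (mem_filter.mp hf).1).2
  obtain ⟨B', hB', hBS'⟩ := exists_common_subset hb t (by omega) hbig S₁
    (fun f => N (f j) (f i) ∩ N (f j) (f l)) (fun f hf => (hPS f hf).2.2.2.2)
  obtain ⟨A, hA, hbox⟩ := hn₁ (by omega)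
    {f ∈ S₁ | B' ⊆ N (f j) (f i) ∩ N (f j) (f l)} (by
      refine le_trans ?_ hBS'
      rw [mul_assoc, mul_assoc]
      gcongr
      exact le_trans (by gcongr) hBS)
  have hne : ∀ s, (A s).Nonempty := fun s => card_pos.mp (by rw [hA]; exact ht)
  choose a ha using hne
  obtain ⟨hij, hil, hjl, -⟩ := hPS a (mem_filter.mp (hbox a ha)).1
  refine ⟨![A l, B, A i, A j, B'], ?_, fun x hx => ?_⟩
  · simp [Fin.forall_fin_succ, hA, hB, hB']
  · let f : Fin m → V := fun s =>
      if s = i then x 2 else if s = j then x 3 else if s = l then x 0 else a s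
    have hfi : f i = x 2 := by simp [f]
    have hfj : f j = x 3 := by simp [f, hij.symm]
    have hfl : f l = x 0 := by simp [f, hil.symm, hjl.symm]
    have hf := mem_filter.mp (hbox f fun s => by
      simp only [f]
      split_ifs with h₁ h₂ h₃
      · exact h₁ ▸ hx 2
      · exact h₂ ▸ hx 3
      · exact h₃ ▸ hx 0
      · exact ha s)
    have h₁ := (mem_filter.mp hf.1).2 (hx 1)
    have h₂ := hf.2 (hx 4)
    simp only [hfi, hfj, hfl, N, mem_inter, mem_filter, mem_univ, true_and] at h₁ h₂
    simp only [fiveCycleEdges, mem_insert, mem_singleton, forall_eq_or_imp, forall_eq, image_insert,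
      image_singleton]
    refine ⟨?_, ?_, ?_, ?_⟩
    · convert h₁.2 using 1
      grind
    · convert h₁.1 using 1
      grind
    · convert h₂.1 using 1
      grind
    · convert h₂.2 using 1
      grind

/-- A blow-up of `C₅⁻` whose (possibly overlapping) parts have size `ℓ` contains `C_ℓ⁻`. -/
lemma hasCopy_of_blowup_fiveCycle {V : Type*} [DecidableEq V] {ℓ : ℕ} (hℓ : 5 ≤ ℓ)
    (F : ThreeGraph (ZMod ℓ))
    (hF : ∀ e ∈ F.edges, ∃ i : ZMod ℓ, i ≠ -1 ∧ e = {i, i + 1, i + 2})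
    (H : ThreeGraph V) (A : Fin 5 → Finset V) (hA : ∀ i, #(A i) = ℓ)
    (hbox : ∀ x : Fin 5 → V, (∀ i, x i ∈ A i) → ∀ e ∈ fiveCycleEdges, e.image x ∈ H.edges) :
    HasCopy H F := by
  have : NeZero ℓ := ⟨by omega⟩
  obtain ⟨g, hg, hwalk⟩ := exists_walk_fiveCycle hℓ
  obtain ⟨φ, hφ, hmem⟩ := (all_card_le_biUnion_card_iff_exists_injective
    fun i : ZMod ℓ => A (g i.val)).mp fun s => by
      rcases s.eq_empty_or_nonempty with rfl | ⟨i, hi⟩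
      · simp
      · calc #s ≤ ℓ := (card_le_univ s).trans_eq (ZMod.card ℓ)
          _ = #(A (g i.val)) := (hA _).symm
          _ ≤ _ := card_le_card (subset_biUnion_of_mem (fun i : ZMod ℓ => A (g i.val)) hi)
  refine ⟨φ, hφ, fun e he => ?_⟩
  obtain ⟨i, hi, rfl⟩ := hF e he
  have hlt := i.val_lt
  have hval : ((i.val : ℕ) : ZMod ℓ) = i := ZMod.natCast_zmod_val i
  have hk : i.val + 2 ≤ ℓ := by
    by_contra hcon
    refine hi (eq_neg_of_add_eq_zero_left ?_)
    rw [← hval, ← Nat.cast_succ, (by omega : i.val.succ = ℓ), ZMod.natCast_self]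
  have h₁ : g (i + 1).val = g (i.val + 1) := by
    rw [← ZMod.val_natCast_of_lt (by omega : i.val + 1 < ℓ), Nat.cast_succ, hval]
  have h₂ : g (i + 2).val = g (i.val + 2) := by
    have hi2 : i + 2 = ((i.val + 2 : ℕ) : ZMod ℓ) := by push_cast; rw [hval]
    rcases hk.lt_or_eq with h | h
    · rw [hi2, ZMod.val_natCast_of_lt h]
    · rw [hi2, h, ZMod.natCast_self, ZMod.val_zero, hg]
  have hT := hwalk i.val hk
  obtain ⟨hab, hac, hbc⟩ := ne_of_mem_fiveCycleEdges hT
  have hne : ∀ s, (A s).Nonempty := fun s => card_pos.mp (by rw [hA]; omega)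
  choose a ha using hne
  let x : Fin 5 → V := fun s => if s = g i.val then φ i else if s = g (i.val + 1) then φ (i + 1)
    else if s = g (i.val + 2) then φ (i + 2) else a s
  have hx := hbox x (fun s => by
    simp only [x]
    split_ifs with e₁ e₂ e₃
    · exact e₁ ▸ hmem i
    · exact e₂ ▸ h₁ ▸ hmem (i + 1)
    · exact e₃ ▸ h₂ ▸ hmem (i + 2)
    · exact ha s) _ hT
  simpa [image_insert, x, hab.symm, hac.symm, hbc.symm] using hx

/-- For every `ℓ ≥ 5`, the tight cycle of length `ℓ` with one edge removed (with vertices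
`v_1, …, v_ℓ` identified with `0, …, ℓ-1` in `ZMod ℓ`, and edges all consecutive cyclic
triples `{i, i+1, i+2}` except the one starting at `-1`, i.e. except `{v_ℓ, v_1, v_2}`)
has codegree Turán density zero. -/
theorem stmt4 (ℓ : ℕ) (hℓ : 5 ≤ ℓ) (F : ThreeGraph (ZMod ℓ))
    (hF : ∀ e : Finset (ZMod ℓ), e ∈ F.edges ↔
      ∃ i : ZMod ℓ, i ≠ -1 ∧ e = {i, i + 1, i + 2}) :
    piCo F = 0 := by
  refine le_antisymm (Real.sSup_nonpos ?_) (Real.sSup_nonneg fun x hx => hx.1)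
  rintro x ⟨-, -, hx⟩
  by_contra! hpos
  obtain ⟨n₀, hn₀⟩ := exists_blowup_fiveCycle hpos (t := ℓ) (by omega)
  obtain ⟨n, hn, H, hfree, hdeg⟩ := hx n₀
  obtain ⟨A, hA, hbox⟩ := hn₀ H (by simpa using hn) (by simpa using hdeg)
  exact hfree (hasCopy_of_blowup_fiveCycle hℓ F (fun e he => (hF e).mp he) H A hA hbox)
end

section
/- For every integer r ≥ 3, the codegree Turán density of the zycle of length r with one edge removed satisfies π_co(Z_r^{(3)−}) = 0. -/
open Finset

variable {α β : Type*}

section CodegreeLemmas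

/-- If every `p ∈ P` is related to at least an `x`-fraction of `V`, then some `v : V` is related to
at least an `x`-fraction of `P`. -/
lemma exists_popular_vertex {V : Type*} [Fintype V] [Nonempty V] {ι : Type*} (P : Finset ι) (R : ι → V → Prop)
    [∀ p, DecidablePred (R p)] (x : ℝ)
    (h : ∀ p ∈ P, x * Fintype.card V ≤ ((univ.filter (R p)).card : ℝ)) :
    ∃ v : V, x * P.card ≤ ((P.filter (fun p => R p v)).card : ℝ) := by
  have hsum : ∑ _v : V, x * (P.card : ℝ) ≤ ∑ v : V, ((P.filter (fun p => R p v)).card : ℝ) := by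
    have hcomm : ∑ v : V, (P.filter (fun p => R p v)).card
        = ∑ p ∈ P, (univ.filter (R p)).card := by
      simp only [card_filter]
      exact sum_comm
    calc ∑ _v : V, x * (P.card : ℝ) = ∑ _p ∈ P, x * (Fintype.card V : ℝ) := by
          simp only [sum_const, card_univ, nsmul_eq_mul]
          ring
      _ ≤ ∑ p ∈ P, ((univ.filter (R p)).card : ℝ) := sum_le_sum h
      _ = _ := by exact_mod_cast hcomm.symm
  obtain ⟨v, -, hv⟩ := exists_le_of_sum_le univ_nonempty hsum
  exact ⟨v, hv⟩

variable {V : Type*} [DecidableEq V]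

lemma ThreeGraph.ne_of_mem {H : ThreeGraph V} {u v w : V}
    (h : ({u, v, w} : Finset V) ∈ H.edges) : u ≠ v ∧ u ≠ w ∧ v ≠ w := by
  have h3 := H.card_eq _ h
  refine ⟨?_, ?_, ?_⟩
  · rintro rfl
    have := card_le_two (a := u) (b := w)
    simp only [insert_eq_of_mem, mem_insert, true_or] at h3
    omega
  · rintro rfl
    have := card_le_two (a := u) (b := v)
    rw [Finset.insert_comm, insert_eq_of_mem (mem_singleton_self u), Finset.pair_comm] at h3
    omega
  · rintro rfl
    have := card_le_two (a := u) (b := v)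
    simp only [insert_eq_of_mem, mem_singleton] at h3
    omega

/-- The ordered pairs of distinct vertices lying in no link of a vertex of `A`. -/
def uncoveredPairs [Fintype V] (H : ThreeGraph V) (A : Finset V) : Finset (V × V) :=
  univ.filter (fun p => p.1 ≠ p.2 ∧ ∀ a ∈ A, ({p.1, p.2, a} : Finset V) ∉ H.edges)

/-- The links of few vertices cover almost all pairs. -/
lemma exists_card_uncoveredPairs_le [Fintype V] [Nonempty V] (H : ThreeGraph V) {x : ℝ} (hx : x ≤ 1)
    (hco : ∀ u v : V, u ≠ v → x * Fintype.card V ≤ (codeg H u v : ℝ)) (m : ℕ) :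
    ∃ A : Finset V, A.card ≤ m ∧
      ((uncoveredPairs H A).card : ℝ) ≤ (1 - x) ^ m * (Fintype.card V : ℝ) ^ 2 := by
  induction m with
  | zero =>
    refine ⟨∅, by simp, ?_⟩
    have : (uncoveredPairs H ∅).card ≤ Fintype.card V * Fintype.card V := by
      rw [← Fintype.card_prod]
      exact card_le_univ _
    rw [pow_zero, one_mul, sq]
    exact_mod_cast this
  | succ m ih =>
    obtain ⟨A, hA, hcard⟩ := ih
    obtain ⟨a, ha⟩ := exists_popular_vertex (uncoveredPairs H A)
      (fun p a => ({p.1, p.2, a} : Finset V) ∈ H.edges) x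
      (fun p hp => hco p.1 p.2 (mem_filter.1 hp).2.1)
    refine ⟨insert a A, (card_insert_le _ _).trans (by omega), ?_⟩
    have hsub : uncoveredPairs H (insert a A) ⊆ (uncoveredPairs H A).filter
        (fun p => ¬ ({p.1, p.2, a} : Finset V) ∈ H.edges) := by
      intro p hp
      simp only [uncoveredPairs, mem_filter, mem_univ, true_and, mem_insert, forall_eq_or_imp]
        at hp ⊢
      tauto
    have hle : ((uncoveredPairs H (insert a A)).card : ℝ) ≤ _ :=
      Nat.cast_le.2 (card_le_card hsub)
    have hsplit : (((uncoveredPairs H A).filter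
          (fun p => ({p.1, p.2, a} : Finset V) ∈ H.edges)).card : ℝ)
        + ((uncoveredPairs H A).filter
          (fun p => ¬ ({p.1, p.2, a} : Finset V) ∈ H.edges)).card = (uncoveredPairs H A).card := by
      exact_mod_cast card_filter_add_card_filter_not _
    calc ((uncoveredPairs H (insert a A)).card : ℝ)
        ≤ (1 - x) * (uncoveredPairs H A).card := by linarith
      _ ≤ (1 - x) * ((1 - x) ^ m * (Fintype.card V : ℝ) ^ 2) :=
          mul_le_mul_of_nonneg_left hcard (by linarith)
      _ = _ := by ring

/-- Every set `W` disjoint from `A` has a large subset which, for each `a ∈ A`, lies in the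
neighbourhood of a pair containing `a`. -/
lemma exists_common_neighborhood [Fintype V] [Nonempty V] (H : ThreeGraph V) {x : ℝ} (hx : 0 ≤ x)
    (hco : ∀ u v : V, u ≠ v → x * Fintype.card V ≤ (codeg H u v : ℝ)) (W A : Finset V)
    (hWA : Disjoint W A) :
    ∃ D ⊆ W, x ^ A.card * W.card ≤ (D.card : ℝ) ∧
      ∀ a ∈ A, ∃ b, ∀ w ∈ D, ({a, b, w} : Finset V) ∈ H.edges := by
  induction A using Finset.induction_on with
  | empty => exact ⟨W, Subset.rfl, by simp, by simp⟩
  | insert a A haA ih =>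
    rw [disjoint_insert_right] at hWA
    obtain ⟨D, hDW, hcard, hD⟩ := ih hWA.2
    obtain ⟨b, hb⟩ := exists_popular_vertex D
      (fun w b => ({a, b, w} : Finset V) ∈ H.edges) x (by
        intro w hw
        have := hco a w (fun h => hWA.1 (h ▸ hDW hw))
        simpa only [codeg, Finset.pair_comm w] using this)
    refine ⟨D.filter (fun w => ({a, b, w} : Finset V) ∈ H.edges),
      (filter_subset _ _).trans hDW, ?_, ?_⟩
    · rw [card_insert_of_notMem haA, pow_succ']
      calc x * x ^ A.card * W.card = x * (x ^ A.card * W.card) := by ring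
        _ ≤ x * D.card := mul_le_mul_of_nonneg_left hcard hx
        _ ≤ _ := hb
    · intro a' ha'
      rcases mem_insert.1 ha' with rfl | h
      · exact ⟨b, fun w hw => (mem_filter.1 hw).2⟩
      · obtain ⟨b', hb'⟩ := hD a' h
        exact ⟨b', fun w hw => hb' w (mem_filter.1 hw).1⟩

/-- The pairs `{f (2 * i), f (2 * i + 1)}`, for `i ≤ k`, are pairwise disjoint and each of them but
the first lies in the neighbourhood of its predecessor. -/
def IsPairChain (H : ThreeGraph V) (k : ℕ) (f : ℕ → V) : Prop :=
  Set.InjOn f (Set.Iio (2 * k + 2)) ∧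
    ∀ i < k, ({f (2 * i), f (2 * i + 1), f (2 * i + 2)} : Finset V) ∈ H.edges ∧
      ({f (2 * i), f (2 * i + 1), f (2 * i + 3)} : Finset V) ∈ H.edges

/-- A chain can be extended by a pair of new vertices in the neighbourhood of its last pair. -/
lemma IsPairChain.extend {H : ThreeGraph V} {k : ℕ} {f : ℕ → V} (hf : IsPairChain H k f) {y z : V}
    (hyz : y ≠ z) (hy : ∀ i < 2 * k + 2, f i ≠ y) (hz : ∀ i < 2 * k + 2, f i ≠ z)
    (hey : ({f (2 * k), f (2 * k + 1), y} : Finset V) ∈ H.edges)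
    (hez : ({f (2 * k), f (2 * k + 1), z} : Finset V) ∈ H.edges) :
    ∃ g : ℕ → V, IsPairChain H (k + 1) g ∧ (∀ i < 2 * k + 2, g i = f i) ∧
      g (2 * k + 2) = y ∧ g (2 * k + 3) = z := by
  obtain ⟨g, hg⟩ : ∃ g : ℕ → V, g = fun i => if i < 2 * k + 2 then f i else
    if i = 2 * k + 2 then y else z := ⟨_, rfl⟩
  have hlt : ∀ i < 2 * k + 2, g i = f i := fun i hi => by simp [hg, hi]
  have hgy : g (2 * k + 2) = y := by simp [hg]
  have hgz : g (2 * k + 3) = z := by simp [hg]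
  refine ⟨g, ⟨?_, ?_⟩, hlt, hgy, hgz⟩
  · intro i hi j hj hij
    simp only [Set.mem_Iio] at hi hj
    have hcases : ∀ l < 2 * (k + 1) + 2, l < 2 * k + 2 ∨ l = 2 * k + 2 ∨ l = 2 * k + 3 := by
      intro l hl
      omega
    rcases hcases i hi with hi' | rfl | rfl <;> rcases hcases j hj with hj' | rfl | rfl
    · rw [hlt i hi', hlt j hj'] at hij
      exact hf.1 hi' hj' hij
    · exact absurd (by rw [← hlt i hi', hij, hgy]) (hy i hi')
    · exact absurd (by rw [← hlt i hi', hij, hgz]) (hz i hi')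
    · exact absurd (by rw [← hlt j hj', ← hij, hgy]) (hy j hj')
    · rfl
    · exact absurd (by rw [← hgy, hij, hgz]) hyz
    · exact absurd (by rw [← hlt j hj', ← hij, hgz]) (hz j hj')
    · exact absurd (by rw [← hgy, ← hij, hgz]) hyz
    · rfl
  · intro i hi
    rcases Nat.lt_succ_iff_lt_or_eq.1 hi with h | rfl
    · rw [hlt (2 * i) (by omega), hlt (2 * i + 1) (by omega), hlt (2 * i + 2) (by omega),
        hlt (2 * i + 3) (by omega)]
      exact hf.2 i h
    · rw [hlt (2 * i) (by omega), hlt (2 * i + 1) (by omega), hgy, hgz]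
      exact ⟨hey, hez⟩

/-- The neighbours of the last pair of a chain, without the vertices of the chain and of `X`. -/
def freshNeighbors [Fintype V] (H : ThreeGraph V) (X : Finset V) (k : ℕ) (f : ℕ → V) : Finset V :=
  univ.filter (fun w => ({f (2 * k), f (2 * k + 1), w} : Finset V) ∈ H.edges) \
    (X ∪ (range (2 * k + 2)).image f)

lemma mem_freshNeighbors [Fintype V] {H : ThreeGraph V} {X : Finset V} {k : ℕ} {f : ℕ → V} {w : V}
    (hw : w ∈ freshNeighbors H X k f) :
    ({f (2 * k), f (2 * k + 1), w} : Finset V) ∈ H.edges ∧ w ∉ X ∧ ∀ i < 2 * k + 2, f i ≠ w := by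
  simp only [freshNeighbors, mem_sdiff, mem_filter, mem_univ, true_and, mem_union, mem_image,
    mem_range, not_or, not_exists, not_and] at hw
  exact ⟨hw.1, hw.2.1, hw.2.2⟩

lemma le_card_freshNeighbors [Fintype V] (H : ThreeGraph V) {x : ℝ}
    (hco : ∀ u v : V, u ≠ v → x * Fintype.card V ≤ (codeg H u v : ℝ)) (X : Finset V) {k : ℕ}
    {f : ℕ → V} (hf : IsPairChain H k f) :
    x * Fintype.card V - X.card - (2 * k + 2) ≤ ((freshNeighbors H X k f).card : ℝ) := by
  have hne : f (2 * k) ≠ f (2 * k + 1) := fun h => by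
    have := hf.1 (by simp) (by simp) h
    omega
  have h1 := hco _ _ hne
  have h2 : codeg H (f (2 * k)) (f (2 * k + 1)) ≤
      (freshNeighbors H X k f).card + (X.card + (2 * k + 2)) := by
    have h3 := le_card_sdiff (X ∪ (range (2 * k + 2)).image f)
      (univ.filter (fun w => ({f (2 * k), f (2 * k + 1), w} : Finset V) ∈ H.edges))
    have h4 := card_union_le X ((range (2 * k + 2)).image f)
    have h5 : ((range (2 * k + 2)).image f).card ≤ 2 * k + 2 := by
      simpa using card_image_le (s := range (2 * k + 2)) (f := f)
    unfold codeg freshNeighbors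
    omega
  have h6 : (codeg H (f (2 * k)) (f (2 * k + 1)) : ℝ) ≤
      (freshNeighbors H X k f).card + (X.card + (2 * k + 2)) := by exact_mod_cast h2
  linarith

/-- Chains avoiding a small set exist from every starting pair. -/
lemma exists_isPairChain [Fintype V] (H : ThreeGraph V) {x : ℝ}
    (hco : ∀ u v : V, u ≠ v → x * Fintype.card V ≤ (codeg H u v : ℝ)) {X : Finset V} {c d : V}
    (hcd : c ≠ d) (hc : c ∉ X) (hd : d ∉ X) (k : ℕ)
    (hbig : X.card + (2 * k + 2) ≤ x * Fintype.card V) :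
    ∃ f : ℕ → V, IsPairChain H k f ∧ (∀ i < 2 * k + 2, f i ∉ X) ∧ f 0 = c ∧ f 1 = d := by
  induction k with
  | zero =>
    refine ⟨fun i => if i = 0 then c else d, ⟨?_, by simp⟩, ?_, by simp, by simp⟩
    · intro i hi j hj hij
      simp only [Set.mem_Iio] at hi hj
      have hi' : i < 2 := by omega
      have hj' : j < 2 := by omega
      interval_cases i <;> interval_cases j <;> simp_all
    · intro i _
      dsimp only
      split_ifs <;> assumption
  | succ k ih =>
    push_cast at hbig
    obtain ⟨f, hf, hfX, hf0, hf1⟩ := ih (by linarith)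
    have hcard := le_card_freshNeighbors H hco X hf
    have htwo : 1 < (freshNeighbors H X k f).card := by
      have : (2 : ℝ) ≤ (freshNeighbors H X k f).card := by linarith
      exact_mod_cast this
    obtain ⟨y, hy, z, hz, hyz⟩ := one_lt_card.1 htwo
    obtain ⟨hey, hyX, hyf⟩ := mem_freshNeighbors hy
    obtain ⟨hez, hzX, hzf⟩ := mem_freshNeighbors hz
    obtain ⟨g, hg, hgf, hgy, hgz⟩ := hf.extend hyz hyf hzf hey hez
    refine ⟨g, hg, ?_, by rw [hgf 0 (by omega), hf0], by rw [hgf 1 (by omega), hf1]⟩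
    intro i hi
    rcases (by omega : i < 2 * k + 2 ∨ i = 2 * k + 2 ∨ i = 2 * k + 3) with h | rfl | rfl
    · rw [hgf i h]
      exact hfX i h
    · rwa [hgy]
    · rwa [hgz]

/-- A chain can be extended by a pair of new vertices spanning an edge with a vertex of `A`, provided
that few pairs are uncovered by `A`. -/
lemma IsPairChain.exists_extend_covered [Fintype V] {H : ThreeGraph V} {x : ℝ}
    (hco : ∀ u v : V, u ≠ v → x * Fintype.card V ≤ (codeg H u v : ℝ)) {A X : Finset V} {k : ℕ}
    {f : ℕ → V} (hf : IsPairChain H k f) (hfX : ∀ i < 2 * k + 2, f i ∉ X) (hx : 0 ≤ x)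
    (hbig : X.card + (2 * k + 2) + 1 ≤ x / 2 * Fintype.card V)
    (hA : ((uncoveredPairs H A).card : ℝ) < (x / 2 * Fintype.card V) ^ 2) :
    ∃ g : ℕ → V, IsPairChain H (k + 1) g ∧ (∀ i < 2 * (k + 1) + 2, g i ∉ X) ∧
      (∀ i < 2 * k + 2, g i = f i) ∧
      ∃ a ∈ A, ({g (2 * k + 2), g (2 * k + 3), a} : Finset V) ∈ H.edges := by
  set N := freshNeighbors H X k f with hN
  have hcard := le_card_freshNeighbors H hco X hf
  have hlarge : (x / 2 * Fintype.card V) ^ 2 ≤ (N.offDiag.card : ℝ) := by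
    have h1 : x / 2 * Fintype.card V + 1 ≤ (N.card : ℝ) := by linarith
    have h2 : (0 : ℝ) ≤ x / 2 * Fintype.card V := by positivity
    rw [offDiag_card, Nat.cast_sub (Nat.le_mul_self _)]
    push_cast
    nlinarith
  obtain ⟨⟨y, z⟩, hp, hcov⟩ : ∃ p ∈ N.offDiag, p ∉ uncoveredPairs H A := by
    by_contra! h
    have : (N.offDiag.card : ℝ) ≤ (uncoveredPairs H A).card := Nat.cast_le.2 (card_le_card h)
    linarith
  obtain ⟨hy, hz, hyz⟩ := mem_offDiag.1 hp
  obtain ⟨a, haA, ha⟩ : ∃ a ∈ A, ({y, z, a} : Finset V) ∈ H.edges := by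
    simpa [uncoveredPairs, show y ≠ z from hyz] using hcov
  obtain ⟨hey, hyX, hyf⟩ := mem_freshNeighbors hy
  obtain ⟨hez, hzX, hzf⟩ := mem_freshNeighbors hz
  obtain ⟨g, hg, hgf, hgy, hgz⟩ := hf.extend hyz hyf hzf hey hez
  dsimp only at hgy hgz
  refine ⟨g, hg, ?_, hgf, a, haA, by rwa [hgy, hgz]⟩
  intro i hi
  rcases (by omega : i < 2 * k + 2 ∨ i = 2 * k + 2 ∨ i = 2 * k + 3) with h | rfl | rfl
  · rw [hgf i h]
    exact hfX i h
  · rwa [hgy]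
  · rwa [hgz]

/-- A chain can be preceded by a pair of new vertices having the first pair of the chain in its
neighbourhood. -/
lemma IsPairChain.prepend {H : ThreeGraph V} {k : ℕ} {f : ℕ → V} (hf : IsPairChain H k f) {a b : V}
    (hab : a ≠ b) (ha : ∀ i < 2 * k + 2, f i ≠ a) (hb : ∀ i < 2 * k + 2, f i ≠ b)
    (h0 : ({a, b, f 0} : Finset V) ∈ H.edges) (h1 : ({a, b, f 1} : Finset V) ∈ H.edges) :
    ∃ g : ℕ → V, IsPairChain H (k + 1) g ∧ g 0 = a ∧ ∀ i, g (i + 2) = f i := by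
  obtain ⟨g, hg⟩ : ∃ g : ℕ → V, g = fun i => if i = 0 then a else if i = 1 then b else f (i - 2) :=
    ⟨_, rfl⟩
  have hg0 : g 0 = a := by simp [hg]
  have hg1 : g 1 = b := by simp [hg]
  have hgf : ∀ i, g (i + 2) = f i := by simp [hg]
  refine ⟨g, ⟨?_, ?_⟩, hg0, hgf⟩
  · intro i hi j hj hij
    simp only [Set.mem_Iio] at hi hj
    match i, j with
    | 0, 0 => rfl
    | 1, 1 => rfl
    | 0, 1 => exact absurd (by rw [← hg0, hij, hg1]) hab
    | 1, 0 => exact absurd (by rw [← hg0, ← hij, hg1]) hab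
    | 0, j + 2 => exact absurd (by rw [← hgf, ← hij, hg0]) (ha j (by omega))
    | 1, j + 2 => exact absurd (by rw [← hgf, ← hij, hg1]) (hb j (by omega))
    | i + 2, 0 => exact absurd (by rw [← hgf, hij, hg0]) (ha i (by omega))
    | i + 2, 1 => exact absurd (by rw [← hgf, hij, hg1]) (hb i (by omega))
    | i + 2, j + 2 =>
      rw [hgf, hgf] at hij
      have := hf.1 (show i < 2 * k + 2 by omega) (show j < 2 * k + 2 by omega) hij
      omega
  · intro i hi
    match i with
    | 0 =>
      have h2 : g 2 = f 0 := hgf 0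
      have h3 : g 3 = f 1 := hgf 1
      simp only [Nat.mul_zero, Nat.zero_add, hg0, hg1, h2, h3]
      exact ⟨h0, h1⟩
    | i + 1 =>
      have := hf.2 i (by omega)
      rwa [← hgf, ← hgf, ← hgf, ← hgf] at this

/-- A large 3-graph of positive minimum codegree has a chain of `k + 3` pairs whose last pair forms
an edge with the first vertex. -/
lemma exists_closed_isPairChain {x : ℝ} (hx0 : 0 < x) (hx1 : x ≤ 1) (k : ℕ) :
    ∃ n₀ : ℕ, ∀ (V : Type) [Fintype V] [DecidableEq V] (H : ThreeGraph V),
      n₀ ≤ Fintype.card V →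
      (∀ u v : V, u ≠ v → x * Fintype.card V ≤ (codeg H u v : ℝ)) →
      ∃ g : ℕ → V, IsPairChain H (k + 2) g ∧
        ({g (2 * k + 4), g (2 * k + 5), g 0} : Finset V) ∈ H.edges := by
  obtain ⟨m, hm⟩ := exists_pow_lt_of_lt_one (show 0 < (x / 2) ^ 2 by positivity)
    (show 1 - x < 1 by linarith)
  obtain ⟨n₁, hn₁⟩ := exists_nat_ge ((m + m + (2 * k + 2) + 1) / (x / 2))
  obtain ⟨n₂, hn₂⟩ := exists_nat_ge (2 / x ^ m + m)
  refine ⟨n₁ + n₂ + 1, fun V _ _ H hn hco => ?_⟩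
  have hpos : 0 < Fintype.card V := by omega
  have : Nonempty V := Fintype.card_pos_iff.1 hpos
  have hnR : (n₁ : ℝ) + n₂ + 1 ≤ Fintype.card V := by exact_mod_cast hn
  have hn1 : (m + m + (2 * k + 2) + 1 : ℝ) ≤ x / 2 * Fintype.card V := by
    have h : (m + m + (2 * k + 2) + 1 : ℝ) / (x / 2) ≤ Fintype.card V := by
      have : (0 : ℝ) ≤ n₂ := Nat.cast_nonneg _
      linarith
    rw [div_le_iff₀ (by positivity)] at h
    linarith
  have hn2 : 2 ≤ x ^ m * ((Fintype.card V : ℝ) - m) := by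
    have h : 2 / x ^ m ≤ (Fintype.card V : ℝ) - m := by
      have : (0 : ℝ) ≤ n₁ := Nat.cast_nonneg _
      linarith
    rw [div_le_iff₀ (by positivity)] at h
    linarith
  obtain ⟨A, hAm, hAcov⟩ := exists_card_uncoveredPairs_le H hx1 hco m
  obtain ⟨D, -, hDcard, hD⟩ := exists_common_neighborhood H hx0.le hco (univ \ A) A sdiff_disjoint
  have hDtwo : 1 < D.card := by
    have hAmR : (A.card : ℝ) ≤ m := by exact_mod_cast hAm
    have hW : (Fintype.card V : ℝ) - m ≤ ((univ \ A).card : ℝ) := by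
      rw [card_sdiff_of_subset (subset_univ _), card_univ, Nat.cast_sub (card_le_univ _)]
      linarith
    have hpow : x ^ m ≤ x ^ A.card := pow_le_pow_of_le_one hx0.le hx1 hAm
    have : (2 : ℝ) ≤ D.card := by
      calc (2 : ℝ) ≤ x ^ m * ((Fintype.card V : ℝ) - m) := hn2
        _ ≤ x ^ m * ((univ \ A).card : ℝ) := by gcongr
        _ ≤ x ^ A.card * ((univ \ A).card : ℝ) := by gcongr
        _ ≤ _ := hDcard
    exact_mod_cast this
  choose! b hb using hD
  obtain ⟨c, hc, d, hd, hcd⟩ := one_lt_card.1 hDtwo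
  set X := A ∪ A.image b with hX
  have hDX : ∀ w ∈ D, w ∉ X := by
    intro w hw hwX
    rcases mem_union.1 hwX with h | h
    · exact (ThreeGraph.ne_of_mem (hb w h w hw)).2.1 rfl
    · obtain ⟨a, ha, rfl⟩ := mem_image.1 h
      exact (ThreeGraph.ne_of_mem (hb a ha _ hw)).2.2 rfl
  have hXcard : (X.card : ℝ) ≤ m + m := by
    have h1 := card_union_le A (A.image b)
    have h2 := card_image_le (s := A) (f := b)
    have : X.card ≤ m + m := by
      rw [hX]
      omega
    exact_mod_cast this
  obtain ⟨f, hf, hfX, hf0, hf1⟩ := exists_isPairChain H hco hcd (hDX c hc) (hDX d hd) k (by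
    have : x / 2 * Fintype.card V ≤ x * Fintype.card V := by gcongr; linarith
    linarith)
  obtain ⟨g, hg, hgX, hgf, a, haA, ha⟩ := hf.exists_extend_covered hco hfX hx0.le
    (by linarith) (lt_of_le_of_lt hAcov (by
      rw [mul_pow]
      have : (0 : ℝ) < Fintype.card V := by exact_mod_cast hpos
      gcongr))
  have hg0 : g 0 = c := by rw [hgf 0 (by omega), hf0]
  have hg1 : g 1 = d := by rw [hgf 1 (by omega), hf1]
  have hac := hb a haA c hc
  obtain ⟨p, hp, hp0, hpg⟩ := hg.prepend (ThreeGraph.ne_of_mem hac).1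
    (fun i hi h => hgX i hi (h ▸ mem_union_left _ haA))
    (fun i hi h => hgX i hi (h ▸ mem_union_right _ (mem_image_of_mem b haA)))
    (by rwa [hg0]) (by rw [hg1]; exact hb a haA d hd)
  exact ⟨p, hp, by rwa [hp0, hpg (2 * k + 2), hpg (2 * k + 3)]⟩

end CodegreeLemmas

/-- For every `r ≥ 3`, the zycle of length `r` with one edge removed (with `u_i = Sum.inl (i-1)`
and `v_i = Sum.inr (i-1)` for indices in `ZMod r`, edges `{u_i, v_i, u_{i+1}}` and
`{u_i, v_i, v_{i+1}}` for `1 ≤ i ≤ r-1` together with `{u_r, v_r, u_1}`) has codegree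
Turán density zero. -/
theorem stmt5 (r : ℕ) (hr : 3 ≤ r) (F : ThreeGraph (ZMod r ⊕ ZMod r))
    (hF : ∀ e : Finset (ZMod r ⊕ ZMod r), e ∈ F.edges ↔
      ((∃ i : ZMod r, i ≠ -1 ∧
          (e = {Sum.inl i, Sum.inr i, Sum.inl (i + 1)} ∨
           e = {Sum.inl i, Sum.inr i, Sum.inr (i + 1)})) ∨
        e = {Sum.inl (-1), Sum.inr (-1), Sum.inl 0})) :
    piCo F = 0 := by
  refine le_antisymm (Real.sSup_le ?_ le_rfl) (Real.sSup_nonneg fun x hx => hx.1)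
  rintro x ⟨-, hx1, hx⟩
  by_contra! hx0
  obtain ⟨k, rfl⟩ := Nat.exists_eq_add_of_le' hr
  obtain ⟨n₀, hn₀⟩ := exists_closed_isPairChain hx0 hx1 k
  obtain ⟨n, hn, H, hfree, hco⟩ := hx n₀
  obtain ⟨g, hg, hclose⟩ := hn₀ (Fin n) H (by simpa using hn) (by simpa using hco)
  refine hfree ⟨Sum.elim (fun i => g (2 * i.val)) (fun i => g (2 * i.val + 1)), ?_, ?_⟩
  · have hval : ∀ i : ZMod (k + 3), i.val < k + 3 := ZMod.val_lt
    have hinj : ∀ i j : ℕ, i < 2 * (k + 3) → j < 2 * (k + 3) → g i = g j → i = j :=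
      fun i j hi hj h => hg.1 (show i < _ by omega) (show j < _ by omega) h
    rintro (i | i) (j | j) hij <;> have hi := hval i <;> have hj := hval j <;>
      have h := hinj _ _ (by omega) (by omega) hij
    · exact congrArg _ (ZMod.val_injective _ (by omega))
    · omega
    · omega
    · exact congrArg _ (ZMod.val_injective _ (by omega))
  · have : Fact (1 < k + 3) := ⟨by omega⟩
    have hlast : (-1 : ZMod (k + 3)).val = k + 2 := ZMod.val_neg_one (k + 2)
    intro e he
    rcases (hF e).1 he with ⟨i, hi, he⟩ | rfl
    · have hlt : i.val < k + 2 := by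
        have h1 := ZMod.val_lt i
        have h2 : i.val ≠ k + 2 := fun h => hi (ZMod.val_injective _ (h.trans hlast.symm))
        omega
      have hsucc : (i + 1).val = i.val + 1 := by
        have hone : (1 : ZMod (k + 3)).val = 1 := ZMod.val_one (k + 3)
        rw [ZMod.val_add_of_lt (by omega), hone]
      have hedge := hg.2 i.val hlt
      rcases he with rfl | rfl
      · simpa only [image_insert, image_singleton, Sum.elim_inl, Sum.elim_inr, hsucc,
          Nat.mul_add] using hedge.1
      · simpa only [image_insert, image_singleton, Sum.elim_inl, Sum.elim_inr, hsucc,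
          Nat.mul_add] using hedge.2
    · simpa only [image_insert, image_singleton, Sum.elim_inl, Sum.elim_inr, hlast,
        ZMod.val_zero, Nat.mul_add] using hclose
end
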